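/- arXiv:1111.1320 — 3 statements merged into one kernel-verified Lean document; each statement's English description precedes it below -/
import Mathlib

section
/- For 1 ≤ k ≤ a, the odd elementary symmetric polynomial ε_k lies in OΛ_a (that is, ∂_i(ε_k) = 0 for all 1 ≤ i ≤ a−1). Moreover the following relations hold in OΛ_a: (i) ε_i ε_{2m−i} = ε_{2m−i} ε_i whenever 1 ≤ i and 2m−i ≤ a; (ii) ε_i ε_{2m+1−i} + (−1)^i ε_{2m+1−i} ε_i = (−1)^i ε_{i+1} ε_{2m−i} + ε_{2m−i} ε_{i+1} whenever 1 ≤ i and 2m−i ≤ a−1; (iii) ε_1 ε_{2m} + ε_{2m} ε_1 = 2 ε_{2m+1} whenever 1 < 2m ≤ a−1. -/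
open scoped BigOperators

/-- The defining anticommutation relations of the odd polynomial ring. -/
inductive OddRel (a : ℕ) : FreeAlgebra ℤ (Fin a) → FreeAlgebra ℤ (Fin a) → Prop
  | anticomm (i j : Fin a) (h : i ≠ j) :
      OddRel a (FreeAlgebra.ι ℤ i * FreeAlgebra.ι ℤ j)
        (-(FreeAlgebra.ι ℤ j * FreeAlgebra.ι ℤ i))

/-- The ring of odd polynomials in `a` variables over `ℤ`. -/
abbrev OPol (a : ℕ) : Type := RingQuot (OddRel a)

/-- The variable `x_{i+1}` (`0`-based index). -/
noncomputable def OX {a : ℕ} (i : Fin a) : OPol a :=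
  RingQuot.mkRingHom (OddRel a) (FreeAlgebra.ι ℤ i)

/-- The variable `x_i` (`1`-based index), `0` if out of range. -/
noncomputable def xv (a : ℕ) (i : ℕ) : OPol a :=
  if h : 1 ≤ i ∧ i ≤ a then OX ⟨i - 1, by omega⟩ else 0

/-- The signed variable `x̃_i = (−1)^{i−1} x_i` (`0`-based index, so the sign is `(−1)^i`). -/
noncomputable def xt (a : ℕ) (i : Fin a) : OPol a := (-1 : OPol a) ^ (i : ℕ) * OX i

/-- Odd elementary symmetric polynomial `ε_k`. -/
noncomputable def eps (a k : ℕ) : OPol a :=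
  ∑ t ∈ Finset.powersetCard k (Finset.univ : Finset (Fin a)),
    ((t.sort (· ≤ ·)).map (xt a)).prod

/-- Odd complete symmetric polynomial `h_k`. -/
noncomputable def hp (a k : ℕ) : OPol a :=
  ∑ σ : Sym (Fin a) k, (((σ : Multiset (Fin a)).sort (· ≤ ·)).map (xt a)).prod

/-- The ordered monomial `x_1^{c_1} ⋯ x_a^{c_a}`. -/
noncomputable def xmon {a : ℕ} (c : Fin a → ℕ) : OPol a :=
  ((List.finRange a).map fun i => OX i ^ c i).prod

/-- The staircase monomial `x^{δ_a} = x_1^{a−1} x_2^{a−2} ⋯ x_a^0`. -/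
noncomputable def xdelta (a : ℕ) : OPol a :=
  ((List.finRange a).map fun i => OX i ^ (a - 1 - (i : ℕ))).prod

/-- Composite of the operators `d i` along a word, leftmost letter acting last (outermost). -/
noncomputable def dword {a : ℕ} (d : ℕ → OPol a →+ OPol a) : List ℕ → (OPol a →+ OPol a)
  | [] => AddMonoidHom.id _
  | i :: l => (d i).comp (dword d l)

/-- The word `1, (2,1), (3,2,1), …, (a−1,…,2,1)` for the longest element, so that
`dword d (DList a) = ∂_1∘(∂_2∘∂_1)∘⋯∘(∂_{a−1}∘⋯∘∂_1) = D_a`. -/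
def DList (a : ℕ) : List ℕ :=
  ((List.range a).map fun b => (List.range b).reverse.map (· + 1)).flatten

/-- Left multiplication by `f` as a `ℤ`-linear endomorphism. -/
noncomputable def mulL {a : ℕ} (f : OPol a) : Module.End ℤ (OPol a) :=
  (AddMonoidHom.mulLeft f).toIntLinearMap

/-- The generators of the odd nilHecke ring inside `End_ℤ(OPol a)`. -/
noncomputable def onhGens (a : ℕ) (d : ℕ → OPol a →+ OPol a) :
    Set (Module.End ℤ (OPol a)) :=
  {T | (∃ i : Fin a, T = mulL (OX i)) ∨
    (∃ i : ℕ, 1 ≤ i ∧ i + 1 ≤ a ∧ T = (d i).toIntLinearMap)}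

/-- The simple transposition `s_i` (`1`-based) of `{1,…,a}`. -/
def sperm (a : ℕ) (i : ℕ) : Equiv.Perm (Fin a) :=
  if h : 1 ≤ i ∧ i + 1 ≤ a then Equiv.swap ⟨i - 1, by omega⟩ ⟨i, by omega⟩ else 1

/-- The permutation associated to a word in the simple transpositions. -/
def wordPerm (a : ℕ) (l : List ℕ) : Equiv.Perm (Fin a) := (l.map (sperm a)).prod

/-- Evaluation of an (even) multivariate polynomial at the squared variables `x_1², …, x_a²`. -/
noncomputable def sqEval {a : ℕ} (p : MvPolynomial (Fin a) ℤ) : OPol a :=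
  ∑ m ∈ p.support,
    MvPolynomial.coeff m p • ((List.finRange a).map fun i => OX i ^ (2 * m i)).prod

/-- The odd symmetrization operator `S(f) = (−1)^{C(a,3)} w₀(D_a(f·x^{δ_a}))`. -/
noncomputable def oddSymzn (a : ℕ) (d : ℕ → OPol a →+ OPol a) (W0 : OPol a →+* OPol a)
    (f : OPol a) : OPol a :=
  (-1 : OPol a) ^ Nat.choose a 3 * W0 (dword d (DList a) (f * xdelta a))

/-- The odd Schur polynomial `s_α = (−1)^{C(a,3)} w₀(D_a(x^α·x^{δ_a}))`. -/
noncomputable def schurP (a : ℕ) (d : ℕ → OPol a →+ OPol a) (W0 : OPol a →+* OPol a)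
    (α : Fin a → ℕ) : OPol a :=
  (-1 : OPol a) ^ Nat.choose a 3 * W0 (dword d (DList a) (xmon α * xdelta a))

/-- The 0-Hecke generator `∂̄_r = x_r ∘ ∂_r`. -/
noncomputable def dbar (a : ℕ) (d : ℕ → OPol a →+ OPol a) (r : ℕ) : OPol a →+ OPol a :=
  (AddMonoidHom.mulLeft (xv a r)).comp (d r)

/-- The `ℤ`-span of products of exactly `n` variables: the degree-`2n` component of `OPol a`. -/
def degComp (a n : ℕ) : Submodule ℤ (OPol a) :=
  Submodule.span ℤ {f : OPol a | ∃ l : List (Fin a), l.length = n ∧ f = (l.map OX).prod}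

/-- Odd Schubert polynomial `𝔰_w = ∂_{w⁻¹w₀}(x^{δ_a})` for a fixed choice `red` of
reduced expressions. -/
noncomputable def schubert (a : ℕ) (d : ℕ → OPol a →+ OPol a)
    (red : Equiv.Perm (Fin a) → List ℕ) (w : Equiv.Perm (Fin a)) : OPol a :=
  dword d (red (w⁻¹ * Fin.revPerm)) (xdelta a)

/-- Product of odd elementary symmetric polynomials along the parts of a partition,
in non-increasing order. -/
noncomputable def epsPart (a : ℕ) {n : ℕ} (p : Nat.Partition n) : OPol a :=
  (((p.parts.sort (· ≤ ·)).reverse).map (eps a)).prod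

section ListSymmetric

variable {R : Type*} [Ring R]

/-- The sum of all products of length-`k` sublists of `l`, for an integer index `k`. -/
def listEsymm : List R → ℤ → R
  | [], k => if k = 0 then 1 else 0
  | y :: l, k => listEsymm l k + y * listEsymm l (k - 1)

theorem listEsymm_of_neg (l : List R) {k : ℤ} (hk : k < 0) : listEsymm l k = 0 := by
  induction l generalizing k with
  | nil => simp [listEsymm, hk.ne]
  | cons y l ih => simp [listEsymm, ih hk, ih (show k - 1 < 0 by omega)]

theorem listEsymm_zero (l : List R) : listEsymm l 0 = 1 := by
  induction l with
  | nil => simp [listEsymm]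
  | cons y l ih => simp [listEsymm, ih, listEsymm_of_neg]

theorem sum_powersetCard_sort_prod {α : Type*} [LinearOrder α] (f : α → R) (s : Finset α)
    (k : ℕ) :
    ∑ t ∈ s.powersetCard k, ((t.sort (· ≤ ·)).map f).prod =
      listEsymm ((s.sort (· ≤ ·)).map f) k := by
  induction s using Finset.induction_on_min generalizing k with
  | empty =>
    cases k with
    | zero => simp [listEsymm]
    | succ k =>
      rw [Finset.powersetCard_eq_empty.2 (by simp)]
      simp [listEsymm, show (k : ℤ) + 1 ≠ 0 by omega]
  | insert m s hm ih =>
    have hms : m ∉ s := fun h => lt_irrefl _ (hm m h)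
    rw [Finset.sort_insert _ (fun b hb => (hm b hb).le) hms, List.map_cons, listEsymm]
    cases k with
    | zero => simp [listEsymm_zero, listEsymm_of_neg]
    | succ k =>
      have hnot : ∀ t ∈ s.powersetCard k, m ∉ t := fun t ht h =>
        hms ((Finset.mem_powersetCard.1 ht).1 h)
      rw [Finset.powersetCard_succ_insert hms, Finset.sum_union, Finset.sum_image, ih,
        Nat.cast_succ, add_sub_cancel_right, ← ih, Finset.mul_sum]
      · congr 1
        refine Finset.sum_congr rfl fun t ht => ?_
        rw [Finset.sort_insert _
          (fun b hb => (hm b ((Finset.mem_powersetCard.1 ht).1 hb)).le) (hnot t ht)]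
        simp
      · intro t ht u hu htu
        rw [← Finset.erase_insert (hnot t ht), ← Finset.erase_insert (hnot u hu)]
        exact congrArg (fun v => Finset.erase v m) htu
      · refine Finset.disjoint_left.2 fun t ht ht' => ?_
        obtain ⟨u, -, rfl⟩ := Finset.mem_image.1 ht'
        exact hms ((Finset.mem_powersetCard.1 ht).1 (Finset.mem_insert_self m u))

theorem listEsymm_mul_of_anticomm (y : R) (l : List R) (h : ∀ z ∈ l, y * z = -(z * y)) (k : ℤ) :
    (Even k → y * listEsymm l k = listEsymm l k * y) ∧
      (Odd k → y * listEsymm l k = -(listEsymm l k * y)) := by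
  induction l generalizing k with
  | nil =>
    by_cases hk : k = 0
    · subst hk; simp [listEsymm]
    · simp [listEsymm, hk]
  | cons z l ih =>
    have hz := h z List.mem_cons_self
    have ih' := ih fun w hw => h w (List.mem_cons_of_mem _ hw)
    refine ⟨fun hk => ?_, fun hk => ?_⟩
    · have h1 := (ih' k).1 hk
      have h2 := (ih' (k - 1)).2 (hk.sub_odd odd_one)
      rw [listEsymm]
      linear_combination (norm := noncomm_ring) h1 + hz * listEsymm l (k - 1) - z * h2
    · have h1 := (ih' k).2 hk
      have h2 := (ih' (k - 1)).1 (hk.sub_odd odd_one)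
      rw [listEsymm]
      linear_combination (norm := noncomm_ring) h1 + hz * listEsymm l (k - 1) - z * h2

/-- The quadratic relations satisfied by odd elementary symmetric polynomials. -/
structure OddEsymmRelations (e : ℤ → R) : Prop where
  comm : ∀ i j, Even (i + j) → e i * e j = e j * e i
  even : ∀ i j, Even i → Even j →
    e i * e (j + 1) + e (j + 1) * e i = e (i + 1) * e j + e j * e (i + 1)
  odd : ∀ i j, Odd i → Odd j →
    e i * e (j + 1) - e (j + 1) * e i = -(e (i + 1) * e j) + e j * e (i + 1)

theorem OddEsymmRelations.add_mul {e : ℤ → R} (he : OddEsymmRelations e) {y : R}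
    (heven : ∀ k, Even k → y * e k = e k * y) (hodd : ∀ k, Odd k → y * e k = -(e k * y)) :
    OddEsymmRelations fun k => e k + y * e (k - 1) where
  comm i j hij := by
    have h := he.comm i j hij
    have h' := he.comm (i - 1) (j - 1) (by
      rw [show i - 1 + (j - 1) = i + j - 2 by ring]; exact hij.sub even_two)
    rcases Int.even_or_odd i with hi | hi
    · have hj : Even j := (Int.even_add.1 hij).1 hi
      have hb := he.odd _ _ (hi.sub_odd odd_one) (hj.sub_odd odd_one)
      have hp := heven i hi
      have hq := heven j hj
      have hp' := hodd _ (hi.sub_odd odd_one)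
      have hq' := hodd _ (hj.sub_odd odd_one)
      simp only [sub_add_cancel] at hb
      linear_combination (norm := noncomm_ring) h - y * y * h' + y * hb
        - hp * e (j - 1) + hq * e (i - 1) + y * hp' * e (j - 1) - y * hq' * e (i - 1)
    · have hj : Odd j := by
        rw [← Int.not_even_iff_odd] at hi ⊢
        exact fun h => hi ((Int.even_add.1 hij).2 h)
      have hb := he.even _ _ (hi.sub_odd odd_one) (hj.sub_odd odd_one)
      have hp := hodd i hi
      have hq := hodd j hj
      have hp' := heven _ (hi.sub_odd odd_one)
      have hq' := heven _ (hj.sub_odd odd_one)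
      simp only [sub_add_cancel] at hb
      linear_combination (norm := noncomm_ring) h + y * y * h' + y * hb
        + hp * e (j - 1) - hq * e (i - 1) - y * hp' * e (j - 1) + y * hq' * e (i - 1)
  even i j hi hj := by
    have hb := he.even i j hi hj
    have hb' := he.odd _ _ (hi.sub_odd odd_one) (hj.sub_odd odd_one)
    have h1 := he.comm (i - 1) (j + 1) (by
      rw [show i - 1 + (j + 1) = i + j by ring]; exact hi.add hj)
    have h2 := he.comm (i + 1) (j - 1) (by
      rw [show i + 1 + (j - 1) = i + j by ring]; exact hi.add hj)
    have hp := heven i hi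
    have hq := heven j hj
    have hp' := hodd _ (hi.sub_odd odd_one)
    have hq' := hodd _ (hj.sub_odd odd_one)
    have hu := hodd _ (hi.add_odd odd_one)
    have hv := hodd _ (hj.add_odd odd_one)
    simp only [sub_add_cancel, add_sub_cancel_right] at *
    linear_combination (norm := noncomm_ring) hb - y * y * hb' + y * h1 + y * h2
      - hp * e j + hv * e (i - 1) + y * hp' * e j - y * hq * e (i - 1)
      - hu * e (j - 1) + hq * e i + y * hp * e (j - 1) - y * hq' * e i
  odd i j hi hj := by
    have hb := he.odd i j hi hj
    have hb' := he.even _ _ (hi.sub_odd odd_one) (hj.sub_odd odd_one)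
    have h1 := he.comm (i - 1) (j + 1) (by
      rw [show i - 1 + (j + 1) = i + j by ring]; exact hi.add_odd hj)
    have h2 := he.comm (i + 1) (j - 1) (by
      rw [show i + 1 + (j - 1) = i + j by ring]; exact hi.add_odd hj)
    have hp := hodd i hi
    have hq := hodd j hj
    have hp' := heven _ (hi.sub_odd odd_one)
    have hq' := heven _ (hj.sub_odd odd_one)
    have hu := heven _ (hi.add_odd odd_one)
    have hv := heven _ (hj.add_odd odd_one)
    simp only [sub_add_cancel, add_sub_cancel_right] at *
    linear_combination (norm := noncomm_ring) hb + y * y * hb' + y * h1 + y * h2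
      + hp * e j + hv * e (i - 1) - y * hp' * e j - y * hq * e (i - 1)
      - hu * e (j - 1) - hq * e i + y * hp * e (j - 1) + y * hq' * e i

theorem oddEsymmRelations_listEsymm {l : List R}
    (hl : l.Pairwise fun y z => y * z = -(z * y)) : OddEsymmRelations (listEsymm l) := by
  induction l with
  | nil =>
    refine ⟨fun i j _ => ?_, fun i j hi hj => ?_, fun i j hi hj => ?_⟩
    · simp only [listEsymm]; split_ifs <;> simp
    · have hi' : i + 1 ≠ 0 := fun h => by obtain ⟨c, rfl⟩ := hi; omega
      have hj' : j + 1 ≠ 0 := fun h => by obtain ⟨c, rfl⟩ := hj; omega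
      simp [listEsymm, hi', hj']
    · have hi' : i ≠ 0 := fun h => by subst h; simp at hi
      have hj' : j ≠ 0 := fun h => by subst h; simp at hj
      simp [listEsymm, hi', hj']
  | cons y l ih =>
    obtain ⟨hy, hl⟩ := List.pairwise_cons.1 hl
    exact (ih hl).add_mul (fun k => (listEsymm_mul_of_anticomm y l hy k).1)
      fun k => (listEsymm_mul_of_anticomm y l hy k).2

theorem map_listEsymm_append_eq_zero {s : R →+* R} {d : R →+ R}
    (hdL : ∀ f g, d (f * g) = d f * g + s f * d g) {l₁ l₂ : List R}
    (h₁ : ∀ y ∈ l₁, d y = 0) (h₂ : ∀ k, d (listEsymm l₂ k) = 0) (k : ℤ) :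
    d (listEsymm (l₁ ++ l₂) k) = 0 := by
  induction l₁ generalizing k with
  | nil => exact h₂ k
  | cons y l ih =>
    have ih' := ih fun z hz => h₁ z (List.mem_cons_of_mem _ hz)
    rw [List.cons_append, listEsymm, map_add, hdL, ih', ih', h₁ y List.mem_cons_self]
    simp

theorem map_listEsymm_cons_cons_eq_zero {s : R →+* R} {d : R →+ R}
    (hdL : ∀ f g, d (f * g) = d f * g + s f * d g) {y z : R} {l : List R} (hsum : d (y + z) = 0)
    (hprod : d (y * z) = 0) (hl : ∀ k, d (listEsymm l k) = 0) (k : ℤ) :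
    d (listEsymm (y :: z :: l) k) = 0 := by
  have h : listEsymm (y :: z :: l) k = listEsymm l k + (y + z) * listEsymm l (k - 1) +
      y * z * listEsymm l (k - 1 - 1) := by
    simp only [listEsymm]; noncomm_ring
  rw [h, map_add, map_add, hdL, hdL, hsum, hprod]
  simp [hl]

end ListSymmetric

theorem eps_eq_listEsymm (a k : ℕ) : eps a k = listEsymm ((List.finRange a).map (xt a)) k := by
  rw [eps, sum_powersetCard_sort_prod, Fin.sort_univ]

theorem OX_mul_OX {a : ℕ} {i j : Fin a} (h : i ≠ j) : (OX i * OX j : OPol a) = -(OX j * OX i) := by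
  have := RingQuot.mkRingHom_rel (OddRel.anticomm i j h)
  simpa [OX] using this

theorem xt_eq_or_neg {a : ℕ} (i : Fin a) : xt a i = OX i ∨ xt a i = -OX i := by
  rcases neg_one_pow_eq_or (OPol a) (i : ℕ) with h | h <;> rw [xt, h]
  · exact Or.inl (one_mul _)
  · exact Or.inr (neg_one_mul _)

theorem xt_mul_xt {a : ℕ} {i j : Fin a} (h : i ≠ j) :
    xt a i * xt a j = -(xt a j * xt a i) := by
  have key : ∀ {R : Type} [Ring R] {x y x' y' : R}, x * y = -(y * x) → x' = x ∨ x' = -x →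
      y' = y ∨ y' = -y → x' * y' = -(y' * x') := by
    rintro R _ x y _ _ hxy (rfl | rfl) (rfl | rfl) <;> simp [hxy]
  exact key (OX_mul_OX h) (xt_eq_or_neg i) (xt_eq_or_neg j)

theorem xt_pair_sign {a n : ℕ} (hn : n + 1 < a) :
    xt a ⟨n, by omega⟩ = OX ⟨n, by omega⟩ ∧ xt a ⟨n + 1, hn⟩ = -OX ⟨n + 1, hn⟩ ∨
      xt a ⟨n, by omega⟩ = -OX ⟨n, by omega⟩ ∧ xt a ⟨n + 1, hn⟩ = OX ⟨n + 1, hn⟩ := by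
  have key : ∀ {R : Type} [Ring R] (x y : R), (-1) ^ n * x = x ∧ (-1) ^ (n + 1) * y = -y ∨
      (-1) ^ n * x = -x ∧ (-1) ^ (n + 1) * y = y := by
    intro R _ x y
    rcases neg_one_pow_eq_or R n with h | h <;> simp [pow_succ, h]
  exact key _ _

theorem oddEsymmRelations_eps (a : ℕ) :
    OddEsymmRelations (listEsymm ((List.finRange a).map (xt a))) :=
  oddEsymmRelations_listEsymm <| List.pairwise_map.2 <|
    (List.nodup_finRange a).imp fun h => xt_mul_xt h

theorem xv_succ {a : ℕ} (i : Fin a) : xv a (i + 1) = OX i := by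
  simp [xv, Nat.succ_le_of_lt i.2]

theorem map_eps_eq_zero {a n : ℕ} (hn : n + 1 < a) {s : OPol a →+* OPol a}
    {d : OPol a →+ OPol a} (hs : s (OX ⟨n, by omega⟩) = -OX ⟨n + 1, hn⟩) (hd1 : d 1 = 0)
    (hdx : ∀ j : Fin a, d (OX j) = if (j : ℕ) = n ∨ (j : ℕ) = n + 1 then 1 else 0)
    (hdL : ∀ f g, d (f * g) = d f * g + s f * d g) (k : ℕ) : d (eps a k) = 0 := by
  have hxt : ∀ j : Fin a, (j : ℕ) ≠ n → (j : ℕ) ≠ n + 1 → d (xt a j) = 0 := by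
    intro j h1 h2
    have : d (OX j) = 0 := by simp [hdx, h1, h2]
    rcases xt_eq_or_neg j with hj | hj <;> simp [hj, this]
  have hsplit : List.finRange a = (List.finRange a).take n ++
      ⟨n, by omega⟩ :: ⟨n + 1, hn⟩ :: (List.finRange a).drop (n + 1 + 1) := by
    conv_lhs => rw [← List.take_append_drop n (List.finRange a),
      List.drop_eq_getElem_cons (by simp; omega),
      List.drop_eq_getElem_cons (by simp; omega)]
    simp
  have hdn : d (OX ⟨n, by omega⟩) = 1 := by simp [hdx]
  have hdn' : d (OX ⟨n + 1, hn⟩) = 1 := by simp [hdx]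
  have hdprod : d (OX ⟨n, by omega⟩ * OX ⟨n + 1, hn⟩) = 0 := by rw [hdL]; simp [hdn, hdn', hs]
  rw [eps_eq_listEsymm, hsplit, List.map_append, List.map_cons, List.map_cons]
  refine map_listEsymm_append_eq_zero hdL ?_
    (map_listEsymm_cons_cons_eq_zero hdL ?_ ?_ ?_) _
  · simp only [List.mem_map, List.mem_take_iff_getElem]
    rintro _ ⟨_, ⟨j, hj, rfl⟩, rfl⟩
    apply hxt <;> simp at hj ⊢ <;> omega
  · rcases xt_pair_sign hn with ⟨h, h'⟩ | ⟨h, h'⟩ <;> simp [h, h', hdn, hdn']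
  · have : xt a ⟨n, by omega⟩ * xt a ⟨n + 1, hn⟩ = -(OX ⟨n, by omega⟩ * OX ⟨n + 1, hn⟩) := by
      rcases xt_pair_sign hn with ⟨h, h'⟩ | ⟨h, h'⟩ <;> rw [h, h']
      · exact mul_neg (α := OPol a) _ _
      · exact neg_mul (α := OPol a) _ _
    rw [this, map_neg, hdprod, neg_zero]
  · intro k
    rw [← List.append_nil (List.map _ _)]
    refine map_listEsymm_append_eq_zero hdL ?_ (fun k => ?_) k
    · simp only [List.mem_map, List.mem_drop_iff_getElem]
      rintro _ ⟨_, ⟨j, hj, rfl⟩, rfl⟩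
      apply hxt <;> simp <;> omega
    · by_cases hk : k = 0 <;> simp [listEsymm, hk, hd1]

/-- the odd elementary symmetric polynomials are odd symmetric, and they
satisfy the stated relations. -/
theorem odd_elementary_symmetric (a : ℕ)
    (s : ℕ → OPol a →+* OPol a)
    (hs : ∀ i j : ℕ, 1 ≤ i → i + 1 ≤ a → 1 ≤ j → j ≤ a →
      s i (xv a j) =
        if j = i then -xv a (i + 1) else if j = i + 1 then -xv a i else -xv a j)
    (d : ℕ → OPol a →+ OPol a)
    (hd1 : ∀ i : ℕ, 1 ≤ i → i + 1 ≤ a → d i 1 = 0)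
    (hdx : ∀ i j : ℕ, 1 ≤ i → i + 1 ≤ a → 1 ≤ j → j ≤ a →
      d i (xv a j) = if j = i ∨ j = i + 1 then 1 else 0)
    (hdL : ∀ i : ℕ, 1 ≤ i → i + 1 ≤ a → ∀ f g : OPol a,
      d i (f * g) = d i f * g + s i f * d i g) :
    (∀ k : ℕ, 1 ≤ k → k ≤ a → ∀ i : ℕ, 1 ≤ i → i + 1 ≤ a → d i (eps a k) = 0) ∧
    (∀ i j : ℕ, 1 ≤ i → j ≤ a → Even (i + j) →
      eps a i * eps a j = eps a j * eps a i) ∧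
    (∀ i j : ℕ, 1 ≤ i → j + 1 ≤ a → Even (i + j) →
      eps a i * eps a (j + 1) + (-1 : OPol a) ^ i * (eps a (j + 1) * eps a i) =
        (-1 : OPol a) ^ i * (eps a (i + 1) * eps a j) + eps a j * eps a (i + 1)) ∧
    (∀ m : ℕ, 1 ≤ m → 2 * m + 1 ≤ a →
      eps a 1 * eps a (2 * m) + eps a (2 * m) * eps a 1 = 2 * eps a (2 * m + 1)) := by
  have he := oddEsymmRelations_eps a
  refine ⟨fun k _ _ i hi hia => ?_, fun i j _ _ hij => ?_, fun i j _ _ hij => ?_,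
    fun m _ _ => ?_⟩
  · obtain ⟨n, rfl⟩ := Nat.exists_eq_add_of_le' hi
    refine map_eps_eq_zero (s := s (n + 1)) (n := n) (by omega) ?_ (hd1 _ hi hia)
      (fun j => ?_) (hdL _ hi hia) k
    · rw [← xv_succ, ← xv_succ, hs _ _ hi hia (by simp) (by simp; omega)]
      simp
    · rw [← xv_succ, hdx _ _ hi hia (by omega) (by omega)]
      simp
  · simp only [eps_eq_listEsymm]
    exact he.comm _ _ (by exact_mod_cast hij)
  · simp only [eps_eq_listEsymm, Nat.cast_add, Nat.cast_one]
    rcases Nat.even_or_odd i with hi | hi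
    · have hj : Even j := (Nat.even_add.1 hij).1 hi
      have hsign : (-1 : OPol a) ^ i = 1 := Even.neg_one_pow (α := OPol a) hi
      rw [hsign, one_mul, one_mul]
      exact he.even i j (by exact_mod_cast hi) (by exact_mod_cast hj)
    · have hj : Odd j := by
        rw [← Nat.not_even_iff_odd] at hi ⊢
        exact fun h => hi ((Nat.even_add.1 hij).2 h)
      have hsign : ∀ x : OPol a, (-1) ^ i * x = -x := fun x =>
        (congrArg (· * x) (Odd.neg_one_pow (α := OPol a) hi)).trans (neg_one_mul x)
      rw [hsign, hsign, ← sub_eq_add_neg]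
      exact he.odd i j (by exact_mod_cast hi) (by exact_mod_cast hj)
  · have h := he.even 0 (2 * m) (by simp) (by simp)
    simp only [listEsymm_zero, one_mul, mul_one, zero_add] at h
    simp only [eps_eq_listEsymm, Nat.cast_add, Nat.cast_mul, Nat.cast_one, Nat.cast_ofNat]
    exact h.symm.trans (two_mul _).symm
end

section
/- For each w ∈ S_a fix a reduced expression w = s_{i_1}⋯s_{i_ℓ} and set ∂_w = ∂_{i_1}∘⋯∘∂_{i_ℓ}; for A = (r_1,…,r_a) ∈ ℕ^a write x^A for left multiplication by x_1^{r_1}⋯x_a^{r_a}. Then the operators x^A∘∂_w, for A ∈ ℕ^a and w ∈ S_a, are ℤ-linearly independent in the ring of additive endomorphisms of OPol_a, and likewise the operators ∂_w∘x^A are ℤ-linearly independent. Consequently, each of these two families is a ℤ-basis of the subring ONH_a of End(OPol_a) generated by the multiplication operators x_1,…,x_a and the odd divided difference operators ∂_1,…,∂_{a−1}. -/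
open scoped BigOperators

/-! ### The ring of odd polynomials -/

theorem OX_anticomm {a : ℕ} {i j : Fin a} (h : i ≠ j) :
    (OX i : OPol a) * OX j = -(OX j * OX i) := by
  have := RingQuot.mkRingHom_rel (OddRel.anticomm i j h)
  simpa only [OX, map_mul, map_neg] using this

theorem OX_eq_xv {a : ℕ} (i : Fin a) : (OX i : OPol a) = xv a (i + 1) := by
  have h : 1 ≤ (i : ℕ) + 1 ∧ (i : ℕ) + 1 ≤ a := by omega
  simp only [xv, dif_pos h, Nat.add_sub_cancel]

theorem xv_anticomm (a : ℕ) {i j : ℕ} (h : i ≠ j) :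
    xv a i * xv a j = -(xv a j * xv a i) := by
  unfold xv
  split_ifs with hi hj hj
  · exact OX_anticomm (by simp only [ne_eq, Fin.mk.injEq]; omega)
  all_goals simp

theorem closure_xv_eq_top (a : ℕ) :
    Subring.closure {f : OPol a | ∃ j, 1 ≤ j ∧ j ≤ a ∧ f = xv a j} = ⊤ := by
  rw [eq_top_iff]
  rintro f -
  obtain ⟨r, rfl⟩ := RingQuot.mkRingHom_surjective (OddRel a) f
  induction r using FreeAlgebra.induction with
  | grade0 n => simp
  | grade1 i => exact Subring.subset_closure ⟨i + 1, by omega, by omega, OX_eq_xv i⟩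
  | mul r t hr ht => rw [map_mul]; exact mul_mem hr ht
  | add r t hr ht => rw [map_add]; exact add_mem hr ht

/-- The automorphism of the commutative polynomial ring negating all variables before `i`. -/
noncomputable def negBelow {a : ℕ} (i : Fin a) :
    MvPolynomial (Fin a) ℤ →ₐ[ℤ] MvPolynomial (Fin a) ℤ :=
  MvPolynomial.aeval fun j => if j < i then -MvPolynomial.X j else MvPolynomial.X j

theorem negBelow_comm {a : ℕ} (i j : Fin a) (p : MvPolynomial (Fin a) ℤ) :
    negBelow i (negBelow j p) = negBelow j (negBelow i p) := by
  have : (negBelow i).comp (negBelow j) = (negBelow j).comp (negBelow i) := by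
    ext1 k
    simp only [negBelow, AlgHom.comp_apply, MvPolynomial.aeval_X]
    split_ifs <;> simp [*]
  exact DFunLike.congr_fun this p

/-- The action of `x_i` on the commutative polynomial ring, in the basis of ordered monomials. -/
noncomputable def oddMulX {a : ℕ} (i : Fin a) : Module.End ℤ (MvPolynomial (Fin a) ℤ) :=
  LinearMap.mulLeft ℤ (MvPolynomial.X i) * (negBelow i).toLinearMap

theorem oddMulX_apply {a : ℕ} (i : Fin a) (p : MvPolynomial (Fin a) ℤ) :
    oddMulX i p = MvPolynomial.X i * negBelow i p := rfl

theorem oddMulX_anticomm {a : ℕ} {i j : Fin a} (h : i ≠ j) :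
    oddMulX i * oddMulX j = -(oddMulX j * oddMulX i) := by
  refine LinearMap.ext fun p => ?_
  simp only [Module.End.mul_apply, LinearMap.neg_apply, oddMulX_apply, map_mul]
  rw [negBelow_comm j i]
  rcases lt_or_gt_of_ne h with h | h
  · simp [negBelow, h, h.not_gt]; ring
  · simp [negBelow, h, h.not_gt]; ring

/-- The representation of the odd polynomial ring on the commutative polynomial ring. -/
noncomputable def oddRep (a : ℕ) : OPol a →+* Module.End ℤ (MvPolynomial (Fin a) ℤ) :=
  RingQuot.lift ⟨(FreeAlgebra.lift ℤ oddMulX).toRingHom, by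
    rintro _ _ ⟨i, j, h⟩
    simpa using oddMulX_anticomm h⟩

theorem oddRep_OX {a : ℕ} (i : Fin a) : oddRep a (OX i) = oddMulX i := by
  simp [oddRep, OX]

theorem oddMulX_pow_apply {a : ℕ} (i : Fin a) (n : ℕ) {q : MvPolynomial (Fin a) ℤ}
    (hq : negBelow i q = q) : (oddMulX i ^ n) q = MvPolynomial.X i ^ n * q := by
  induction n with
  | zero => simp
  | succ n ih =>
    rw [pow_succ', Module.End.mul_apply, ih, oddMulX_apply, map_mul, hq, map_pow, pow_succ']
    simp [negBelow, mul_assoc]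

theorem oddRep_xmon_one {a : ℕ} (c : Fin a → ℕ) :
    oddRep a (xmon c) 1 = MvPolynomial.monomial (Finsupp.equivFunOnFinite.symm c) 1 := by
  have key : ∀ L : List (Fin a), L.Pairwise (· < ·) →
      oddRep a (L.map fun i => OX i ^ c i).prod 1 =
        (L.map fun i => (MvPolynomial.X i : MvPolynomial (Fin a) ℤ) ^ c i).prod := by
    intro L hL
    induction L with
    | nil => simp
    | cons i L ih =>
      rw [List.pairwise_cons] at hL
      simp only [List.map_cons, List.prod_cons, map_mul, map_pow, Module.End.mul_apply,
        ih hL.2, oddRep_OX]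
      apply oddMulX_pow_apply
      rw [map_list_prod, List.map_map]
      congr 1
      refine List.map_congr_left fun j hj => ?_
      simp [negBelow, (hL.1 j hj).not_gt]
  rw [xmon, key _ (List.sortedLT_finRange a).pairwise, ← Fin.prod_univ_def,
    MvPolynomial.monomial_eq, Finsupp.prod_fintype _ _ (by simp)]
  simp

theorem linearIndependent_xmon (a : ℕ) :
    LinearIndependent ℤ (xmon : (Fin a → ℕ) → OPol a) := by
  let φ : OPol a →ₗ[ℤ] MvPolynomial (Fin a) ℤ :=
    (LinearMap.applyₗ (1 : MvPolynomial (Fin a) ℤ)).comp (oddRep a).toAddMonoidHom.toIntLinearMap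
  refine LinearIndependent.of_comp φ ?_
  have : φ ∘ xmon = (MvPolynomial.basisMonomials (Fin a) ℤ) ∘ Finsupp.equivFunOnFinite.symm := by
    ext1 c
    exact (oddRep_xmon_one c).trans (by simp)
  rw [this]
  exact (MvPolynomial.basisMonomials (Fin a) ℤ).linearIndependent.comp _ (Equiv.injective _)

/-- The ordered monomial `x_1^{c_1} ⋯ x_a^{c_a}` in a sequence of ring elements. -/
def oddMonomial {R : Type*} [Ring R] {a : ℕ} (x : ℕ → R) (c : Fin a → ℕ) : R :=
  ((List.finRange a).map fun i : Fin a => x (i + 1) ^ c i).prod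

/-- `R` is a ring of odd polynomials in the variables `x 1, …, x a`. -/
structure IsOddPolynomialRing {R : Type*} [Ring R] (a : ℕ) (x : ℕ → R) : Prop where
  anticomm : ∀ i j, i ≠ j → x i * x j = -(x j * x i)
  closure_eq_top : Subring.closure {f | ∃ j, 1 ≤ j ∧ j ≤ a ∧ f = x j} = ⊤
  linearIndependent : LinearIndependent ℤ (oddMonomial x : (Fin a → ℕ) → R)

/-- The operators `d i` are the odd divided differences with twisting automorphisms `s i`. -/
structure IsOddDividedDifference {R : Type*} [Ring R] (a : ℕ) (x : ℕ → R) (s : ℕ → R →+* R)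
    (d : ℕ → R →+ R) : Prop where
  twist : ∀ i j, 1 ≤ i → i + 1 ≤ a → 1 ≤ j → j ≤ a →
    s i (x j) = if j = i then -x (i + 1) else if j = i + 1 then -x i else -x j
  map_one : ∀ i, 1 ≤ i → i + 1 ≤ a → d i 1 = 0
  map_var : ∀ i j, 1 ≤ i → i + 1 ≤ a → 1 ≤ j → j ≤ a →
    d i (x j) = if j = i ∨ j = i + 1 then 1 else 0
  leibniz : ∀ i, 1 ≤ i → i + 1 ≤ a → ∀ f g, d i (f * g) = d i f * g + s i f * d i g

/-- Composite of the operators `d i` along a word, as a linear map. -/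
def opWord {R : Type*} [Ring R] (d : ℕ → R →+ R) (l : List ℕ) : Module.End ℤ R :=
  (l.map fun i => (d i).toIntLinearMap).prod

/-- A choice of reduced words for all permutations of `Fin a`. -/
structure IsReducedWords (a : ℕ) (red : Equiv.Perm (Fin a) → List ℕ) : Prop where
  mem : ∀ w, ∀ i ∈ red w, 1 ≤ i ∧ i + 1 ≤ a
  perm_eq : ∀ w, wordPerm a (red w) = w
  length_le : ∀ w, ∀ l : List ℕ, (∀ i ∈ l, 1 ≤ i ∧ i + 1 ≤ a) → wordPerm a l = w →
    (red w).length ≤ l.length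

/-! ### Braid equivalence of words and normal forms -/

/-- Equality of words up to the braid relations of the symmetric group. -/
inductive BraidEq : List ℕ → List ℕ → Prop
  | refl (l) : BraidEq l l
  | symm {l l'} : BraidEq l l' → BraidEq l' l
  | trans {l l' l''} : BraidEq l l' → BraidEq l' l'' → BraidEq l l''
  | cons (i) {l l'} : BraidEq l l' → BraidEq (i :: l) (i :: l')
  | comm (i j l) : i + 2 ≤ j → BraidEq (i :: j :: l) (j :: i :: l)
  | braid (i l) : BraidEq (i :: (i + 1) :: i :: l) ((i + 1) :: i :: (i + 1) :: l)

namespace BraidEq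

theorem append_right {l l' : List ℕ} (h : BraidEq l l') (t : List ℕ) :
    BraidEq (l ++ t) (l' ++ t) := by
  induction h with
  | refl l => exact refl _
  | symm _ ih => exact ih.symm
  | trans _ _ ih ih' => exact ih.trans ih'
  | cons i _ ih => exact ih.cons i
  | comm i j l h => exact comm i j _ h
  | braid i l => exact braid i _

theorem append_left (t : List ℕ) {l l' : List ℕ} (h : BraidEq l l') :
    BraidEq (t ++ l) (t ++ l') := by
  induction t with
  | nil => exact h
  | cons i t ih => exact ih.cons i

theorem mem_iff {l l' : List ℕ} (h : BraidEq l l') (i : ℕ) : i ∈ l ↔ i ∈ l' := by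
  induction h with
  | refl l => rfl
  | symm _ ih => exact ih.symm
  | trans _ _ ih ih' => exact ih.trans ih'
  | cons i _ ih => simp [ih]
  | comm i j l h => simp only [List.mem_cons]; tauto
  | braid i l => simp only [List.mem_cons]; tauto

theorem length_eq {l l' : List ℕ} (h : BraidEq l l') : l.length = l'.length := by
  induction h with
  | refl l => rfl
  | symm _ ih => exact ih.symm
  | trans _ _ ih ih' => exact ih.trans ih'
  | cons i _ ih => simp [ih]
  | comm i j l h => simp
  | braid i l => simp

end BraidEq

/-- The increasing word `m+1-k, …, m-1, m` of length `k`. -/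
def runWord (m : ℕ) : ℕ → List ℕ
  | 0 => []
  | k + 1 => (m - k) :: runWord m k

/-- The normal form word of length `c 0 + ⋯ + c (m-1)` in the letters `1, …, m-1`. -/
def normalWord (c : ℕ → ℕ) : ℕ → List ℕ
  | 0 => []
  | m + 1 => runWord m (c m) ++ normalWord c m

theorem normalWord_congr {c c' : ℕ → ℕ} {m : ℕ} (h : ∀ b < m, c b = c' b) :
    normalWord c m = normalWord c' m := by
  induction m with
  | zero => rfl
  | succ m ih =>
    rw [normalWord, normalWord, h m (by omega), ih fun b hb => h b (by omega)]

theorem normalWord_update (c : ℕ → ℕ) (m k : ℕ) :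
    normalWord (Function.update c m k) (m + 1) = runWord m k ++ normalWord c m := by
  rw [normalWord, Function.update_self,
    normalWord_congr fun b hb => Function.update_of_ne (Nat.ne_of_lt hb) _ _]

theorem runWord_succ (m k : ℕ) : runWord (m + 1) (k + 1) = runWord m k ++ [m + 1] := by
  induction k with
  | zero => rfl
  | succ k ih => rw [runWord, ih, runWord, Nat.add_sub_add_right]; rfl

theorem mem_runWord {m k i : ℕ} (hk : k ≤ m) (hi : i ∈ runWord m k) : 1 ≤ i ∧ i ≤ m := by
  induction k with
  | zero => simp [runWord] at hi
  | succ k ih =>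
    rcases List.mem_cons.1 hi with rfl | hi
    · omega
    · exact ih (by omega) hi

theorem mem_normalWord {c : ℕ → ℕ} (hc : ∀ b, c b ≤ b) {m i : ℕ} (hi : i ∈ normalWord c m) :
    1 ≤ i ∧ i + 1 ≤ m := by
  induction m with
  | zero => simp [normalWord] at hi
  | succ m ih =>
    rcases List.mem_append.1 hi with hi | hi
    · have := mem_runWord (hc m) hi; omega
    · have := ih hi; omega

theorem BraidEq.cons_runWord_of_lt {m k i : ℕ} (hk : k ≤ m) (h : i + k + 1 ≤ m) :
    BraidEq (i :: runWord m k) (runWord m k ++ [i]) := by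
  induction k with
  | zero => exact refl _
  | succ k ih =>
    exact (comm i (m - k) _ (by omega)).trans ((ih (by omega) (by omega)).cons _)

theorem BraidEq.cons_runWord_of_gt {m k i : ℕ} (hk : k ≤ m) (h : m + 1 < i + 1 + k)
    (hi : i + 1 ≤ m) :
    BraidEq ((i + 1) :: runWord m k) (runWord m k ++ [i]) := by
  induction k with
  | zero => omega
  | succ k ih =>
    by_cases hik : m - k = i
    · obtain _ | k := k
      · omega
      have h1 : m - k = i + 1 := by omega
      rw [runWord, runWord, hik, h1]
      exact (braid i _).symm.trans
        (((cons_runWord_of_lt (by omega) (by omega)).cons (i + 1)).cons i)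
    · exact (comm (m - k) (i + 1) _ (by omega)).symm.trans
        ((ih (by omega) (by omega)).cons _)

/-- A word is either a normal form, or has a square, up to braid relations. -/
def Reducible (m : ℕ) (l : List ℕ) : Prop :=
  (∃ c : ℕ → ℕ, (∀ b, c b ≤ b) ∧ BraidEq l (normalWord c m)) ∨
    ∃ u j v, BraidEq l (u ++ j :: j :: v)

theorem Reducible.of_braidEq {m : ℕ} {l l' : List ℕ} (h : BraidEq l l') (h' : Reducible m l') :
    Reducible m l := by
  rcases h' with ⟨c, hc, h'⟩ | ⟨u, j, v, h'⟩
  · exact Or.inl ⟨c, hc, h.trans h'⟩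
  · exact Or.inr ⟨u, j, v, h.trans h'⟩

theorem update_le_self {c : ℕ → ℕ} (hc : ∀ b, c b ≤ b) {m k : ℕ} (hk : k ≤ m) (b : ℕ) :
    Function.update c m k b ≤ b := by
  rw [Function.update_apply]
  split_ifs with h
  · omega
  · exact hc b

theorem Reducible.runWord_append {m k : ℕ} {l : List ℕ} (hk : k ≤ m) (h : Reducible m l) :
    Reducible (m + 1) (runWord m k ++ l) := by
  rcases h with ⟨c, hc, h⟩ | ⟨u, j, v, h⟩
  · refine Or.inl ⟨Function.update c m k, update_le_self hc hk, ?_⟩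
    rw [normalWord_update]
    exact h.append_left _
  · refine Or.inr ⟨runWord m k ++ u, j, v, ?_⟩
    rw [List.append_assoc]
    exact h.append_left _

theorem reducible_cons_normalWord {c : ℕ → ℕ} (hc : ∀ b, c b ≤ b) {m i : ℕ} (h1 : 1 ≤ i)
    (h2 : i + 1 ≤ m) : Reducible m (i :: normalWord c m) := by
  induction m generalizing i with
  | zero => omega
  | succ m ih =>
    have hk := hc m
    rw [normalWord, ← List.cons_append]
    rcases lt_trichotomy (i + c m) m with h | h | h
    · refine .of_braidEq ((BraidEq.cons_runWord_of_lt hk (by omega)).append_right _) ?_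
      rw [List.append_assoc]
      exact (ih h1 (by omega)).runWord_append hk
    · refine Or.inl ⟨Function.update c m (c m + 1), update_le_self hc (by omega), ?_⟩
      rw [normalWord_update, runWord, show m - c m = i by omega]
      exact .refl _
    · obtain h | h : i + c m = m + 1 ∨ m + 1 < i + c m := by omega
      · obtain ⟨k, hk'⟩ : ∃ k, c m = k + 1 := ⟨c m - 1, by omega⟩
        refine Or.inr ⟨[], i, runWord m k ++ normalWord c m, ?_⟩
        rw [hk', runWord, show m - k = i by omega]
        exact .refl _
      · obtain ⟨i, rfl⟩ : ∃ i', i = i' + 1 := ⟨i - 1, by omega⟩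
        refine .of_braidEq
          ((BraidEq.cons_runWord_of_gt hk (by omega) (by omega)).append_right _) ?_
        rw [List.append_assoc]
        exact (ih (by omega) (by omega)).runWord_append hk

theorem normalWord_zero (m : ℕ) : normalWord (fun _ => 0) m = [] := by
  induction m with
  | zero => rfl
  | succ m ih => rw [normalWord, ih]; rfl

/-- All letters of the word `l` index simple transpositions of `{1, …, a}`. -/
def ValidWord (a : ℕ) (l : List ℕ) : Prop := ∀ i ∈ l, 1 ≤ i ∧ i + 1 ≤ a

theorem ValidWord.reducible {a : ℕ} {l : List ℕ} (hl : ValidWord a l) : Reducible a l := by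
  induction l with
  | nil =>
    refine Or.inl ⟨fun _ => 0, fun _ => Nat.zero_le _, ?_⟩
    rw [normalWord_zero]
    exact .refl _
  | cons i l ih =>
    have hi := hl i (by simp)
    rcases ih fun j hj => hl j (by simp [hj]) with ⟨c, hc, h⟩ | ⟨u, j, v, h⟩
    · exact .of_braidEq (h.cons i) (reducible_cons_normalWord hc hi.1 hi.2)
    · exact Or.inr ⟨i :: u, j, v, h.cons i⟩

theorem ValidWord.of_braidEq {a : ℕ} {l l' : List ℕ} (h : BraidEq l l') (hl : ValidWord a l) :
    ValidWord a l' := fun i hi => hl i ((h.mem_iff i).2 hi)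

/-! ### Permutations of words and normal forms -/

theorem sperm_of_valid {a i : ℕ} (h : 1 ≤ i ∧ i + 1 ≤ a) :
    sperm a i = Equiv.swap ⟨i - 1, by omega⟩ ⟨i, by omega⟩ := dif_pos h

theorem sperm_mul_self (a i : ℕ) : sperm a i * sperm a i = 1 := by
  unfold sperm
  split_ifs <;> simp

theorem sperm_comm {a i j : ℕ} (hi : 1 ≤ i ∧ i + 1 ≤ a) (hj : 1 ≤ j ∧ j + 1 ≤ a)
    (h : i + 2 ≤ j) : sperm a i * sperm a j = sperm a j * sperm a i := by
  rw [sperm_of_valid hi, sperm_of_valid hj]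
  refine (Equiv.Perm.disjoint_swap_swap ?_).commute
  simp only [List.nodup_cons, List.mem_cons, Fin.mk.injEq, List.not_mem_nil, or_false,
    not_or, not_false_eq_true, List.nodup_nil, and_true]
  omega

theorem swap_braid {α : Type*} [DecidableEq α] {p q r : α} (hpq : p ≠ q) (hpr : p ≠ r)
    (hqr : q ≠ r) : Equiv.swap p q * Equiv.swap q r * Equiv.swap p q =
      Equiv.swap q r * Equiv.swap p q * Equiv.swap q r := by
  rw [Equiv.swap_mul_swap_mul_swap hpq hpr, Equiv.swap_comm p q, Equiv.swap_comm q r,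
    Equiv.swap_mul_swap_mul_swap hqr.symm hpr.symm, Equiv.swap_comm]

theorem sperm_braid {a i : ℕ} (hi : 1 ≤ i) (hj : i + 2 ≤ a) :
    sperm a i * (sperm a (i + 1) * sperm a i) =
      sperm a (i + 1) * (sperm a i * sperm a (i + 1)) := by
  rw [sperm_of_valid ⟨hi, by omega⟩, sperm_of_valid ⟨by omega, hj⟩]
  simp only [Nat.add_sub_cancel, ← mul_assoc]
  apply swap_braid <;> simp only [ne_eq, Fin.mk.injEq] <;> omega

theorem wordPerm_cons (a i : ℕ) (l : List ℕ) :
    wordPerm a (i :: l) = sperm a i * wordPerm a l := by simp [wordPerm]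

theorem wordPerm_append (a : ℕ) (l l' : List ℕ) :
    wordPerm a (l ++ l') = wordPerm a l * wordPerm a l' := by simp [wordPerm]

theorem BraidEq.wordPerm_eq {a : ℕ} {l l' : List ℕ} (h : BraidEq l l') (hl : ValidWord a l) :
    wordPerm a l = wordPerm a l' := by
  induction h with
  | refl l => rfl
  | symm h ih => exact (ih (hl.of_braidEq h.symm)).symm
  | trans h _ ih ih' => exact (ih hl).trans (ih' (hl.of_braidEq h))
  | cons i _ ih =>
    rw [wordPerm_cons, wordPerm_cons, ih fun j hj => hl j (List.mem_cons_of_mem _ hj)]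
  | comm i j l h =>
    simp only [wordPerm_cons, ← mul_assoc]
    rw [sperm_comm (hl i (by simp)) (hl j (by simp)) h]
  | braid i l =>
    have := sperm_braid (hl i (by simp)).1 (hl (i + 1) (by simp)).2
    simp only [wordPerm_cons, ← mul_assoc] at this ⊢
    rw [this]

/-- The normal form codes of length `a`. -/
abbrev Code (a : ℕ) : Type := ∀ b : Fin a, Fin (b + 1)

/-- Extension of a code by zero. -/
def Code.extend {a : ℕ} (c : Code a) (b : ℕ) : ℕ := if h : b < a then c ⟨b, h⟩ else 0

theorem Code.extend_le {a : ℕ} (c : Code a) (b : ℕ) : c.extend b ≤ b := by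
  unfold Code.extend
  split_ifs with h
  · exact Nat.le_of_lt_succ (c ⟨b, h⟩).2
  · exact Nat.zero_le _

theorem exists_code_normalWord_eq {a : ℕ} {c : ℕ → ℕ} (hc : ∀ b, c b ≤ b) :
    ∃ e : Code a, (∀ b < a, c b = e.extend b) ∧ normalWord c a = normalWord e.extend a := by
  have h : ∀ b < a, c b =
      Code.extend (fun b : Fin a => (⟨c b, Nat.lt_succ_of_le (hc b)⟩ : Fin (b + 1))) b :=
    fun b hb => by simp [Code.extend, hb]
  exact ⟨_, h, normalWord_congr h⟩

theorem IsReducedWords.exists_braidEq {a : ℕ} {red : Equiv.Perm (Fin a) → List ℕ}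
    (hred : IsReducedWords a red) (w : Equiv.Perm (Fin a)) :
    ∃ e : Code a, BraidEq (red w) (normalWord e.extend a) := by
  have hv : ValidWord a (red w) := hred.mem w
  rcases hv.reducible with ⟨c, hc, h⟩ | ⟨u, j, v, h⟩
  · obtain ⟨e, -, he⟩ := exists_code_normalWord_eq (a := a) hc
    exact ⟨e, he ▸ h⟩
  · exfalso
    have hv' := hv.of_braidEq h
    have h1 := hred.length_le w (u ++ v)
      (fun i hi => hv' i (by rcases List.mem_append.1 hi with h | h <;> simp [h])) (by
        have := (h.wordPerm_eq hv).symm.trans (hred.perm_eq w)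
        rw [← this]
        simp only [wordPerm_append, wordPerm_cons]
        rw [← mul_assoc (sperm a j), sperm_mul_self, one_mul])
    have h2 := h.length_eq
    simp only [List.length_append, List.length_cons] at h1 h2
    omega

theorem IsReducedWords.bijective_wordPerm_normalWord {a : ℕ}
    {red : Equiv.Perm (Fin a) → List ℕ} (hred : IsReducedWords a red) :
    Function.Bijective fun e : Code a => wordPerm a (normalWord e.extend a) := by
  rw [Fintype.bijective_iff_surjective_and_card]
  constructor
  · intro w
    obtain ⟨e, he⟩ := hred.exists_braidEq w
    exact ⟨e, (he.wordPerm_eq (hred.mem w)).symm.trans (hred.perm_eq w)⟩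
  · rw [Fintype.card_pi, Fintype.card_perm, Fintype.card_fin,
      ← Finset.prod_range_add_one_eq_factorial, Finset.prod_range]
    simp

theorem IsReducedWords.exists_code {a : ℕ} {red : Equiv.Perm (Fin a) → List ℕ}
    (hred : IsReducedWords a red) :
    ∃ κ : Equiv.Perm (Fin a) → Code a, Function.Injective κ ∧
      (∀ w, BraidEq (red w) (normalWord (κ w).extend a)) ∧
      ∀ e, κ (wordPerm a (normalWord e.extend a)) = e := by
  choose κ hκ using hred.exists_braidEq
  have hperm : ∀ w, wordPerm a (normalWord (κ w).extend a) = w := fun w =>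
    ((hκ w).wordPerm_eq (hred.mem w)).symm.trans (hred.perm_eq w)
  refine ⟨κ, fun v w h => ?_, hκ, fun e => hred.bijective_wordPerm_normalWord.1 (hperm _)⟩
  rw [← hperm v, ← hperm w, h]

theorem IsReducedWords.braidEq_or_square {a : ℕ} {red : Equiv.Perm (Fin a) → List ℕ}
    (hred : IsReducedWords a red) {l : List ℕ} (hl : ValidWord a l) :
    (∃ w, BraidEq l (red w)) ∨ ∃ u j v, BraidEq l (u ++ j :: j :: v) := by
  rcases hl.reducible with ⟨c, hc, h⟩ | h
  · obtain ⟨κ, -, hκ, hκ'⟩ := hred.exists_code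
    obtain ⟨e, -, he⟩ := exists_code_normalWord_eq (a := a) hc
    refine Or.inl ⟨wordPerm a (normalWord e.extend a), h.trans ?_⟩
    have := (hκ (wordPerm a (normalWord e.extend a))).symm
    rw [hκ'] at this
    exact he ▸ this
  · exact Or.inr h

/-! ### Relations between odd divided differences -/

theorem IsOddPolynomialRing.induction {R : Type*} [Ring R] {a : ℕ} {x : ℕ → R}
    (hR : IsOddPolynomialRing a x) {P : R → Prop} (one : P 1)
    (add : ∀ f g, P f → P g → P (f + g)) (neg : ∀ f, P f → P (-f))
    (mul : ∀ j f, 1 ≤ j → j ≤ a → P f → P (x j * f)) (f : R) : P f := by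
  have zero : P 0 := by simpa using add _ _ one (neg _ one)
  have hf : f ∈ Subring.closure {f | ∃ j, 1 ≤ j ∧ j ≤ a ∧ f = x j} := by
    rw [hR.closure_eq_top]; trivial
  suffices h : ∀ g, P g → P (f * g) by simpa using h 1 one
  induction hf using Subring.closure_induction with
  | mem f hf =>
    obtain ⟨j, h1, h2, rfl⟩ := hf
    exact fun g => mul j g h1 h2
  | zero => intro g _; rwa [zero_mul]
  | one => intro g hg; rwa [one_mul]
  | add f f' _ _ h h' => intro g hg; rw [add_mul]; exact add _ _ (h g hg) (h' g hg)
  | neg f _ h => intro g hg; rw [neg_mul]; exact neg _ (h g hg)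
  | mul f f' _ _ h h' => intro g hg; rw [mul_assoc]; exact h _ (h' g hg)

theorem mul_oddMonomial_prod {R : Type*} [Ring R] {a : ℕ} {x : ℕ → R}
    (hx : ∀ i j, i ≠ j → x i * x j = -(x j * x i)) (i : Fin a) (c : Fin a → ℕ)
    (L : List (Fin a)) (hL : L.Nodup) (hi : i ∈ L) :
    x (i + 1) * (L.map fun j : Fin a => x (j + 1) ^ c j).prod =
        (L.map fun j : Fin a => x (j + 1) ^ Function.update c i (c i + 1) j).prod ∨
      x (i + 1) * (L.map fun j : Fin a => x (j + 1) ^ c j).prod =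
        -(L.map fun j : Fin a => x (j + 1) ^ Function.update c i (c i + 1) j).prod := by
  induction L with
  | nil => simp at hi
  | cons j L ih =>
    rw [List.nodup_cons] at hL
    simp only [List.map_cons, List.prod_cons]
    by_cases hij : i = j
    · subst hij
      left
      have : (L.map fun j : Fin a => x (j + 1) ^ Function.update c i (c i + 1) j) =
          L.map fun j : Fin a => x (j + 1) ^ c j := by
        refine List.map_congr_left fun k hk => ?_
        rw [Function.update_of_ne]
        rintro rfl
        exact hL.1 hk
      rw [this, Function.update_self, pow_succ', ← mul_assoc]
    · have hiL : i ∈ L := by simpa [hij] using hi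
      have hcomm : ∀ n : ℕ, x (i + 1) * x (j + 1) ^ n = x (j + 1) ^ n * x (i + 1) ∨
          x (i + 1) * x (j + 1) ^ n = -(x (j + 1) ^ n * x (i + 1)) := by
        intro n
        induction n with
        | zero => simp
        | succ n ihn =>
          rw [pow_succ, ← mul_assoc]
          rcases ihn with h | h <;> rw [h] <;>
            simp [mul_assoc, hx (i + 1) (j + 1) (by omega)]
      rw [Function.update_of_ne (Ne.symm hij), ← mul_assoc]
      rcases hcomm (c j) with h | h <;> rcases ih hL.2 hiL with h' | h' <;> rw [h] <;>
        simp [mul_assoc, h']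

theorem IsOddPolynomialRing.span_range_oddMonomial {R : Type*} [Ring R] {a : ℕ} {x : ℕ → R}
    (hR : IsOddPolynomialRing a x) :
    Submodule.span ℤ (Set.range (oddMonomial x : (Fin a → ℕ) → R)) = ⊤ := by
  rw [eq_top_iff]
  rintro f -
  induction f using hR.induction with
  | one =>
    refine Submodule.subset_span ⟨0, ?_⟩
    simp [oddMonomial]
  | add f g hf hg => exact add_mem hf hg
  | neg f hf => exact neg_mem hf
  | mul j f h1 h2 hf =>
    obtain ⟨i, rfl⟩ : ∃ i : Fin a, j = i + 1 := ⟨⟨j - 1, by omega⟩, by simp; omega⟩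
    induction hf using Submodule.span_induction with
    | mem f hf =>
      obtain ⟨c, rfl⟩ := hf
      rcases mul_oddMonomial_prod hR.anticomm i c (List.finRange a)
        (List.nodup_finRange a) (List.mem_finRange _) with h | h
      · rw [oddMonomial, h]
        exact Submodule.subset_span ⟨_, rfl⟩
      · rw [oddMonomial, h]
        exact neg_mem (Submodule.subset_span ⟨_, rfl⟩)
    | zero => simp
    | add f g _ _ hf hg => rw [mul_add]; exact add_mem hf hg
    | smul n f _ hf => rw [mul_smul_comm]; exact Submodule.smul_mem _ _ hf

/-- The basis of ordered monomials. -/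
noncomputable def IsOddPolynomialRing.basis {R : Type*} [Ring R] {a : ℕ} {x : ℕ → R}
    (hR : IsOddPolynomialRing a x) : Module.Basis (Fin a → ℕ) ℤ R :=
  Module.Basis.mk hR.linearIndependent hR.span_range_oddMonomial.ge

namespace IsOddDividedDifference

variable {R : Type*} [Ring R] {a : ℕ} {x : ℕ → R} {s : ℕ → R →+* R} {d : ℕ → R →+ R}

theorem map_left_mul (hd : IsOddDividedDifference a x s d) {i : ℕ} (h1 : 1 ≤ i)
    (h2 : i + 1 ≤ a) (f : R) : d i (x i * f) = f - x (i + 1) * d i f := by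
  rw [hd.leibniz i h1 h2, hd.map_var i i h1 h2 h1 (by omega),
    hd.twist i i h1 h2 h1 (by omega)]
  simp [sub_eq_add_neg]

theorem map_right_mul (hd : IsOddDividedDifference a x s d) {i : ℕ} (h1 : 1 ≤ i)
    (h2 : i + 1 ≤ a) (f : R) : d i (x (i + 1) * f) = f - x i * d i f := by
  rw [hd.leibniz i h1 h2, hd.map_var i (i + 1) h1 h2 (by omega) h2,
    hd.twist i (i + 1) h1 h2 (by omega) h2]
  simp [sub_eq_add_neg]

theorem map_other_mul (hd : IsOddDividedDifference a x s d) {i j : ℕ} (h1 : 1 ≤ i)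
    (h2 : i + 1 ≤ a) (hj1 : 1 ≤ j) (hj2 : j ≤ a) (hi : j ≠ i) (hi' : j ≠ i + 1) (f : R) :
    d i (x j * f) = -(x j * d i f) := by
  rw [hd.leibniz i h1 h2, hd.map_var i j h1 h2 hj1 hj2, hd.twist i j h1 h2 hj1 hj2]
  simp [hi, hi']

theorem twist_twist (hR : IsOddPolynomialRing a x) (hd : IsOddDividedDifference a x s d)
    {i : ℕ} (h1 : 1 ≤ i) (h2 : i + 1 ≤ a) (f : R) : s i (s i f) = f := by
  induction f using hR.induction with
  | one => simp
  | add f g hf hg => simp [hf, hg]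
  | neg f hf => simp [hf]
  | mul j f hj1 hj2 hf =>
    rw [map_mul, map_mul, hf, hd.twist i j h1 h2 hj1 hj2]
    split_ifs with h h'
    · rw [map_neg, hd.twist i (i + 1) h1 h2 (by omega) h2]
      simp [h]
    · rw [map_neg, hd.twist i i h1 h2 h1 (by omega)]
      simp [h']
    · rw [map_neg, hd.twist i j h1 h2 hj1 hj2]
      simp [h, h']

theorem map_map (hR : IsOddPolynomialRing a x) (hd : IsOddDividedDifference a x s d)
    {i : ℕ} (h1 : 1 ≤ i) (h2 : i + 1 ≤ a) (f : R) : d i (d i f) = 0 := by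
  induction f using hR.induction with
  | one => simp [hd.map_one i h1 h2]
  | add f g hf hg => simp [hf, hg]
  | neg f hf => simp [hf]
  | mul j f hj1 hj2 hf =>
    by_cases h : j = i
    · simp [h, hd.map_left_mul h1 h2, hd.map_right_mul h1 h2, hf]
    by_cases h' : j = i + 1
    · simp [h', hd.map_left_mul h1 h2, hd.map_right_mul h1 h2, hf]
    · simp [hd.map_other_mul h1 h2 hj1 hj2 h h', hf]

theorem map_anticomm (hR : IsOddPolynomialRing a x) (hd : IsOddDividedDifference a x s d)
    {i j : ℕ} (h1 : 1 ≤ i) (h2 : j + 1 ≤ a) (hij : i + 2 ≤ j) (f : R) :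
    d i (d j f) = -d j (d i f) := by
  have hi2 : i + 1 ≤ a := by omega
  have hj1 : 1 ≤ j := by omega
  induction f using hR.induction with
  | one => simp [hd.map_one i h1 hi2, hd.map_one j hj1 h2]
  | add f g hf hg => simp [hf, hg, add_comm]
  | neg f hf => simp [hf]
  | mul k f hk1 hk2 hf =>
    have hI := hd.map_other_mul h1 hi2 hk1 hk2
    have hJ := hd.map_other_mul hj1 h2 hk1 hk2
    by_cases h : k = i ∨ k = i + 1
    · rcases h with rfl | rfl
      · rw [hJ (by omega) (by omega), map_neg, hd.map_left_mul h1 hi2,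
          hd.map_left_mul h1 hi2, map_sub,
          hd.map_other_mul hj1 h2 (by omega) (by omega) (by omega) (by omega), hf]
        noncomm_ring
      · rw [hJ (by omega) (by omega), map_neg, hd.map_right_mul h1 hi2,
          hd.map_right_mul h1 hi2, map_sub,
          hd.map_other_mul hj1 h2 (by omega) (by omega) (by omega) (by omega), hf]
        noncomm_ring
    by_cases h' : k = j ∨ k = j + 1
    · rcases h' with rfl | rfl
      · rw [hI (by omega) (by omega), map_neg, hd.map_left_mul hj1 h2,
          hd.map_left_mul hj1 h2, map_sub,
          hd.map_other_mul h1 hi2 (by omega) (by omega) (by omega) (by omega), hf]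
        noncomm_ring
      · rw [hI (by omega) (by omega), map_neg, hd.map_right_mul hj1 h2,
          hd.map_right_mul hj1 h2, map_sub,
          hd.map_other_mul h1 hi2 (by omega) (by omega) (by omega) (by omega), hf]
        noncomm_ring
    · rw [hI (by omega) (by omega), hJ (by omega) (by omega), map_neg, map_neg,
        hI (by omega) (by omega), hJ (by omega) (by omega), hf]
      simp

theorem map_braid (hR : IsOddPolynomialRing a x) (hd : IsOddDividedDifference a x s d)
    {i : ℕ} (h1 : 1 ≤ i) (h2 : i + 2 ≤ a) (f : R) :
    d i (d (i + 1) (d i f)) = d (i + 1) (d i (d (i + 1) f)) := by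
  have hi2 : i + 1 ≤ a := by omega
  have hj1 : 1 ≤ i + 1 := by omega
  have hL := hd.map_left_mul h1 hi2
  have hM := hd.map_right_mul h1 hi2
  have hL' := hd.map_left_mul hj1 h2
  have hM' := hd.map_right_mul hj1 h2
  have hO := hd.map_other_mul h1 hi2 (j := i + 1 + 1) (by omega) (by omega) (by omega) (by omega)
  have hO' := hd.map_other_mul hj1 h2 (j := i) (by omega) (by omega) (by omega) (by omega)
  have hI := hd.map_map hR h1 hi2
  have hJ := hd.map_map hR hj1 h2
  induction f using hR.induction with
  | one => simp [hd.map_one i h1 hi2, hd.map_one (i + 1) hj1 h2]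
  | add f g hf hg => simp [hf, hg]
  | neg f hf => simp [hf]
  | mul k f hk1 hk2 hf =>
    by_cases h : k = i ∨ k = i + 1 ∨ k = i + 1 + 1
    · rcases h with rfl | rfl | rfl <;>
        simp only [hL, hM, hL', hM', hO, hO', hI, hJ, map_sub, map_neg, hf] <;> noncomm_ring
    · have hK := hd.map_other_mul h1 hi2 hk1 hk2 (by omega) (by omega)
      have hK' := hd.map_other_mul hj1 h2 hk1 hk2 (by omega) (by omega)
      simp only [hK, hK', map_neg, hf]

end IsOddDividedDifference

/-! ### Composites of odd divided differences along words -/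

theorem opWord_cons {R : Type*} [Ring R] (d : ℕ → R →+ R) (i : ℕ) (l : List ℕ) :
    opWord d (i :: l) = (d i).toIntLinearMap * opWord d l := by simp [opWord]

theorem opWord_append {R : Type*} [Ring R] (d : ℕ → R →+ R) (l l' : List ℕ) :
    opWord d (l ++ l') = opWord d l * opWord d l' := by simp [opWord]

theorem opWord_cons_apply {R : Type*} [Ring R] (d : ℕ → R →+ R) (i : ℕ) (l : List ℕ) (f : R) :
    opWord d (i :: l) f = d i (opWord d l f) := by simp [opWord_cons]

theorem opWord_append_apply {R : Type*} [Ring R] (d : ℕ → R →+ R) (l l' : List ℕ) (f : R) :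
    opWord d (l ++ l') f = opWord d l (opWord d l' f) := by simp [opWord_append]

namespace IsOddDividedDifference

variable {R : Type*} [Ring R] {a : ℕ} {x : ℕ → R} {s : ℕ → R →+* R} {d : ℕ → R →+ R}

theorem opWord_square (hR : IsOddPolynomialRing a x) (hd : IsOddDividedDifference a x s d)
    {u v : List ℕ} {j : ℕ} (hj : 1 ≤ j ∧ j + 1 ≤ a) : opWord d (u ++ j :: j :: v) = 0 := by
  refine LinearMap.ext fun f => ?_
  rw [opWord_append_apply, opWord_cons_apply, opWord_cons_apply, hd.map_map hR hj.1 hj.2]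
  simp

theorem opWord_eq_or_neg (hR : IsOddPolynomialRing a x) (hd : IsOddDividedDifference a x s d)
    {l l' : List ℕ} (h : BraidEq l l') (hl : ValidWord a l) :
    opWord d l = opWord d l' ∨ opWord d l = -opWord d l' := by
  induction h with
  | refl l => exact Or.inl rfl
  | symm h ih =>
    rcases ih (hl.of_braidEq h.symm) with h | h
    · exact Or.inl h.symm
    · exact Or.inr (by rw [h, neg_neg])
  | trans h _ ih ih' =>
    rcases ih hl with h1 | h1 <;> rcases ih' (hl.of_braidEq h) with h2 | h2 <;> simp [h1, h2]
  | cons i _ ih =>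
    rcases ih fun j hj => hl j (List.mem_cons_of_mem _ hj) with h | h <;>
      simp [opWord_cons, h]
  | comm i j l h =>
    refine Or.inr (LinearMap.ext fun f => ?_)
    have := hd.map_anticomm hR (hl i (by simp)).1 (hl j (by simp)).2 h (opWord d l f)
    simpa only [LinearMap.neg_apply, opWord_cons_apply] using this
  | braid i l =>
    refine Or.inl (LinearMap.ext fun f => ?_)
    have := hd.map_braid hR (hl i (by simp)).1 (hl (i + 1) (by simp)).2 (opWord d l f)
    simpa only [opWord_cons_apply] using this

theorem opWord_eq_zero_or_red (hR : IsOddPolynomialRing a x)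
    (hd : IsOddDividedDifference a x s d) {red : Equiv.Perm (Fin a) → List ℕ}
    (hred : IsReducedWords a red) {l : List ℕ} (hl : ValidWord a l) :
    opWord d l = 0 ∨ ∃ w, (red w).length = l.length ∧
      (opWord d l = opWord d (red w) ∨ opWord d l = -opWord d (red w)) := by
  rcases hred.braidEq_or_square hl with ⟨w, h⟩ | ⟨u, j, v, h⟩
  · exact Or.inr ⟨w, h.length_eq.symm, hd.opWord_eq_or_neg hR h hl⟩
  · left
    have := hd.opWord_square hR (u := u) (v := v) (hl.of_braidEq h j (by simp))
    rcases hd.opWord_eq_or_neg hR h hl with h | h <;> simp [h, this]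

/-! ### Linear independence over the odd polynomial ring -/

theorem map_pow_eq_zero (hd : IsOddDividedDifference a x s d) {i j : ℕ} (h1 : 1 ≤ i)
    (h2 : i + 1 ≤ a) (hj1 : 1 ≤ j) (hj2 : j ≤ a) (hi : j ≠ i) (hi' : j ≠ i + 1) (n : ℕ) :
    d i (x j ^ n) = 0 := by
  induction n with
  | zero => rw [pow_zero, hd.map_one i h1 h2]
  | succ n ih => rw [pow_succ', hd.map_other_mul h1 h2 hj1 hj2 hi hi', ih, mul_zero, neg_zero]

theorem map_right_pow_succ (hd : IsOddDividedDifference a x s d) {i : ℕ} (h1 : 1 ≤ i)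
    (h2 : i + 1 ≤ a) (n : ℕ) :
    d i (x (i + 1) ^ (n + 1)) = d i (x (i + 1) ^ n) * x (i + 1) + (-1) ^ n * x i ^ n := by
  rw [pow_succ, hd.leibniz i h1 h2, hd.map_var i (i + 1) h1 h2 (by omega) h2, map_pow (s i),
    hd.twist i (i + 1) h1 h2 (by omega) h2]
  simp [neg_pow (x i)]

theorem opWord_mul_right (hd : IsOddDividedDifference a x s d) {l : List ℕ}
    (hl : ValidWord a l) {g : R} (hg : ∀ i ∈ l, d i g = 0) (f : R) :
    opWord d l (f * g) = opWord d l f * g := by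
  induction l with
  | nil => rfl
  | cons i l ih =>
    obtain ⟨h1, h2⟩ := hl i (by simp)
    rw [opWord_cons_apply, ih (fun j hj => hl j (by simp [hj])) fun j hj => hg j (by simp [hj]),
      hd.leibniz i h1 h2, hg i (by simp), mul_zero, add_zero, opWord_cons_apply]

theorem opWord_neg_one_pow_mul (l : List ℕ) (n : ℕ) (f : R) :
    opWord d l ((-1) ^ n * f) = (-1) ^ n * opWord d l f := by
  rcases neg_one_pow_eq_or R n with h | h <;> simp [h]

theorem opWord_runWord_map_pow_succ (hd : IsOddDividedDifference a x s d) {m k : ℕ}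
    (hk : k ≤ m) (hm : m + 2 ≤ a) (j : ℕ) :
    opWord d (runWord m k) (d (m + 1) (x (m + 2) ^ (j + 1))) =
      opWord d (runWord m k) (d (m + 1) (x (m + 2) ^ j)) * x (m + 2) +
        (-1) ^ j * opWord d (runWord m k) (x (m + 1) ^ j) := by
  have hl : ValidWord a (runWord m k) := fun i hi => by
    have := mem_runWord hk hi
    omega
  have hg : ∀ i ∈ runWord m k, d i (x (m + 2)) = 0 := fun i hi => by
    have := mem_runWord hk hi
    rw [hd.map_var i (m + 2) (by omega) (by omega) (by omega) (by omega), if_neg (by omega)]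
  rw [hd.map_right_pow_succ (by omega) hm, map_add, hd.opWord_mul_right hl hg,
    opWord_neg_one_pow_mul]

theorem opWord_runWord_pow (hd : IsOddDividedDifference a x s d) {m k j : ℕ} (hk : k ≤ m)
    (hm : m + 1 ≤ a) :
    (j < k → opWord d (runWord m k) (x (m + 1) ^ j) = 0) ∧
      (j = k → opWord d (runWord m k) (x (m + 1) ^ j) = 1 ∨
        opWord d (runWord m k) (x (m + 1) ^ j) = -1) := by
  induction k generalizing m j with
  | zero =>
    refine ⟨fun h => by omega, ?_⟩
    rintro rfl
    simp [runWord, opWord]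
  | succ k ih =>
    obtain ⟨m, rfl⟩ : ∃ m', m = m' + 1 := ⟨m - 1, by omega⟩
    have hk' : k ≤ m := by omega
    have key : ∀ j ≤ k, opWord d (runWord m k) (d (m + 1) (x (m + 2) ^ j)) = 0 := by
      intro j hj
      induction j with
      | zero => rw [pow_zero, hd.map_one (m + 1) (by omega) (by omega), map_zero]
      | succ j ihj =>
        rw [hd.opWord_runWord_map_pow_succ hk' hm, ihj (by omega),
          (ih hk' (by omega)).1 (by omega), zero_mul, mul_zero, add_zero]
    have hcons : ∀ f, opWord d (runWord (m + 1) (k + 1)) f =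
        opWord d (runWord m k) (d (m + 1) f) := fun f => by
      rw [runWord_succ, opWord_append_apply]
      simp [opWord]
    rw [hcons]
    refine ⟨fun h => key j (by omega), ?_⟩
    rintro rfl
    rw [hd.opWord_runWord_map_pow_succ hk' hm, key k le_rfl, zero_mul, zero_add]
    rcases (ih (j := k) hk' (by omega)).2 rfl with h | h <;>
      rcases neg_one_pow_eq_or R k with h' | h' <;> simp [h, h']

end IsOddDividedDifference

/-- The ordered monomial `x_1^{c_0} ⋯ x_m^{c_{m-1}}` indexed by a sequence. -/
def codeMonomial {R : Type*} [Ring R] (x : ℕ → R) (c : ℕ → ℕ) : ℕ → R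
  | 0 => 1
  | m + 1 => codeMonomial x c m * x (m + 1) ^ c m

namespace IsOddDividedDifference

variable {R : Type*} [Ring R] {a : ℕ} {x : ℕ → R} {s : ℕ → R →+* R} {d : ℕ → R →+ R}

theorem opWord_normalWord_succ (hd : IsOddDividedDifference a x s d) {c c' : ℕ → ℕ}
    (hc : ∀ b, c b ≤ b) {m : ℕ} (hm : m + 1 ≤ a) :
    opWord d (normalWord c (m + 1)) (codeMonomial x c' (m + 1)) =
      opWord d (runWord m (c m))
        (opWord d (normalWord c m) (codeMonomial x c' m) * x (m + 1) ^ c' m) := by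
  rw [normalWord, opWord_append_apply, codeMonomial, hd.opWord_mul_right]
  · intro i hi
    have := mem_normalWord hc hi
    omega
  · intro i hi
    have := mem_normalWord hc hi
    exact hd.map_pow_eq_zero (by omega) (by omega) (by omega) hm (by omega) (by omega) _

theorem opWord_normalWord_codeMonomial_self (hd : IsOddDividedDifference a x s d) {c : ℕ → ℕ}
    (hc : ∀ b, c b ≤ b) {m : ℕ} (hm : m ≤ a) :
    opWord d (normalWord c m) (codeMonomial x c m) = 1 ∨
      opWord d (normalWord c m) (codeMonomial x c m) = -1 := by
  induction m with
  | zero => exact Or.inl rfl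
  | succ m ih =>
    rw [hd.opWord_normalWord_succ hc hm]
    rcases ih (by omega) with h | h <;>
      rcases (hd.opWord_runWord_pow (j := c m) (hc m) hm).2 rfl with h' | h' <;> simp [h, h']

theorem opWord_normalWord_codeMonomial_of_lt (hd : IsOddDividedDifference a x s d)
    {c c' : ℕ → ℕ} (hc : ∀ b, c b ≤ b) (hc' : ∀ b, c' b ≤ b) {m b : ℕ} (hm : m ≤ a)
    (hb : b < m) (heq : ∀ j < b, c' j = c j) (hlt : c' b < c b) :
    opWord d (normalWord c m) (codeMonomial x c' m) = 0 := by
  induction m with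
  | zero => omega
  | succ m ih =>
    rw [hd.opWord_normalWord_succ hc hm]
    rcases (Nat.lt_succ_iff.1 hb).lt_or_eq with h | rfl
    · rw [ih (by omega) h, zero_mul, map_zero]
    · rw [← normalWord_congr heq]
      rcases hd.opWord_normalWord_codeMonomial_self hc' (m := b) (by omega) with h' | h' <;>
        simp [h', (hd.opWord_runWord_pow (hc b) hm).1 hlt]

/-- The operator `∑ f_w ∂_w`. -/
noncomputable def leftComb {a : ℕ} (d : ℕ → R →+ R) (red : Equiv.Perm (Fin a) → List ℕ) :
    (Equiv.Perm (Fin a) → R) →ₗ[ℤ] Module.End ℤ R where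
  toFun f := ∑ w, LinearMap.mulLeft ℤ (f w) * opWord d (red w)
  map_add' f g := by
    rw [← Finset.sum_add_distrib]
    refine Finset.sum_congr rfl fun w _ => LinearMap.ext fun p => ?_
    simp [add_mul]
  map_smul' n f := by
    rw [Finset.smul_sum]
    refine Finset.sum_congr rfl fun w _ => LinearMap.ext fun p => ?_
    simp

/-- The operator `∑ ∂_w f_w`. -/
noncomputable def rightComb {a : ℕ} (d : ℕ → R →+ R) (red : Equiv.Perm (Fin a) → List ℕ) :
    (Equiv.Perm (Fin a) → R) →ₗ[ℤ] Module.End ℤ R where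
  toFun f := ∑ w, opWord d (red w) * LinearMap.mulLeft ℤ (f w)
  map_add' f g := by
    rw [← Finset.sum_add_distrib]
    refine Finset.sum_congr rfl fun w _ => LinearMap.ext fun p => ?_
    simp [add_mul]
  map_smul' n f := by
    rw [Finset.smul_sum]
    refine Finset.sum_congr rfl fun w _ => LinearMap.ext fun p => ?_
    simp only [Pi.smul_apply, RingHom.id_apply, Module.End.mul_apply, LinearMap.mulLeft_apply,
      LinearMap.smul_apply, smul_mul_assoc, map_zsmul]

variable {red : Equiv.Perm (Fin a) → List ℕ}

theorem leftComb_single [DecidableEq (Equiv.Perm (Fin a))] (w : Equiv.Perm (Fin a)) (f : R) :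
    leftComb d red (Pi.single w f) = LinearMap.mulLeft ℤ f * opWord d (red w) := by
  simp only [leftComb, LinearMap.coe_mk, AddHom.coe_mk]
  rw [Finset.sum_eq_single w]
  · simp
  · intro v _ hv
    simp [hv]
  · simp

theorem rightComb_single [DecidableEq (Equiv.Perm (Fin a))] (w : Equiv.Perm (Fin a)) (f : R) :
    rightComb d red (Pi.single w f) = opWord d (red w) * LinearMap.mulLeft ℤ f := by
  simp only [rightComb, LinearMap.coe_mk, AddHom.coe_mk]
  rw [Finset.sum_eq_single w]
  · simp
  · intro v _ hv
    simp [hv]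
  · simp

theorem leftComb_injective (hR : IsOddPolynomialRing a x) (hd : IsOddDividedDifference a x s d)
    (hred : IsReducedWords a red) : Function.Injective (leftComb d red) := by
  classical
  rw [injective_iff_map_eq_zero]
  intro f hf
  by_contra hne
  obtain ⟨κ, hκinj, hκ, -⟩ := hred.exists_code
  let o : Equiv.Perm (Fin a) → Lex (Fin a → ℕ) := fun w => toLex fun b => (κ w b : ℕ)
  have ho : Function.Injective o := fun v w h => hκinj <| funext fun b =>
    Fin.ext (congrFun (toLex.injective h) b)
  obtain ⟨w, hw, hmin⟩ := (Finset.univ.filter fun w => f w ≠ 0).exists_min_image o (by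
    obtain ⟨w, hw⟩ := Function.ne_iff.1 hne
    exact ⟨w, by simpa using hw⟩)
  have hval : ∀ v, ∀ p, opWord d (red v) p = opWord d (normalWord (κ v).extend a) p ∨
      opWord d (red v) p = -opWord d (normalWord (κ v).extend a) p := fun v p => by
    rcases hd.opWord_eq_or_neg hR (hκ v) (hred.mem v) with h | h <;> simp [h]
  have heval := DFunLike.congr_fun hf (codeMonomial x (κ w).extend a)
  simp only [leftComb, LinearMap.coe_mk, AddHom.coe_mk, LinearMap.sum_apply,
    Module.End.mul_apply, LinearMap.mulLeft_apply, LinearMap.zero_apply] at heval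
  rw [Finset.sum_eq_single w] at heval
  · apply (Finset.mem_filter.1 hw).2
    rcases hval w (codeMonomial x (κ w).extend a) with h | h <;>
      rcases hd.opWord_normalWord_codeMonomial_self (κ w).extend_le le_rfl with h' | h' <;>
      simpa [h, h'] using heval
  · intro v _ hvw
    by_cases hv : f v = 0
    · rw [hv, zero_mul]
    have hlt : o w < o v :=
      (hmin v (by simpa using hv)).lt_of_ne fun h => hvw (ho h).symm
    obtain ⟨b, hb, hb'⟩ := hlt
    have hz : opWord d (normalWord (κ v).extend a) (codeMonomial x (κ w).extend a) = 0 := by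
      refine hd.opWord_normalWord_codeMonomial_of_lt (κ v).extend_le (κ w).extend_le le_rfl b.2
        (fun j hj => ?_) ?_
      · have hja : j < a := hj.trans b.2
        simp only [Code.extend, hja, dif_pos]
        exact hb ⟨j, hja⟩ hj
      · simp only [Code.extend, b.2, dif_pos]
        exact hb'
    rcases hval v (codeMonomial x (κ w).extend a) with h | h <;> simp [h, hz]
  · simp

/-- The span of the operators `f ∂_l` for words `l` of length less than `n`. -/
def lowerSpan (a : ℕ) (d : ℕ → R →+ R) (n : ℕ) : Submodule ℤ (Module.End ℤ R) :=
  Submodule.span ℤ {T | ∃ f l, ValidWord a l ∧ l.length < n ∧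
    T = LinearMap.mulLeft ℤ f * opWord d l}

theorem lowerSpan_mono {n n' : ℕ} (h : n ≤ n') : lowerSpan a d n ≤ lowerSpan a d n' := by
  refine Submodule.span_mono ?_
  rintro _ ⟨f, l, hl, hn, rfl⟩
  exact ⟨f, l, hl, hn.trans_le h, rfl⟩

theorem map_mul_mulLeft (hd : IsOddDividedDifference a x s d) {i : ℕ} (h1 : 1 ≤ i)
    (h2 : i + 1 ≤ a) (f : R) :
    (d i).toIntLinearMap * LinearMap.mulLeft ℤ f =
      LinearMap.mulLeft ℤ (d i f) + LinearMap.mulLeft ℤ (s i f) * (d i).toIntLinearMap := by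
  refine LinearMap.ext fun g => ?_
  simp [hd.leibniz i h1 h2]

theorem map_mul_mem_lowerSpan (hd : IsOddDividedDifference a x s d) {i n : ℕ} (h1 : 1 ≤ i)
    (h2 : i + 1 ≤ a) {T : Module.End ℤ R} (hT : T ∈ lowerSpan a d n) :
    (d i).toIntLinearMap * T ∈ lowerSpan a d (n + 1) := by
  induction hT using Submodule.span_induction with
  | mem T hT =>
    obtain ⟨f, l, hl, hn, rfl⟩ := hT
    rw [← mul_assoc, hd.map_mul_mulLeft h1 h2, add_mul, mul_assoc, ← opWord_cons]
    refine add_mem (Submodule.subset_span ⟨_, l, hl, by omega, rfl⟩)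
      (Submodule.subset_span ⟨_, i :: l, ?_, by simpa using hn, rfl⟩)
    intro j hj
    rcases List.mem_cons.1 hj with rfl | hj
    · exact ⟨h1, h2⟩
    · exact hl j hj
  | zero => simp
  | add T T' _ _ h h' => rw [mul_add]; exact add_mem h h'
  | smul n T _ h => rw [mul_smul_comm]; exact Submodule.smul_mem _ _ h

theorem exists_twist_opWord (hR : IsOddPolynomialRing a x)
    (hd : IsOddDividedDifference a x s d) {l : List ℕ} (hl : ValidWord a l) :
    ∃ σ : R →+* R, Function.Bijective σ ∧ ∀ f,
      opWord d l * LinearMap.mulLeft ℤ f - LinearMap.mulLeft ℤ (σ f) * opWord d l ∈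
        lowerSpan a d l.length := by
  induction l with
  | nil =>
    refine ⟨RingHom.id R, Function.bijective_id, fun f => ?_⟩
    have : opWord d [] = 1 := rfl
    simp [this]
  | cons i l ih =>
    obtain ⟨σ, hσ, h⟩ := ih fun j hj => hl j (by simp [hj])
    obtain ⟨h1, h2⟩ := hl i (by simp)
    refine ⟨(s i).comp σ, ?_, fun f => ?_⟩
    · exact (Function.Involutive.bijective (f := s i) (hd.twist_twist hR h1 h2)).comp hσ
    · have h3 : LinearMap.mulLeft ℤ (d i (σ f)) * opWord d l ∈ lowerSpan a d (l.length + 1) :=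
        Submodule.subset_span ⟨d i (σ f), l, fun j hj => hl j (by simp [hj]),
          Nat.lt_succ_self _, rfl⟩
      have := add_mem (hd.map_mul_mem_lowerSpan h1 h2 (h f)) h3
      rw [List.length_cons]
      rw [mul_sub, ← mul_assoc _ (LinearMap.mulLeft ℤ (σ f)), hd.map_mul_mulLeft h1 h2] at this
      convert this using 1
      rw [opWord_cons, RingHom.comp_apply]
      noncomm_ring

theorem exists_leftComb_eq (hR : IsOddPolynomialRing a x) (hd : IsOddDividedDifference a x s d)
    (hred : IsReducedWords a red) {n : ℕ} {T : Module.End ℤ R} (hT : T ∈ lowerSpan a d n) :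
    ∃ g, (∀ w, n ≤ (red w).length → g w = 0) ∧ leftComb d red g = T := by
  classical
  induction hT using Submodule.span_induction with
  | mem T hT =>
    obtain ⟨f, l, hl, hn, rfl⟩ := hT
    rcases hd.opWord_eq_zero_or_red hR hred hl with h | ⟨w, hw, h | h⟩
    · exact ⟨0, fun _ _ => rfl, by simp [h]⟩
    · refine ⟨Pi.single w f, fun v hv => Pi.single_eq_of_ne (by rintro rfl; omega) _, ?_⟩
      rw [leftComb_single, h]
    · refine ⟨Pi.single w (-f), fun v hv => Pi.single_eq_of_ne (by rintro rfl; omega) _, ?_⟩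
      rw [leftComb_single, h]
      refine LinearMap.ext fun p => ?_
      simp
  | zero => exact ⟨0, fun _ _ => rfl, map_zero _⟩
  | add T T' _ _ h h' =>
    obtain ⟨g, hg, rfl⟩ := h
    obtain ⟨g', hg', rfl⟩ := h'
    exact ⟨g + g', fun w hw => by simp [hg w hw, hg' w hw], map_add _ _ _⟩
  | smul n T _ h =>
    obtain ⟨g, hg, rfl⟩ := h
    exact ⟨n • g, fun w hw => by simp [hg w hw], map_smul _ _ _⟩

theorem rightComb_injective (hR : IsOddPolynomialRing a x) (hd : IsOddDividedDifference a x s d)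
    (hred : IsReducedWords a red) : Function.Injective (rightComb d red) := by
  classical
  rw [injective_iff_map_eq_zero]
  intro f hf
  by_contra hne
  obtain ⟨w, hw, hmax⟩ := (Finset.univ.filter fun w => f w ≠ 0).exists_max_image
    (fun w => (red w).length) (by
      obtain ⟨w, hw⟩ := Function.ne_iff.1 hne
      exact ⟨w, by simpa using hw⟩)
  choose σ hσ h using fun w => hd.exists_twist_opWord hR (hred.mem w)
  have hmem : rightComb d red f - leftComb d red (fun v => σ v (f v)) ∈
      lowerSpan a d (red w).length := by
    simp only [rightComb, leftComb, LinearMap.coe_mk, AddHom.coe_mk]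
    rw [← Finset.sum_sub_distrib]
    refine sum_mem fun v _ => ?_
    by_cases hv : f v = 0
    · simp [hv]
    · exact lowerSpan_mono (hmax v (by simpa using hv)) (h v (f v))
  obtain ⟨g, hg, hg'⟩ := hd.exists_leftComb_eq hR hred hmem
  rw [hf, zero_sub, ← map_neg] at hg'
  have := congrFun (hd.leftComb_injective hR hred hg') w
  rw [hg w le_rfl, Pi.neg_apply, eq_comm, neg_eq_zero] at this
  exact (Finset.mem_filter.1 hw).2 ((hσ w).1 (this.trans (map_zero _).symm))

/-- The generators of the odd nilHecke ring. -/
def nilHeckeGens (a : ℕ) (x : ℕ → R) (d : ℕ → R →+ R) : Set (Module.End ℤ R) :=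
  {T | (∃ j, 1 ≤ j ∧ j ≤ a ∧ T = LinearMap.mulLeft ℤ (x j)) ∨
    (∃ i : ℕ, 1 ≤ i ∧ i + 1 ≤ a ∧ T = (d i).toIntLinearMap)}

theorem mulLeft_mem_closure (hR : IsOddPolynomialRing a x) (f : R) :
    LinearMap.mulLeft ℤ f ∈ Subring.closure (nilHeckeGens a x d) := by
  induction f using hR.induction with
  | one => rw [LinearMap.mulLeft_one]; exact one_mem _
  | add f g hf hg =>
    have : LinearMap.mulLeft ℤ (f + g) = LinearMap.mulLeft ℤ f + LinearMap.mulLeft ℤ g :=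
      LinearMap.ext fun p => by simp [add_mul]
    rw [this]
    exact add_mem hf hg
  | neg f hf =>
    have : LinearMap.mulLeft ℤ (-f) = -LinearMap.mulLeft ℤ f := LinearMap.ext fun p => by simp
    rw [this]
    exact neg_mem hf
  | mul j f h1 h2 hf =>
    rw [LinearMap.mulLeft_mul]
    exact mul_mem (Subring.subset_closure (Or.inl ⟨j, h1, h2, rfl⟩)) hf

theorem opWord_mem_closure {l : List ℕ} (hl : ValidWord a l) :
    opWord d l ∈ Subring.closure (nilHeckeGens a x d) := by
  refine list_prod_mem fun T hT => ?_
  obtain ⟨i, hi, rfl⟩ := List.mem_map.1 hT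
  exact Subring.subset_closure (Or.inr ⟨i, (hl i hi).1, (hl i hi).2, rfl⟩)

theorem exists_mem_lowerSpan_of_mem_closure (hd : IsOddDividedDifference a x s d)
    {T : Module.End ℤ R} (hT : T ∈ Subring.closure (nilHeckeGens a x d)) :
    ∃ n, T ∈ lowerSpan a d n := by
  suffices h : ∀ n, ∀ U ∈ lowerSpan a d n, ∃ n', T * U ∈ lowerSpan a d n' by
    have h1 : (1 : Module.End ℤ R) ∈ lowerSpan a d 1 :=
      Submodule.subset_span ⟨1, [], by simp [ValidWord], by simp,
        by rw [LinearMap.mulLeft_one]; rfl⟩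
    obtain ⟨n, hn⟩ := h 1 1 h1
    exact ⟨n, by rwa [mul_one] at hn⟩
  induction hT using Subring.closure_induction with
  | mem T hT =>
    intro n U hU
    rcases hT with ⟨j, -, -, rfl⟩ | ⟨i, h1, h2, rfl⟩
    · refine ⟨n, ?_⟩
      induction hU using Submodule.span_induction with
      | mem U hU =>
        obtain ⟨f, l, hl, hn, rfl⟩ := hU
        rw [← mul_assoc]
        exact Submodule.subset_span ⟨x j * f, l, hl, hn, by rw [LinearMap.mulLeft_mul]; rfl⟩
      | zero => simp
      | add U U' _ _ h h' => rw [mul_add]; exact add_mem h h'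
      | smul n U _ h => rw [mul_smul_comm]; exact Submodule.smul_mem _ _ h
    · exact ⟨n + 1, hd.map_mul_mem_lowerSpan h1 h2 hU⟩
  | zero => exact fun n U _ => ⟨0, by simp⟩
  | one => exact fun n U hU => ⟨n, by simpa using hU⟩
  | add T T' _ _ h h' =>
    intro n U hU
    obtain ⟨m, hm⟩ := h n U hU
    obtain ⟨m', hm'⟩ := h' n U hU
    refine ⟨max m m', ?_⟩
    rw [add_mul]
    exact add_mem (lowerSpan_mono (le_max_left _ _) hm) (lowerSpan_mono (le_max_right _ _) hm')
  | neg T _ h =>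
    intro n U hU
    obtain ⟨m, hm⟩ := h n U hU
    exact ⟨m, by rw [neg_mul]; exact neg_mem hm⟩
  | mul T T' _ _ h h' =>
    intro n U hU
    obtain ⟨m, hm⟩ := h' n U hU
    rw [mul_assoc]
    exact h m _ hm

theorem lowerSpan_le_range_rightComb (hR : IsOddPolynomialRing a x)
    (hd : IsOddDividedDifference a x s d) (hred : IsReducedWords a red) (n : ℕ) :
    lowerSpan a d n ≤ LinearMap.range (rightComb d red) := by
  classical
  induction n with
  | zero =>
    refine Submodule.span_le.2 ?_
    rintro _ ⟨f, l, -, hn, -⟩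
    omega
  | succ n ih =>
    refine Submodule.span_le.2 ?_
    rintro _ ⟨f, l, hl, hn, rfl⟩
    have hw : ∀ w, (red w).length = l.length →
        LinearMap.mulLeft ℤ f * opWord d (red w) ∈ LinearMap.range (rightComb d red) := by
      intro w hw
      obtain ⟨σ, hσ, h⟩ := hd.exists_twist_opWord hR (hred.mem w)
      obtain ⟨g, rfl⟩ := hσ.2 f
      have hg : opWord d (red w) * LinearMap.mulLeft ℤ g ∈ LinearMap.range (rightComb d red) :=
        ⟨Pi.single w g, rightComb_single w g⟩
      have := sub_mem hg (ih (lowerSpan_mono (by omega) (h g)))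
      rwa [sub_sub_cancel] at this
    rcases hd.opWord_eq_zero_or_red hR hred hl with h | ⟨w, hwl, h | h⟩
    · simp [h]
    · rw [h]
      exact hw w hwl
    · rw [h, mul_neg]
      exact neg_mem (hw w hwl)

theorem range_leftComb (hR : IsOddPolynomialRing a x) (hd : IsOddDividedDifference a x s d)
    (hred : IsReducedWords a red) :
    (LinearMap.range (leftComb d red) : Set (Module.End ℤ R)) =
      Subring.closure (nilHeckeGens a x d) := by
  refine Set.Subset.antisymm ?_ fun T hT => ?_
  · rintro _ ⟨f, rfl⟩
    exact sum_mem fun w _ =>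
      mul_mem (mulLeft_mem_closure hR _) (opWord_mem_closure (hred.mem w))
  · obtain ⟨n, hn⟩ := hd.exists_mem_lowerSpan_of_mem_closure hT
    obtain ⟨g, -, hg⟩ := hd.exists_leftComb_eq hR hred hn
    exact ⟨g, hg⟩

theorem range_rightComb (hR : IsOddPolynomialRing a x) (hd : IsOddDividedDifference a x s d)
    (hred : IsReducedWords a red) :
    (LinearMap.range (rightComb d red) : Set (Module.End ℤ R)) =
      Subring.closure (nilHeckeGens a x d) := by
  refine Set.Subset.antisymm ?_ fun T hT => ?_
  · rintro _ ⟨f, rfl⟩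
    exact sum_mem fun w _ =>
      mul_mem (opWord_mem_closure (hred.mem w)) (mulLeft_mem_closure hR _)
  · obtain ⟨n, hn⟩ := hd.exists_mem_lowerSpan_of_mem_closure hT
    exact hd.lowerSpan_le_range_rightComb hR hred n hn

end IsOddDividedDifference

/-- An injective linear map carries a basis, placed in each coordinate, to a basis of its range. -/
theorem linearIndependent_and_span_eq_range {ι κ M E : Type*} [Fintype κ] [DecidableEq κ]
    [AddCommGroup M] [AddCommGroup E] (b : Module.Basis ι ℤ M) {Φ : (κ → M) →ₗ[ℤ] E}
    (hΦ : Function.Injective Φ) :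
    LinearIndependent ℤ (fun p : ι × κ => Φ (Pi.single p.2 (b p.1))) ∧
      Submodule.span ℤ (Set.range fun p : ι × κ => Φ (Pi.single p.2 (b p.1))) =
        LinearMap.range Φ := by
  let B : Module.Basis (ι × κ) ℤ (κ → M) := (Pi.basis fun _ : κ => b).reindex
    ((Equiv.sigmaEquivProd κ ι).trans (Equiv.prodComm κ ι))
  have hB : (fun p : ι × κ => Φ (Pi.single p.2 (b p.1))) = Φ ∘ B := by
    funext p
    simp [B, Pi.basis_apply]
  rw [hB]
  refine ⟨B.linearIndependent.map' Φ (LinearMap.ker_eq_bot.2 hΦ), ?_⟩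
  rw [Set.range_comp, ← Submodule.map_span, B.span_eq, Submodule.map_top]

theorem odd_nilHecke_basis_of_isOddPolynomialRing {R : Type*} [Ring R] {a : ℕ} {x : ℕ → R}
    (hR : IsOddPolynomialRing a x) {s : ℕ → R →+* R} {d : ℕ → R →+ R}
    (hd : IsOddDividedDifference a x s d) {red : Equiv.Perm (Fin a) → List ℕ}
    (hred : IsReducedWords a red) :
    LinearIndependent ℤ (fun p : (Fin a → ℕ) × Equiv.Perm (Fin a) =>
      LinearMap.mulLeft ℤ (oddMonomial x p.1) * opWord d (red p.2)) ∧
    LinearIndependent ℤ (fun p : (Fin a → ℕ) × Equiv.Perm (Fin a) =>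
      opWord d (red p.2) * LinearMap.mulLeft ℤ (oddMonomial x p.1)) ∧
    (Submodule.span ℤ (Set.range fun p : (Fin a → ℕ) × Equiv.Perm (Fin a) =>
      LinearMap.mulLeft ℤ (oddMonomial x p.1) * opWord d (red p.2)) : Set (Module.End ℤ R)) =
      Subring.closure (IsOddDividedDifference.nilHeckeGens a x d) ∧
    (Submodule.span ℤ (Set.range fun p : (Fin a → ℕ) × Equiv.Perm (Fin a) =>
      opWord d (red p.2) * LinearMap.mulLeft ℤ (oddMonomial x p.1)) : Set (Module.End ℤ R)) =
      Subring.closure (IsOddDividedDifference.nilHeckeGens a x d) := by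
  classical
  have hb : ∀ c, hR.basis c = oddMonomial x c := fun c => by
    rw [IsOddPolynomialRing.basis, Module.Basis.mk_apply]
  obtain ⟨hl, hl'⟩ := linearIndependent_and_span_eq_range hR.basis
    (hd.leftComb_injective hR hred)
  obtain ⟨hr, hr'⟩ := linearIndependent_and_span_eq_range hR.basis
    (hd.rightComb_injective hR hred)
  simp only [IsOddDividedDifference.leftComb_single, hb] at hl hl'
  simp only [IsOddDividedDifference.rightComb_single, hb] at hr hr'
  exact ⟨hl, hr, by rw [hl', hd.range_leftComb hR hred], by rw [hr', hd.range_rightComb hR hred]⟩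

theorem xmon_eq_oddMonomial {a : ℕ} (c : Fin a → ℕ) : xmon c = oddMonomial (xv a) c := by
  simp only [xmon, oddMonomial, OX_eq_xv]

theorem isOddPolynomialRing_OPol (a : ℕ) : IsOddPolynomialRing a (xv a) where
  anticomm _ _ h := xv_anticomm a h
  closure_eq_top := closure_xv_eq_top a
  linearIndependent := by
    have : (oddMonomial (xv a) : (Fin a → ℕ) → OPol a) = xmon :=
      funext fun c => (xmon_eq_oddMonomial c).symm
    rw [this]
    exact linearIndependent_xmon a

theorem dword_toIntLinearMap {a : ℕ} (d : ℕ → OPol a →+ OPol a) (l : List ℕ) :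
    (dword d l).toIntLinearMap = opWord d l := by
  induction l with
  | nil => rfl
  | cons i l ih =>
    have : opWord d (i :: l) = (d i).toIntLinearMap * opWord d l := by simp [opWord]
    rw [this, ← ih]
    rfl

theorem mulL_eq {a : ℕ} (f : OPol a) : mulL f = LinearMap.mulLeft ℤ f := rfl

theorem onhGens_eq {a : ℕ} (d : ℕ → OPol a →+ OPol a) :
    onhGens a d = IsOddDividedDifference.nilHeckeGens a (xv a) d := by
  ext T
  refine or_congr ⟨?_, ?_⟩ Iff.rfl
  · rintro ⟨i, rfl⟩
    exact ⟨i + 1, by omega, by omega, by rw [OX_eq_xv, mulL_eq]⟩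
  · rintro ⟨j, h1, h2, rfl⟩
    exact ⟨⟨j - 1, by omega⟩, by rw [OX_eq_xv, mulL_eq]; simp only [Nat.sub_add_cancel h1]⟩

/-- the operators x^A∘∂_w (and the operators ∂_w∘x^A) are ℤ-linearly
independent, and each family is a ℤ-basis of the odd nilHecke ring ONH_a, the subring of
End(OPol_a) generated by the multiplication operators and the ∂_i. -/
theorem odd_nilHecke_basis (a : ℕ)
    (s : ℕ → OPol a →+* OPol a)
    (hs : ∀ i j : ℕ, 1 ≤ i → i + 1 ≤ a → 1 ≤ j → j ≤ a →
      s i (xv a j) =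
        if j = i then -xv a (i + 1) else if j = i + 1 then -xv a i else -xv a j)
    (d : ℕ → OPol a →+ OPol a)
    (hd1 : ∀ i : ℕ, 1 ≤ i → i + 1 ≤ a → d i 1 = 0)
    (hdx : ∀ i j : ℕ, 1 ≤ i → i + 1 ≤ a → 1 ≤ j → j ≤ a →
      d i (xv a j) = if j = i ∨ j = i + 1 then 1 else 0)
    (hdL : ∀ i : ℕ, 1 ≤ i → i + 1 ≤ a → ∀ f g : OPol a,
      d i (f * g) = d i f * g + s i f * d i g)
    (red : Equiv.Perm (Fin a) → List ℕ)
    (hred1 : ∀ w, ∀ i ∈ red w, 1 ≤ i ∧ i + 1 ≤ a)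
    (hred2 : ∀ w, wordPerm a (red w) = w)
    (hred3 : ∀ w, ∀ l : List ℕ, (∀ i ∈ l, 1 ≤ i ∧ i + 1 ≤ a) → wordPerm a l = w →
      (red w).length ≤ l.length) :
    LinearIndependent ℤ (fun p : (Fin a → ℕ) × Equiv.Perm (Fin a) =>
      mulL (xmon p.1) * (dword d (red p.2)).toIntLinearMap) ∧
    LinearIndependent ℤ (fun p : (Fin a → ℕ) × Equiv.Perm (Fin a) =>
      (dword d (red p.2)).toIntLinearMap * mulL (xmon p.1)) ∧
    (Submodule.span ℤ (Set.range fun p : (Fin a → ℕ) × Equiv.Perm (Fin a) =>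
        mulL (xmon p.1) * (dword d (red p.2)).toIntLinearMap) :
        Set (Module.End ℤ (OPol a))) =
      (Subring.closure (onhGens a d) : Set (Module.End ℤ (OPol a))) ∧
    (Submodule.span ℤ (Set.range fun p : (Fin a → ℕ) × Equiv.Perm (Fin a) =>
        (dword d (red p.2)).toIntLinearMap * mulL (xmon p.1)) :
        Set (Module.End ℤ (OPol a))) =
      (Subring.closure (onhGens a d) : Set (Module.End ℤ (OPol a))) := by
  have key := odd_nilHecke_basis_of_isOddPolynomialRing (isOddPolynomialRing_OPol a)
    (s := s) (d := d) ⟨hs, hd1, hdx, hdL⟩ (red := red) ⟨hred1, hred2, hred3⟩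
  simp only [dword_toIntLinearMap, xmon_eq_oddMonomial, onhGens_eq, mulL_eq]
  exact key
end

section
/- OPol_a is a free left OΛ_a-module and a free right OΛ_a-module, in both cases with homogeneous basis given by the odd Schubert polynomials {𝔰_w}_{w ∈ S_a}; its graded rank over OΛ_a is Σ_{w∈S_a} q^{2ℓ(w)} = q^{a(a−1)/2}[a]!, where ℓ is the Coxeter length and [a]! is the balanced q-factorial. -/
open scoped BigOperators

namespace OddSchubert

open Equiv

section Inversions

variable {a : ℕ}

/-- The inversions of a permutation, as ordered pairs of positions. -/
def invSet (w : Perm (Fin a)) : Finset (Fin a × Fin a) :=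
  Finset.univ.filter fun p => p.1 < p.2 ∧ w p.2 < w p.1

/-- The number of inversions of a permutation. -/
def inv (w : Perm (Fin a)) : ℕ := (invSet w).card

theorem mem_invSet (w : Perm (Fin a)) (p q : Fin a) :
    (p, q) ∈ invSet w ↔ p < q ∧ w q < w p := by
  simp [invSet]

theorem sperm_val {i : ℕ} (h1 : 1 ≤ i) (h2 : i + 1 ≤ a) (k : Fin a) :
    (sperm a i k : ℕ) = if (k : ℕ) = i - 1 then i else if (k : ℕ) = i then i - 1 else k := by
  simp only [sperm, dif_pos (And.intro h1 h2), Equiv.swap_apply_def, Fin.ext_iff]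
  split_ifs <;> rfl

theorem sperm_mul_self (i : ℕ) : sperm a i * sperm a i = 1 := by
  unfold sperm
  split_ifs <;> simp

theorem sperm_mul_cancel_left (i : ℕ) (w : Perm (Fin a)) : sperm a i * (sperm a i * w) = w := by
  rw [← mul_assoc, sperm_mul_self, one_mul]

theorem sperm_inv (i : ℕ) : (sperm a i)⁻¹ = sperm a i :=
  inv_eq_of_mul_eq_one_left (sperm_mul_self i)

theorem inv_sperm_mul_of_lt {i : ℕ} (h1 : 1 ≤ i) (h2 : i + 1 ≤ a) (w : Perm (Fin a))
    (h : w⁻¹ ⟨i - 1, by omega⟩ < w⁻¹ ⟨i, by omega⟩) :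
    inv (sperm a i * w) = inv w + 1 := by
  set u := w⁻¹ ⟨i - 1, by omega⟩ with hu
  set v := w⁻¹ ⟨i, by omega⟩ with hv
  have hwu : w u = ⟨i - 1, by omega⟩ := by simp [hu]
  have hwv : w v = ⟨i, by omega⟩ := by simp [hv]
  have key : invSet (sperm a i * w) = insert (u, v) (invSet w) := by
    ext ⟨p, q⟩
    rw [Finset.mem_insert, mem_invSet, mem_invSet, Prod.mk.injEq, Perm.mul_apply, Perm.mul_apply,
      Fin.lt_def (a := sperm a i _), Fin.lt_def (a := w _), sperm_val h1 h2, sperm_val h1 h2]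
    have e : ∀ r : Fin a, ((w r : ℕ) = i - 1 ↔ r = u) ∧ ((w r : ℕ) = i ↔ r = v) := fun r => by
      constructor
      · rw [← w.injective.eq_iff (a := r) (b := u), hwu, Fin.ext_iff]
      · rw [← w.injective.eq_iff (a := r) (b := v), hwv, Fin.ext_iff]
    rw [← (e p).1, ← (e q).2]
    have hpu := (e p).1
    have hpv := (e p).2
    have hqu := (e q).1
    have hqv := (e q).2
    have hpq : (w p : ℕ) = w q → p = q := fun h => w.injective (Fin.ext h)
    constructor
    · rintro ⟨hlt, h3⟩
      have : (w p : ℕ) ≠ w q := fun h => hlt.ne (hpq h)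
      by_cases hp : (w p : ℕ) = i - 1 ∧ (w q : ℕ) = i
      · exact Or.inl hp
      · refine Or.inr ⟨hlt, ?_⟩
        split_ifs at h3 <;> omega
    · rintro (⟨h3, h4⟩ | ⟨hlt, h3⟩)
      · rw [hpu.1 h3, hqv.1 h4]
        refine ⟨h, ?_⟩
        rw [hwu, hwv]
        simp only
        split_ifs <;> omega
      · refine ⟨hlt, ?_⟩
        by_cases hp : (w p : ℕ) = i ∧ (w q : ℕ) = i - 1
        · rw [hpv.1 hp.1, hqu.1 hp.2] at hlt
          exact absurd hlt h.asymm
        · split_ifs <;> omega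
  have hnot : (u, v) ∉ invSet w := by
    rw [mem_invSet, hwu, hwv]
    simp only [Fin.mk_lt_mk, not_and]
    omega
  rw [inv, key, Finset.card_insert_of_notMem hnot, inv]

theorem inv_sperm_mul_of_gt {i : ℕ} (h1 : 1 ≤ i) (h2 : i + 1 ≤ a) (w : Perm (Fin a))
    (h : w⁻¹ ⟨i, by omega⟩ < w⁻¹ ⟨i - 1, by omega⟩) :
    inv (sperm a i * w) + 1 = inv w := by
  have hs1 : sperm a i ⟨i - 1, by omega⟩ = ⟨i, by omega⟩ := by
    ext; rw [sperm_val h1 h2]; simp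
  have hs2 : sperm a i ⟨i, by omega⟩ = ⟨i - 1, by omega⟩ := by
    rw [← hs1, ← Perm.mul_apply, sperm_mul_self, Perm.one_apply]
  have := inv_sperm_mul_of_lt h1 h2 (sperm a i * w)
    (by rwa [mul_inv_rev, sperm_inv, Perm.mul_apply, Perm.mul_apply, hs1, hs2])
  rw [sperm_mul_cancel_left] at this
  omega

theorem lt_of_inv_sperm_mul_lt {i : ℕ} (h1 : 1 ≤ i) (h2 : i + 1 ≤ a) (w : Perm (Fin a))
    (h : inv (sperm a i * w) < inv w) :
    w⁻¹ ⟨i, by omega⟩ < w⁻¹ ⟨i - 1, by omega⟩ := by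
  rcases lt_trichotomy (w⁻¹ ⟨i, by omega⟩) (w⁻¹ ⟨i - 1, by omega⟩) with h3 | h3 | h3
  · exact h3
  · have := w⁻¹.injective h3
    simp only [Fin.mk.injEq] at this
    omega
  · have := inv_sperm_mul_of_lt h1 h2 w h3
    omega

theorem inv_sperm_mul_cases {i : ℕ} (h1 : 1 ≤ i) (h2 : i + 1 ≤ a) (w : Perm (Fin a)) :
    inv (sperm a i * w) = inv w + 1 ∨ inv (sperm a i * w) + 1 = inv w := by
  rcases lt_trichotomy (w⁻¹ ⟨i, by omega⟩) (w⁻¹ ⟨i - 1, by omega⟩) with h3 | h3 | h3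
  · exact Or.inr (inv_sperm_mul_of_gt h1 h2 w h3)
  · have := w⁻¹.injective h3
    simp only [Fin.mk.injEq] at this
    omega
  · exact Or.inl (inv_sperm_mul_of_lt h1 h2 w h3)

theorem inv_one : inv (1 : Perm (Fin a)) = 0 := by
  rw [inv, Finset.card_eq_zero, Finset.eq_empty_iff_forall_notMem]
  rintro ⟨p, q⟩ h
  rw [mem_invSet] at h
  exact absurd h.1 h.2.asymm

theorem eq_one_of_inv_eq_zero {w : Perm (Fin a)} (h : inv w = 0) : w = 1 := by
  rw [inv, Finset.card_eq_zero, Finset.eq_empty_iff_forall_notMem] at h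
  have hmono : StrictMono w := fun p q hpq => by
    have := h (p, q)
    rw [mem_invSet] at this
    exact lt_of_le_of_ne (not_lt.1 fun h' => this ⟨hpq, h'⟩) (w.injective.ne hpq.ne)
  ext p : 1
  exact congrFun (hmono.range_inj strictMono_id |>.1 (by simp [w.surjective.range_eq])) p

theorem inv_inv (w : Perm (Fin a)) : inv w⁻¹ = inv w := by
  refine Finset.card_bij' (fun p _ => (w⁻¹ p.2, w⁻¹ p.1)) (fun p _ => (w p.2, w p.1))
    ?_ ?_ ?_ ?_
  · rintro ⟨p, q⟩ h
    rw [mem_invSet] at h ⊢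
    simpa using h.symm
  · rintro ⟨p, q⟩ h
    rw [mem_invSet] at h ⊢
    simpa using h.symm
  · rintro ⟨p, q⟩ _
    simp
  · rintro ⟨p, q⟩ _
    simp

theorem inv_mul_rev (w : Perm (Fin a)) :
    inv (w * Fin.revPerm) + inv w = ∑ i : Fin a, (a - 1 - (i : ℕ)) := by
  have h1 : inv (w * Fin.revPerm) =
      (Finset.univ.filter fun p : Fin a × Fin a => p.1 < p.2 ∧ ¬ w p.2 < w p.1).card := by
    refine Finset.card_bij' (fun p _ => (Fin.rev p.2, Fin.rev p.1))
      (fun p _ => (Fin.rev p.2, Fin.rev p.1)) ?_ ?_ ?_ ?_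
    · rintro ⟨p, q⟩ h
      rw [mem_invSet] at h
      simpa using ⟨h.1, by simpa using h.2.le⟩
    · rintro ⟨p, q⟩ h
      rw [mem_invSet]
      simp only [Finset.mem_filter, Finset.mem_univ, true_and, not_lt] at h
      simpa using ⟨h.1, lt_of_le_of_ne h.2 (w.injective.ne h.1.ne)⟩
    · rintro ⟨p, q⟩ _
      simp
    · rintro ⟨p, q⟩ _
      simp
  have h2 : inv w = (Finset.univ.filter fun p : Fin a × Fin a => p.1 < p.2 ∧ w p.2 < w p.1).card :=
    rfl
  rw [h1, h2, add_comm, ← Finset.filter_filter, ← Finset.filter_filter,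
    Finset.card_filter_add_card_filter_not, Finset.card_filter,
    ← Finset.univ_product_univ, Finset.sum_product]
  refine Finset.sum_congr rfl fun i _ => ?_
  rw [← Finset.card_filter, Finset.filter_lt_eq_Ioi, Fin.card_Ioi]

theorem inv_le (w : Perm (Fin a)) : inv w ≤ ∑ i : Fin a, (a - 1 - (i : ℕ)) := by
  have := inv_mul_rev w
  omega

theorem inv_inv_mul_rev (w : Perm (Fin a)) :
    inv (w⁻¹ * Fin.revPerm) + inv w = ∑ i : Fin a, (a - 1 - (i : ℕ)) := by
  rw [← inv_inv w, inv_mul_rev]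

theorem eq_rev_of_inv_eq {w : Perm (Fin a)} (h : inv w = ∑ i : Fin a, (a - 1 - (i : ℕ))) :
    w = Fin.revPerm := by
  have h1 := inv_mul_rev w
  have h2 : w * Fin.revPerm = 1 := eq_one_of_inv_eq_zero (by omega)
  rw [mul_eq_one_iff_eq_inv] at h2
  rw [h2]
  rfl

/-- All letters of the word index simple transpositions of `S_a`. -/
def ValidWord (a : ℕ) (l : List ℕ) : Prop := ∀ i ∈ l, 1 ≤ i ∧ i + 1 ≤ a

theorem validWord_cons {i : ℕ} {l : List ℕ} :
    ValidWord a (i :: l) ↔ (1 ≤ i ∧ i + 1 ≤ a) ∧ ValidWord a l :=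
  List.forall_mem_cons

theorem validWord_append {l m : List ℕ} :
    ValidWord a (l ++ m) ↔ ValidWord a l ∧ ValidWord a m :=
  List.forall_mem_append

theorem wordPerm_cons (i : ℕ) (l : List ℕ) :
    wordPerm a (i :: l) = sperm a i * wordPerm a l := by
  simp [wordPerm]

theorem wordPerm_append (l m : List ℕ) :
    wordPerm a (l ++ m) = wordPerm a l * wordPerm a m := by
  simp [wordPerm]

theorem inv_wordPerm_le {l : List ℕ} (hl : ValidWord a l) : inv (wordPerm a l) ≤ l.length := by
  induction l with
  | nil => simp [wordPerm, inv_one]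
  | cons i l ih =>
    obtain ⟨hi, hl⟩ := validWord_cons.1 hl
    rw [wordPerm_cons, List.length_cons]
    have := ih hl
    rcases inv_sperm_mul_cases hi.1 hi.2 (wordPerm a l) with h | h <;> omega

theorem exists_descent {w : Perm (Fin a)} (h : inv w ≠ 0) :
    ∃ i, (1 ≤ i ∧ i + 1 ≤ a) ∧ inv (sperm a i * w) + 1 = inv w := by
  by_contra! hcon
  apply h
  have hlt : ∀ i (h1 : 1 ≤ i) (h2 : i + 1 ≤ a),
      w⁻¹ ⟨i - 1, by omega⟩ < w⁻¹ ⟨i, by omega⟩ := fun i h1 h2 => by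
    by_contra hn
    refine hcon i ⟨h1, h2⟩ (inv_sperm_mul_of_gt h1 h2 w (lt_of_le_of_ne (not_lt.1 hn) ?_))
    intro h3
    have := w⁻¹.injective h3
    simp only [Fin.mk.injEq] at this
    omega
  have hmono : StrictMono ⇑(w⁻¹) := by
    cases a with
    | zero => exact fun p => p.elim0
    | succ n =>
      rw [Fin.strictMono_iff_lt_succ]
      intro i
      exact hlt (i + 1) (by omega) (by omega)
  rw [← inv_inv, inv, Finset.card_eq_zero, Finset.eq_empty_iff_forall_notMem]
  rintro ⟨p, q⟩ hpq
  rw [mem_invSet] at hpq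
  exact absurd (hmono hpq.1) hpq.2.asymm

theorem exists_reduced (w : Perm (Fin a)) :
    ∃ l, ValidWord a l ∧ wordPerm a l = w ∧ l.length = inv w := by
  induction h : inv w generalizing w with
  | zero => exact ⟨[], by simp [ValidWord], by simp [wordPerm, eq_one_of_inv_eq_zero h], rfl⟩
  | succ n ih =>
    obtain ⟨i, hi, h2⟩ := exists_descent (w := w) (by omega)
    obtain ⟨l, hl, hw, hlen⟩ := ih (sperm a i * w) (by omega)
    refine ⟨i :: l, validWord_cons.2 ⟨hi, hl⟩, ?_, by simp [hlen]⟩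
    rw [wordPerm_cons, hw, sperm_mul_cancel_left]

end Inversions
section GeneratingFunction

/-- The permutation of `Fin (n + 1)` with first value `p` and remaining values in the relative
order given by `e`. -/
def insertFirst {n : ℕ} (p : Fin (n + 1)) (e : Perm (Fin n)) : Perm (Fin (n + 1)) :=
  ((finSuccEquiv n).trans (Equiv.optionCongr e)).trans (finSuccEquiv' p).symm

theorem insertFirst_zero {n : ℕ} (p : Fin (n + 1)) (e : Perm (Fin n)) :
    insertFirst p e 0 = p := by
  simp [insertFirst]

theorem insertFirst_succ {n : ℕ} (p : Fin (n + 1)) (e : Perm (Fin n)) (j : Fin n) :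
    insertFirst p e j.succ = p.succAbove (e j) := by
  simp [insertFirst]

theorem insertFirst_bijective (n : ℕ) :
    Function.Bijective fun x : Fin (n + 1) × Perm (Fin n) => insertFirst x.1 x.2 := by
  rw [Fintype.bijective_iff_injective_and_card]
  constructor
  · rintro ⟨p, e⟩ ⟨p', e'⟩ h
    simp only at h
    have h0 : p = p' := by rw [← insertFirst_zero p e, h, insertFirst_zero]
    subst h0
    refine Prod.ext rfl (Equiv.ext fun j => ?_)
    have := congrArg (fun w : Perm _ => w j.succ) h
    simp only [insertFirst_succ] at this
    exact Fin.succAbove_right_injective this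
  · simp [Fintype.card_perm, Nat.factorial_succ]

theorem inv_insertFirst {n : ℕ} (p : Fin (n + 1)) (e : Perm (Fin n)) :
    inv (insertFirst p e) = p + inv e := by
  have h1 : ∀ w : Perm (Fin (n + 1)), inv w =
      ∑ i : Fin (n + 1), ∑ j : Fin (n + 1), if i < j ∧ w j < w i then 1 else 0 := fun w => by
    rw [inv, invSet, Finset.card_filter, ← Finset.univ_product_univ, Finset.sum_product]
  have h2 : inv e = ∑ i : Fin n, ∑ j : Fin n, if i < j ∧ e j < e i then 1 else 0 := by
    rw [inv, invSet, Finset.card_filter, ← Finset.univ_product_univ, Finset.sum_product]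
  have h3 : (∑ j : Fin n, if p.succAbove (e j) < p then 1 else 0) = (p : ℕ) := by
    rw [Equiv.sum_comp e fun j => if p.succAbove j < p then 1 else 0, ← Finset.card_filter]
    simp only [Fin.succAbove_lt_iff_castSucc_lt]
    simp only [Fin.lt_def, Fin.val_castSucc]
    rw [Fin.card_filter_val_lt]
    omega
  rw [h1, h2, Fin.sum_univ_succ]
  congr 1
  · rw [Fin.sum_univ_succ]
    simpa [insertFirst_zero, insertFirst_succ, Fin.succ_pos] using h3
  · refine Finset.sum_congr rfl fun i _ => ?_
    rw [Fin.sum_univ_succ]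
    simp [insertFirst_succ, Fin.succAbove_lt_succAbove_iff]

theorem sum_X_pow_inv (a : ℕ) :
    ∑ w : Perm (Fin a), (Polynomial.X : Polynomial ℤ) ^ (2 * inv w) =
      ∏ i ∈ Finset.range a, ∑ j ∈ Finset.range (i + 1), (Polynomial.X : Polynomial ℤ) ^ (2 * j) := by
  induction a with
  | zero => simp [inv, invSet]
  | succ n ih =>
    rw [Finset.prod_range_succ, ← ih, ← (insertFirst_bijective n).sum_comp,
      ← Finset.univ_product_univ, Finset.sum_product, Finset.sum_range, mul_comm,
      Finset.sum_mul_sum]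
    simp only [inv_insertFirst, mul_add, pow_add]

end GeneratingFunction

section Matsumoto

variable {a : ℕ} {d : ℕ → OPol a →+ OPol a}

/-- The odd nilCoxeter relations. -/
structure OddNilCoxeter (a : ℕ) (d : ℕ → OPol a →+ OPol a) : Prop where
  sq : ∀ i, 1 ≤ i → i + 1 ≤ a → ∀ f, d i (d i f) = 0
  comm : ∀ i j, 1 ≤ i → i + 1 < j → j + 1 ≤ a → ∀ f, d i (d j f) = -d j (d i f)
  braid : ∀ i, 1 ≤ i → i + 2 ≤ a → ∀ f,
    d i (d (i + 1) (d i f)) = d (i + 1) (d i (d (i + 1) f))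

theorem dword_cons (i : ℕ) (l : List ℕ) (f : OPol a) :
    dword d (i :: l) f = d i (dword d l f) := rfl

theorem dword_append (l m : List ℕ) (f : OPol a) :
    dword d (l ++ m) f = dword d l (dword d m f) := by
  induction l with
  | nil => rfl
  | cons i l ih => rw [List.cons_append, dword_cons, ih, dword_cons]

/-- Equality of additive endomorphisms up to a global sign. -/
def EqUpToSign (S T : OPol a →+ OPol a) : Prop := S = T ∨ S = -T

theorem EqUpToSign.symm {S T : OPol a →+ OPol a} (h : EqUpToSign S T) : EqUpToSign T S := by
  rcases h with rfl | rfl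
  · exact Or.inl rfl
  · exact Or.inr (neg_neg T).symm

theorem EqUpToSign.trans {S T U : OPol a →+ OPol a} (h : EqUpToSign S T) (h' : EqUpToSign T U) :
    EqUpToSign S U := by
  rcases h with rfl | rfl
  · exact h'
  · rcases h' with rfl | rfl
    · exact Or.inr rfl
    · exact Or.inl (neg_neg U)

theorem EqUpToSign.comp_left {S T : OPol a →+ OPol a} (h : EqUpToSign S T)
    (D : OPol a →+ OPol a) : EqUpToSign (D.comp S) (D.comp T) := by
  rcases h with rfl | rfl
  · exact Or.inl rfl
  · exact Or.inr (by ext; simp)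

/-- The word `l` is a reduced expression of `w`. -/
def IsReducedWord (w : Perm (Fin a)) (l : List ℕ) : Prop :=
  ValidWord a l ∧ wordPerm a l = w ∧ l.length = inv w

theorem IsReducedWord.cons {w : Perm (Fin a)} {l : List ℕ} {i : ℕ} (hi : 1 ≤ i ∧ i + 1 ≤ a)
    (h : inv (sperm a i * w) + 1 = inv w) (hl : IsReducedWord (sperm a i * w) l) :
    IsReducedWord w (i :: l) := by
  refine ⟨validWord_cons.2 ⟨hi, hl.1⟩, ?_, ?_⟩
  · rw [wordPerm_cons, hl.2.1, sperm_mul_cancel_left]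
  · rw [List.length_cons, hl.2.2, h]

theorem IsReducedWord.of_cons {w : Perm (Fin a)} {l : List ℕ} {i : ℕ}
    (h : IsReducedWord w (i :: l)) :
    (1 ≤ i ∧ i + 1 ≤ a) ∧ inv (sperm a i * w) + 1 = inv w ∧
      IsReducedWord (sperm a i * w) l := by
  obtain ⟨h1, h2, h3⟩ := h
  obtain ⟨hi, hl⟩ := validWord_cons.1 h1
  rw [wordPerm_cons] at h2
  have h4 : wordPerm a l = sperm a i * w := by rw [← h2, sperm_mul_cancel_left]
  have h5 := inv_wordPerm_le hl
  rw [h4] at h5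
  rw [List.length_cons] at h3
  have h6 : inv (sperm a i * w) + 1 = inv w := by
    rcases inv_sperm_mul_cases hi.1 hi.2 w with h | h <;> omega
  exact ⟨hi, h6, hl, h4, by omega⟩

theorem exists_isReducedWord (w : Perm (Fin a)) : ∃ l, IsReducedWord w l := exists_reduced w

theorem inv_comm_descents {i j : ℕ} (hi : 1 ≤ i) (hij : i + 1 < j) (hj : j + 1 ≤ a)
    {w : Perm (Fin a)} (h1 : inv (sperm a i * w) + 1 = inv w)
    (h2 : inv (sperm a j * w) + 1 = inv w) :
    sperm a i * (sperm a j * w) = sperm a j * (sperm a i * w) ∧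
    inv (sperm a j * (sperm a i * w)) + 1 = inv (sperm a i * w) ∧
    inv (sperm a i * (sperm a j * w)) + 1 = inv (sperm a j * w) := by
  have hcomm : sperm a i * (sperm a j * w) = sperm a j * (sperm a i * w) := by
    rw [← mul_assoc, ← mul_assoc]
    congr 1
    ext k
    simp only [Perm.mul_apply, sperm_val hi (show i + 1 ≤ a by omega),
      sperm_val (show 1 ≤ j by omega) hj]
    split_ifs <;> omega
  have hd := lt_of_inv_sperm_mul_lt (show 1 ≤ j by omega) hj w (by omega)
  have e : ∀ k : Fin a, (k : ℕ) ≠ i - 1 → (k : ℕ) ≠ i → (sperm a i * w)⁻¹ k = w⁻¹ k := by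
    intro k hk1 hk2
    rw [mul_inv_rev, sperm_inv, Perm.mul_apply]
    congr 1
    ext
    rw [sperm_val hi (by omega), if_neg hk1, if_neg hk2]
  have h3 := inv_sperm_mul_of_gt (show 1 ≤ j by omega) hj (sperm a i * w) (by
    rw [e _ (by simp only; omega) (by simp only; omega),
      e _ (by simp only; omega) (by simp only; omega)]
    exact hd)
  refine ⟨hcomm, h3, ?_⟩
  rw [hcomm]
  omega

theorem inv_braid_descents {i : ℕ} (hi : 1 ≤ i) (hj : i + 2 ≤ a)
    {w : Perm (Fin a)} (h1 : inv (sperm a i * w) + 1 = inv w)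
    (h2 : inv (sperm a (i + 1) * w) + 1 = inv w) :
    sperm a i * (sperm a (i + 1) * (sperm a i * w)) =
      sperm a (i + 1) * (sperm a i * (sperm a (i + 1) * w)) ∧
    inv (sperm a (i + 1) * (sperm a i * w)) + 1 = inv (sperm a i * w) ∧
    inv (sperm a i * (sperm a (i + 1) * (sperm a i * w))) + 1 =
      inv (sperm a (i + 1) * (sperm a i * w)) ∧
    inv (sperm a i * (sperm a (i + 1) * w)) + 1 = inv (sperm a (i + 1) * w) ∧
    inv (sperm a (i + 1) * (sperm a i * (sperm a (i + 1) * w))) + 1 =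
      inv (sperm a i * (sperm a (i + 1) * w)) := by
  have v1 : sperm a i ⟨i - 1, by omega⟩ = ⟨i, by omega⟩ := by
    ext; rw [sperm_val hi (by omega)]; simp only; split_ifs <;> omega
  have v2 : sperm a i ⟨i, by omega⟩ = ⟨i - 1, by omega⟩ := by
    ext; rw [sperm_val hi (by omega)]; simp only; split_ifs <;> omega
  have v3 : sperm a i ⟨i + 1, by omega⟩ = ⟨i + 1, by omega⟩ := by
    ext; rw [sperm_val hi (by omega)]; simp only; split_ifs <;> omega
  have v4 : sperm a (i + 1) ⟨i - 1, by omega⟩ = ⟨i - 1, by omega⟩ := by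
    ext; rw [sperm_val (by omega) (by omega)]; simp only; split_ifs <;> omega
  have v5 : sperm a (i + 1) ⟨i, by omega⟩ = ⟨i + 1, by omega⟩ := by
    ext; rw [sperm_val (by omega) (by omega)]; simp only; split_ifs <;> omega
  have v6 : sperm a (i + 1) ⟨i + 1, by omega⟩ = ⟨i, by omega⟩ := by
    ext; rw [sperm_val (by omega) (by omega)]; simp only; split_ifs <;> omega
  have hbraid : sperm a i * (sperm a (i + 1) * (sperm a i * w)) =
      sperm a (i + 1) * (sperm a i * (sperm a (i + 1) * w)) := by
    simp only [← mul_assoc]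
    congr 1
    ext k : 1
    simp only [Perm.mul_apply]
    by_cases k1 : k = ⟨i - 1, by omega⟩
    · rw [k1, v1, v5, v3, v4, v1, v5]
    by_cases k2 : k = ⟨i, by omega⟩
    · rw [k2, v2, v4, v1, v5, v3, v6]
    by_cases k3 : k = ⟨i + 1, by omega⟩
    · rw [k3, v3, v6, v2, v4]
    rw [Fin.ext_iff] at k1 k2 k3
    simp only at k1 k2 k3
    have w1 : sperm a i k = k := by
      ext; rw [sperm_val hi (by omega), if_neg k1, if_neg k2]
    have w2 : sperm a (i + 1) k = k := by
      ext; rw [sperm_val (by omega) (by omega), if_neg (by omega), if_neg k3]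
    rw [w1, w2, w1, w2]
  have d1 := lt_of_inv_sperm_mul_lt hi (show i + 1 ≤ a by omega) w (by omega)
  have d2 := lt_of_inv_sperm_mul_lt (show 1 ≤ i + 1 by omega) (show i + 1 + 1 ≤ a by omega) w
    (by omega)
  simp only [Nat.add_sub_cancel] at d2
  have e : ∀ (m : ℕ) (u : Perm (Fin a)) (k k' : Fin a), sperm a m k = k' →
      (sperm a m * u)⁻¹ k = u⁻¹ k' := by
    rintro m u k k' rfl
    rw [mul_inv_rev, sperm_inv, Perm.mul_apply]
  have g1 := inv_sperm_mul_of_gt (show 1 ≤ i + 1 by omega) (show i + 1 + 1 ≤ a by omega)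
    (sperm a i * w) (by
      simp only [Nat.add_sub_cancel]
      rw [e _ _ _ _ v3, e _ _ _ _ v2]
      exact d2.trans d1)
  have g2 := inv_sperm_mul_of_gt hi (show i + 1 ≤ a by omega)
    (sperm a (i + 1) * (sperm a i * w)) (by
      rw [e _ _ _ _ v5, e _ _ _ _ v3, e _ _ _ _ v4, e _ _ _ _ v1]
      exact d2)
  have g3 := inv_sperm_mul_of_gt hi (show i + 1 ≤ a by omega) (sperm a (i + 1) * w) (by
      rw [e _ _ _ _ v5, e _ _ _ _ v4]
      exact d2.trans d1)
  refine ⟨hbraid, g1, g2, g3, ?_⟩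
  rw [← hbraid]
  omega

/-- Reduced words of the same permutation act by the same operator up to sign. -/
theorem OddNilCoxeter.dword_eqUpToSign (hd : OddNilCoxeter a d) {w : Perm (Fin a)}
    {l l' : List ℕ} (hl : IsReducedWord w l) (hl' : IsReducedWord w l') :
    EqUpToSign (dword d l) (dword d l') := by
  induction hn : inv w using Nat.strong_induction_on generalizing w l l' with
  | _ n ih =>
  subst hn
  cases l with
  | nil =>
    have h1 := hl.2.2
    have h2 := hl'.2.2
    cases l' with
    | nil => exact Or.inl rfl
    | cons j m => simp only [List.length_nil, List.length_cons] at h1 h2; omega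
  | cons i m =>
  cases l' with
  | nil =>
    have h1 := hl.2.2
    have h2 := hl'.2.2
    simp only [List.length_nil, List.length_cons] at h1 h2
    omega
  | cons j m' =>
  obtain ⟨hi, hwi, hm⟩ := hl.of_cons
  obtain ⟨hj, hwj, hm'⟩ := hl'.of_cons
  have commCase : ∀ (i j : ℕ) (m m' : List ℕ), 1 ≤ i → i + 1 < j → j + 1 ≤ a →
      inv (sperm a i * w) + 1 = inv w → inv (sperm a j * w) + 1 = inv w →
      IsReducedWord (sperm a i * w) m → IsReducedWord (sperm a j * w) m' →
      EqUpToSign (dword d (i :: m)) (dword d (j :: m')) := by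
    intro i j m m' hi hij hj hwi hwj hm hm'
    obtain ⟨c1, c2, c3⟩ := inv_comm_descents hi hij hj hwi hwj
    obtain ⟨k, hk⟩ := exists_isReducedWord (sperm a j * (sperm a i * w))
    have k1 := IsReducedWord.cons ⟨by omega, hj⟩ c2 hk
    have k2 := IsReducedWord.cons ⟨hi, by omega⟩ c3 (c1 ▸ hk)
    have s1 := (ih _ (by omega) hm k1 rfl).comp_left (d i)
    have s2 := (ih _ (by omega) hm' k2 rfl).comp_left (d j)
    refine s1.trans (EqUpToSign.trans (Or.inr ?_) s2.symm)
    ext f : 1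
    exact hd.comm i j hi hij hj _
  have braidCase : ∀ (i : ℕ) (m m' : List ℕ), 1 ≤ i → i + 2 ≤ a →
      inv (sperm a i * w) + 1 = inv w → inv (sperm a (i + 1) * w) + 1 = inv w →
      IsReducedWord (sperm a i * w) m → IsReducedWord (sperm a (i + 1) * w) m' →
      EqUpToSign (dword d (i :: m)) (dword d ((i + 1) :: m')) := by
    intro i m m' hi hj hwi hwj hm hm'
    obtain ⟨c1, c2, c3, c4, c5⟩ := inv_braid_descents hi hj hwi hwj
    obtain ⟨k, hk⟩ := exists_isReducedWord (sperm a i * (sperm a (i + 1) * (sperm a i * w)))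
    have vi : 1 ≤ i ∧ i + 1 ≤ a := ⟨hi, by omega⟩
    have vj : 1 ≤ i + 1 ∧ i + 1 + 1 ≤ a := ⟨by omega, by omega⟩
    have k1 := IsReducedWord.cons vj c2 (IsReducedWord.cons vi c3 hk)
    have k2 := IsReducedWord.cons vi c4 (IsReducedWord.cons vj c5 (c1 ▸ hk))
    have s1 := (ih _ (by omega) hm k1 rfl).comp_left (d i)
    have s2 := (ih _ (by omega) hm' k2 rfl).comp_left (d (i + 1))
    refine s1.trans (EqUpToSign.trans (Or.inl ?_) s2.symm)
    ext f : 1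
    exact hd.braid i hi hj _
  rcases lt_trichotomy i j with hij | rfl | hij
  · rcases Nat.lt_or_ge (i + 1) j with h | h
    · exact commCase i j m m' hi.1 h hj.2 hwi hwj hm hm'
    · obtain rfl : j = i + 1 := by omega
      exact braidCase i m m' hi.1 hj.2 hwi hwj hm hm'
  · exact (ih _ (by omega) hm hm' rfl).comp_left (d i)
  · rcases Nat.lt_or_ge (j + 1) i with h | h
    · exact (commCase j i m' m hj.1 h hi.2 hwj hwi hm' hm).symm
    · obtain rfl : i = j + 1 := by omega
      exact (braidCase j m' m hj.1 hi.2 hwj hwi hm' hm).symm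

/-- Non-reduced words act by zero. -/
theorem OddNilCoxeter.dword_eq_zero (hd : OddNilCoxeter a d) {l : List ℕ}
    (hl : ValidWord a l) (hne : l.length ≠ inv (wordPerm a l)) (f : OPol a) :
    dword d l f = 0 := by
  induction l with
  | nil => simp [wordPerm, inv_one] at hne
  | cons i m ih =>
    obtain ⟨hi, hm⟩ := validWord_cons.1 hl
    rw [dword_cons]
    by_cases hm' : m.length = inv (wordPerm a m)
    · rw [List.length_cons, wordPerm_cons] at hne
      have h1 : inv (sperm a i * wordPerm a m) + 1 = inv (wordPerm a m) := by
        rcases inv_sperm_mul_cases hi.1 hi.2 (wordPerm a m) with h | h <;> omega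
      obtain ⟨k, hk⟩ := exists_isReducedWord (sperm a i * wordPerm a m)
      have h2 := hd.dword_eqUpToSign ⟨hm, rfl, hm'⟩ (IsReducedWord.cons hi h1 hk)
      rcases h2 with h2 | h2
      · rw [h2, dword_cons, hd.sq i hi.1 hi.2]
      · rw [h2, AddMonoidHom.neg_apply, map_neg, dword_cons, hd.sq i hi.1 hi.2, neg_zero]
    · rw [ih hm hm', map_zero]

end Matsumoto
section OddPolynomials

variable {a : ℕ}

/-- `neg_mul` for the negation instance found on `OPol a`. -/
theorem oddPol_neg_mul (f g : OPol a) : -f * g = -(f * g) := neg_mul f g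

/-- `mul_neg` for the negation instance found on `OPol a`. -/
theorem oddPol_mul_neg (f g : OPol a) : f * -g = -(f * g) := mul_neg f g

/-- `smul_zero` for the zero found on `OPol a`. -/
theorem oddPol_zsmul_zero (n : ℤ) : n • (0 : OPol a) = 0 := smul_zero n

/-- `zero_sub` for the zero and the negation found on `OPol a`. -/
theorem oddPol_zero_sub (f : OPol a) : 0 - f = -f := zero_sub f

theorem OX_mul_OX {i j : Fin a} (h : i ≠ j) : (OX i * OX j : OPol a) = -(OX j * OX i) := by
  simpa [OX] using RingQuot.mkRingHom_rel (OddRel.anticomm i j h)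

/-- The ring homomorphism out of `OPol a` determined by anticommuting images of the variables. -/
noncomputable def oddLift {R : Type} [Ring R] (g : Fin a → R)
    (hg : ∀ i j, i ≠ j → g i * g j = -(g j * g i)) : OPol a →+* R :=
  RingQuot.lift ⟨(FreeAlgebra.lift ℤ g : FreeAlgebra ℤ (Fin a) →+* R), by
    rintro _ _ ⟨i, j, h⟩
    simpa using hg i j h⟩

theorem oddLift_OX {R : Type} [Ring R] (g : Fin a → R)
    (hg : ∀ i j, i ≠ j → g i * g j = -(g j * g i)) (i : Fin a) : oddLift g hg (OX i) = g i := by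
  rw [oddLift, OX, RingQuot.lift_mkRingHom_apply]
  simp

theorem oddPol_induction {P : OPol a → Prop} (one : P 1) (neg : ∀ f, P f → P (-f))
    (add : ∀ f g, P f → P g → P (f + g)) (mul : ∀ i f, P f → P (OX i * f)) (f : OPol a) : P f := by
  let N : AddSubgroup (OPol a) :=
    { carrier := {f | P f}
      add_mem' := fun {f g} => add f g
      zero_mem' := by simpa using add _ _ one (neg _ one)
      neg_mem' := fun {f} => neg f }
  have key : ∀ p : FreeAlgebra ℤ (Fin a), ∀ g ∈ N,
      RingQuot.mkRingHom (OddRel a) p * g ∈ N := fun p => by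
    induction p using FreeAlgebra.induction with
    | grade0 r =>
      intro g hg
      have : RingQuot.mkRingHom (OddRel a) (algebraMap ℤ _ r) * g = r • g := by
        rw [eq_intCast (algebraMap ℤ (FreeAlgebra ℤ (Fin a))) r, map_intCast, zsmul_eq_mul]
      rw [this]
      exact N.zsmul_mem hg r
    | grade1 i => exact fun g hg => mul i g hg
    | mul p q hp hq =>
      intro g hg
      rw [map_mul, mul_assoc]
      exact hp _ (hq _ hg)
    | add p q hp hq =>
      intro g hg
      rw [map_add, add_mul]
      exact N.add_mem (hp _ hg) (hq _ hg)
  obtain ⟨p, rfl⟩ := RingQuot.mkRingHom_surjective (OddRel a) f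
  have := key p 1 one
  rwa [mul_one] at this

/-- The anti-involution of `OPol a` fixing the variables. -/
noncomputable def reversal (a : ℕ) : OPol a →+* (OPol a)ᵐᵒᵖ :=
  oddLift (fun i => MulOpposite.op (OX i)) fun i j h => by
    rw [← MulOpposite.op_mul, ← MulOpposite.op_mul, ← MulOpposite.op_neg, OX_mul_OX h.symm]

/-- The reversal anti-involution as an additive endomorphism. -/
noncomputable def rev (f : OPol a) : OPol a := (reversal a f).unop

theorem rev_add (f g : OPol a) : rev (f + g) = rev f + rev g := by simp [rev]

theorem rev_neg (f : OPol a) : rev (-f) = -rev f := by simp [rev]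

theorem rev_mul (f g : OPol a) : rev (f * g) = rev g * rev f := by simp [rev]

theorem rev_one : rev (1 : OPol a) = 1 := by simp [rev]

theorem rev_zero : rev (0 : OPol a) = 0 := by simp [rev]

theorem rev_zsmul (n : ℤ) (f : OPol a) : rev (n • f) = n • rev f := by
  rw [rev, map_zsmul, MulOpposite.unop_smul, rev]

theorem rev_sum {ι : Type} (t : Finset ι) (f : ι → OPol a) :
    rev (∑ i ∈ t, f i) = ∑ i ∈ t, rev (f i) := by simp [rev]

theorem rev_OX (i : Fin a) : rev (OX i) = OX i := by simp [rev, reversal, oddLift_OX]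

theorem rev_rev (f : OPol a) : rev (rev f) = f := by
  induction f using oddPol_induction with
  | one => simp only [rev_one]
  | neg f h => simp only [rev_neg, h]
  | add f g hf hg => simp only [rev_add, hf, hg]
  | mul i f h => simp only [rev_mul, rev_OX, h]

/-- The hypotheses on the ring homomorphisms `s i` and the odd divided differences `d i`. -/
structure OddDividedDiff (a : ℕ) (s : ℕ → OPol a →+* OPol a) (d : ℕ → OPol a →+ OPol a) :
    Prop where
  s_X : ∀ i, 1 ≤ i → i + 1 ≤ a → ∀ k : Fin a, s i (OX k) = -OX (sperm a i k)
  d_one : ∀ i, 1 ≤ i → i + 1 ≤ a → d i 1 = 0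
  d_X : ∀ i, 1 ≤ i → i + 1 ≤ a → ∀ k : Fin a,
    d i (OX k) = if (k : ℕ) + 1 = i ∨ (k : ℕ) = i then 1 else 0
  leibniz : ∀ i, 1 ≤ i → i + 1 ≤ a → ∀ f g, d i (f * g) = d i f * g + s i f * d i g

theorem xv_succ (k : Fin a) : xv a (k + 1) = OX k := by
  rw [xv, dif_pos ⟨by omega, by omega⟩]
  rfl

theorem OddDividedDiff.mk_of_xv {s : ℕ → OPol a →+* OPol a} {d : ℕ → OPol a →+ OPol a}
    (hs : ∀ i j : ℕ, 1 ≤ i → i + 1 ≤ a → 1 ≤ j → j ≤ a →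
      s i (xv a j) =
        if j = i then -xv a (i + 1) else if j = i + 1 then -xv a i else -xv a j)
    (hd1 : ∀ i : ℕ, 1 ≤ i → i + 1 ≤ a → d i 1 = 0)
    (hdx : ∀ i j : ℕ, 1 ≤ i → i + 1 ≤ a → 1 ≤ j → j ≤ a →
      d i (xv a j) = if j = i ∨ j = i + 1 then 1 else 0)
    (hdL : ∀ i : ℕ, 1 ≤ i → i + 1 ≤ a → ∀ f g : OPol a,
      d i (f * g) = d i f * g + s i f * d i g) :
    OddDividedDiff a s d where
  s_X i h1 h2 k := by
    have hv := sperm_val h1 h2 k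
    rw [← xv_succ, ← xv_succ, hs i _ h1 h2 (by omega) (by omega), hv]
    split_ifs <;> first | omega | rfl | (congr 2; omega)
  d_one := hd1
  d_X i h1 h2 k := by
    rw [← xv_succ, hdx i _ h1 h2 (by omega) (by omega)]
    simp only [Nat.add_right_cancel_iff]
  leibniz := hdL

namespace OddDividedDiff

variable {s : ℕ → OPol a →+* OPol a} {d : ℕ → OPol a →+ OPol a}

/-- The integer `∂_i(x_k)`. -/
def coeff (i : ℕ) (k : Fin a) : ℤ := if (k : ℕ) + 1 = i ∨ (k : ℕ) = i then 1 else 0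

theorem coeff_sperm_self {i : ℕ} (h1 : 1 ≤ i) (h2 : i + 1 ≤ a) (k : Fin a) :
    coeff i (sperm a i k) = coeff i k := by
  have hv := sperm_val h1 h2 k
  unfold coeff
  congr 1
  split_ifs at hv <;> simp only [eq_iff_iff] <;> omega

theorem coeff_sperm_of_lt {i j : ℕ} (h1 : 1 ≤ i) (hij : i + 1 < j) (h2 : j + 1 ≤ a) (k : Fin a) :
    coeff i (sperm a j k) = coeff i k ∧ coeff j (sperm a i k) = coeff j k := by
  have hv := sperm_val h1 (show i + 1 ≤ a by omega) k
  have hw := sperm_val (show 1 ≤ j by omega) h2 k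
  unfold coeff
  constructor
  · congr 1
    split_ifs at hw <;> simp only [eq_iff_iff] <;> omega
  · congr 1
    split_ifs at hv <;> simp only [eq_iff_iff] <;> omega

theorem coeff_sperm_sperm {i : ℕ} (h1 : 1 ≤ i) (h2 : i + 2 ≤ a) (k : Fin a) :
    coeff i (sperm a (i + 1) (sperm a i k)) = coeff (i + 1) k ∧
      coeff (i + 1) (sperm a i (sperm a (i + 1) k)) = coeff i k := by
  have hv := sperm_val h1 (show i + 1 ≤ a by omega) k
  have hw := sperm_val (show 1 ≤ i + 1 by omega) h2 k
  have hv' := sperm_val h1 (show i + 1 ≤ a by omega) (sperm a (i + 1) k)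
  have hw' := sperm_val (show 1 ≤ i + 1 by omega) h2 (sperm a i k)
  unfold coeff
  constructor
  · congr 1
    split_ifs at hv <;> split_ifs at hw' <;> simp only [eq_iff_iff] <;> omega
  · congr 1
    split_ifs at hw <;> split_ifs at hv' <;> simp only [eq_iff_iff] <;> omega

theorem d_X_eq (h : OddDividedDiff a s d) {i : ℕ} (h1 : 1 ≤ i) (h2 : i + 1 ≤ a) (k : Fin a) :
    d i (OX k) = (coeff i k : OPol a) := by
  rw [h.d_X i h1 h2, coeff]
  split_ifs <;> simp

theorem d_X_mul (h : OddDividedDiff a s d) {i : ℕ} (h1 : 1 ≤ i) (h2 : i + 1 ≤ a) (k : Fin a)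
    (f : OPol a) : d i (OX k * f) = coeff i k • f - OX (sperm a i k) * d i f := by
  rw [h.leibniz i h1 h2, h.d_X_eq h1 h2, h.s_X i h1 h2, zsmul_eq_mul, oddPol_neg_mul, sub_eq_add_neg]

theorem sperm_apply_sperm (i : ℕ) (k : Fin a) : sperm a i (sperm a i k) = k := by
  rw [← Perm.mul_apply, sperm_mul_self, Perm.one_apply]

theorem oddNilCoxeter (h : OddDividedDiff a s d) : OddNilCoxeter a d where
  sq i h1 h2 f := by
    induction f using oddPol_induction with
    | one => rw [h.d_one i h1 h2, map_zero]
    | neg f hf => rw [map_neg, map_neg, hf, neg_zero]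
    | add f g hf hg => rw [map_add, map_add, hf, hg, add_zero]
    | mul k f hf =>
      rw [h.d_X_mul h1 h2, map_sub, map_zsmul, h.d_X_mul h1 h2, coeff_sperm_self h1 h2, hf,
        mul_zero, sub_zero, sub_self]
  comm i j h1 hij h2 f := by
    have hi : i + 1 ≤ a := by omega
    have hj : 1 ≤ j := by omega
    induction f using oddPol_induction with
    | one => rw [h.d_one i h1 hi, h.d_one j hj h2, map_zero, map_zero, neg_zero]
    | neg f hf => rw [map_neg, map_neg, hf, map_neg, map_neg]
    | add f g hf hg => rw [map_add, map_add, hf, hg, map_add, map_add, neg_add]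
    | mul k f hf =>
      have hk : sperm a i (sperm a j k) = sperm a j (sperm a i k) := by
        ext
        have v1 := sperm_val h1 hi k
        have v2 := sperm_val hj h2 k
        have v3 := sperm_val h1 hi (sperm a j k)
        have v4 := sperm_val hj h2 (sperm a i k)
        split_ifs at v1 <;> split_ifs at v2 <;> split_ifs at v3 <;> split_ifs at v4 <;> omega
      rw [h.d_X_mul hj h2, h.d_X_mul h1 hi, map_sub, map_sub, map_zsmul, map_zsmul,
        h.d_X_mul hj h2, h.d_X_mul h1 hi, (coeff_sperm_of_lt h1 hij h2 k).1,
        (coeff_sperm_of_lt h1 hij h2 k).2, hf, hk, oddPol_mul_neg]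
      abel
  braid i h1 h2 f := by
    have hi : i + 1 ≤ a := by omega
    have hj : 1 ≤ i + 1 := by omega
    have hsq : ∀ j, 1 ≤ j → j + 1 ≤ a → ∀ f, d j (d j f) = 0 := by
      intro j h1 h2 f
      induction f using oddPol_induction with
      | one => rw [h.d_one j h1 h2, map_zero]
      | neg f hf => rw [map_neg, map_neg, hf, neg_zero]
      | add f g hf hg => rw [map_add, map_add, hf, hg, add_zero]
      | mul k f hf =>
        rw [h.d_X_mul h1 h2, map_sub, map_zsmul, h.d_X_mul h1 h2, coeff_sperm_self h1 h2, hf,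
          mul_zero, sub_zero, sub_self]
    induction f using oddPol_induction with
    | one => simp only [h.d_one i h1 hi, h.d_one (i + 1) hj h2, map_zero]
    | neg f hf => simp only [map_neg, hf]
    | add f g hf hg => simp only [map_add, hf, hg]
    | mul k f hf =>
      have hk : sperm a i (sperm a (i + 1) (sperm a i k)) =
          sperm a (i + 1) (sperm a i (sperm a (i + 1) k)) := by
        ext
        have v1 := sperm_val h1 hi k
        have v2 := sperm_val hj h2 k
        have v3 := sperm_val h1 hi (sperm a (i + 1) k)
        have v4 := sperm_val hj h2 (sperm a i k)
        have v5 := sperm_val h1 hi (sperm a (i + 1) (sperm a i k))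
        have v6 := sperm_val hj h2 (sperm a i (sperm a (i + 1) k))
        split_ifs at v1 <;> split_ifs at v2 <;> split_ifs at v3 <;> try omega
        all_goals split_ifs at v4 <;> try omega
        all_goals split_ifs at v5 <;> try omega
        all_goals split_ifs at v6 <;> omega
      simp only [h.d_X_mul hj h2, h.d_X_mul h1 hi, map_sub, map_zsmul, hsq i h1 hi,
        hsq (i + 1) hj h2, hf, hk, (coeff_sperm_sperm h1 h2 k).1, (coeff_sperm_sperm h1 h2 k).2,
        oddPol_zsmul_zero, oddPol_zero_sub]
      abel

theorem s_s (h : OddDividedDiff a s d) {i : ℕ} (h1 : 1 ≤ i) (h2 : i + 1 ≤ a) (f : OPol a) :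
    s i (s i f) = f := by
  induction f using oddPol_induction with
  | one => simp only [map_one]
  | neg f hf => simp only [map_neg, hf]
  | add f g hf hg => simp only [map_add, hf, hg]
  | mul k f hf =>
    rw [map_mul, map_mul, hf, h.s_X i h1 h2, map_neg, h.s_X i h1 h2, neg_neg, sperm_apply_sperm]

theorem s_rev (h : OddDividedDiff a s d) {i : ℕ} (h1 : 1 ≤ i) (h2 : i + 1 ≤ a) (f : OPol a) :
    s i (d i (rev f)) = rev (d i f) := by
  induction f using oddPol_induction with
  | one => rw [rev_one, h.d_one i h1 h2, map_zero, rev_zero]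
  | neg f hf => rw [rev_neg, map_neg, map_neg, hf, map_neg, rev_neg]
  | add f g hf hg => rw [rev_add, map_add, map_add, hf, hg, map_add, rev_add]
  | mul k f hf =>
    rw [rev_mul, rev_OX, h.leibniz i h1 h2, map_add, map_mul, map_mul, hf, h.s_s h1 h2,
      h.d_X_mul h1 h2, h.s_X i h1 h2, h.d_X_eq h1 h2, map_intCast, sub_eq_add_neg, rev_add,
      rev_zsmul, rev_neg, rev_mul, rev_OX, zsmul_eq_mul, Int.cast_comm, oddPol_mul_neg, add_comm]

theorem d_rev_eq_zero (h : OddDividedDiff a s d) {i : ℕ} (h1 : 1 ≤ i) (h2 : i + 1 ≤ a)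
    {f : OPol a} (hf : d i f = 0) : d i (rev f) = 0 := by
  rw [← h.s_s h1 h2 (d i (rev f)), h.s_rev h1 h2, hf, rev_zero, map_zero]

end OddDividedDiff

end OddPolynomials
section Words

variable {a : ℕ}

/-- The product of the variables along a list of letters. -/
noncomputable def word (l : List (Fin a)) : OPol a := (l.map OX).prod

theorem word_nil : word ([] : List (Fin a)) = 1 := rfl

theorem word_cons (k : Fin a) (l : List (Fin a)) : word (k :: l) = OX k * word l := by
  simp [word]

theorem word_append (l m : List (Fin a)) : word (l ++ m) = word l * word m := by
  simp [word]

theorem word_eq_or_neg_of_perm {l m : List (Fin a)} (h : l.Perm m) :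
    word l = word m ∨ word l = -word m := by
  induction h with
  | nil => exact Or.inl rfl
  | cons k _ ih =>
    rw [word_cons, word_cons]
    rcases ih with ih | ih
    · exact Or.inl (by rw [ih])
    · exact Or.inr (by rw [ih, oddPol_mul_neg])
  | swap i j l =>
    simp only [word_cons]
    by_cases hij : i = j
    · exact Or.inl (by rw [hij])
    · refine Or.inr ?_
      rw [← mul_assoc, OX_mul_OX (Ne.symm hij), oddPol_neg_mul, mul_assoc]
  | trans _ _ ih1 ih2 =>
    rcases ih1 with h1 | h1 <;> rcases ih2 with h2 | h2
    · exact Or.inl (h1.trans h2)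
    · exact Or.inr (h1.trans h2)
    · exact Or.inr (by rw [h1, h2])
    · refine Or.inl ?_
      rw [h1, h2]
      exact neg_neg _

/-- The additive span of the words satisfying `Q`. -/
def wordSpan (Q : List (Fin a) → Prop) : AddSubgroup (OPol a) :=
  AddSubgroup.closure {f | ∃ l, Q l ∧ f = word l}

theorem word_mem_wordSpan {Q : List (Fin a) → Prop} {l : List (Fin a)} (h : Q l) :
    word l ∈ wordSpan Q :=
  AddSubgroup.subset_closure ⟨l, h, rfl⟩

theorem wordSpan_mono {Q Q' : List (Fin a) → Prop} (h : ∀ l, Q l → Q' l) :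
    wordSpan Q ≤ wordSpan Q' :=
  AddSubgroup.closure_mono fun _ ⟨l, hl, hf⟩ => ⟨l, h l hl, hf⟩

theorem map_mem_of_mem_wordSpan {Q : List (Fin a) → Prop} {N : AddSubgroup (OPol a)}
    (T : OPol a →+ OPol a) (h : ∀ l, Q l → T (word l) ∈ N) {f : OPol a} (hf : f ∈ wordSpan Q) :
    T f ∈ N := by
  have : wordSpan Q ≤ N.comap T := by
    rw [wordSpan, AddSubgroup.closure_le]
    rintro _ ⟨l, hl, rfl⟩
    exact h l hl
  exact this hf

theorem mul_mem_of_mem_wordSpan {Q Q' : List (Fin a) → Prop} (k : Fin a)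
    (h : ∀ l, Q l → Q' (k :: l)) {f : OPol a} (hf : f ∈ wordSpan Q) :
    OX k * f ∈ wordSpan Q' :=
  map_mem_of_mem_wordSpan (AddMonoidHom.mulLeft (OX k)) (fun l hl => by
    rw [AddMonoidHom.coe_mulLeft, ← word_cons]
    exact word_mem_wordSpan (h l hl)) hf

/-- `q` copies of the block `u v`. -/
def blocks (q : ℕ) (u v : Fin a) : List (Fin a) := (List.replicate q [u, v]).flatten

theorem blocks_succ (q : ℕ) (u v : Fin a) : blocks (q + 1) u v = u :: v :: blocks q u v := by
  simp [blocks, List.replicate_succ]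

theorem count_blocks (q : ℕ) {u v : Fin a} (huv : u ≠ v) (k : Fin a) :
    (blocks q u v).count k = if k = u ∨ k = v then q else 0 := by
  induction q with
  | zero => simp [blocks]
  | succ q ih =>
    rw [blocks_succ, List.count_cons, List.count_cons, ih]
    simp only [beq_iff_eq]
    split_ifs <;> grind

theorem length_blocks (q : ℕ) (u v : Fin a) : (blocks q u v).length = 2 * q := by
  simp [blocks, mul_comm]

namespace OddDividedDiff

variable {s : ℕ → OPol a →+* OPol a} {d : ℕ → OPol a →+ OPol a}

/-- The letters `u ≠ v` are the two letters exchanged by the simple transposition `s_i`. -/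
structure Exchanged (a i : ℕ) (u v : Fin a) : Prop where
  one_le : 1 ≤ i
  lt : i + 1 ≤ a
  ne : u ≠ v
  left : sperm a i u = v
  right : sperm a i v = u
  coeff_left : coeff i u = 1
  coeff_right : coeff i v = 1
  coeff_other : ∀ k, k ≠ u → k ≠ v → coeff i k = 0

theorem Exchanged.symm {i : ℕ} {u v : Fin a} (h : Exchanged a i u v) : Exchanged a i v u :=
  ⟨h.1, h.2, h.3.symm, h.5, h.4, h.7, h.6, fun k h1 h2 => h.8 k h2 h1⟩

theorem exchanged {i : ℕ} (h1 : 1 ≤ i) (h2 : i + 1 ≤ a) :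
    Exchanged a i ⟨i - 1, by omega⟩ ⟨i, by omega⟩ where
  one_le := h1
  lt := h2
  ne := by simp only [ne_eq, Fin.mk.injEq]; omega
  left := by ext; rw [sperm_val h1 h2]; simp
  right := by ext; rw [sperm_val h1 h2]; simp only; split_ifs <;> omega
  coeff_left := by simp only [coeff]; split_ifs <;> omega
  coeff_right := by simp [coeff]
  coeff_other k h3 h4 := by
    rw [ne_eq, Fin.ext_iff] at h3 h4
    simp only at h3 h4
    simp only [coeff]; split_ifs <;> omega

variable {i : ℕ} {u v : Fin a}

theorem d_X_left_mul (h : OddDividedDiff a s d) (e : Exchanged a i u v) (f : OPol a) :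
    d i (OX u * f) = f - OX v * d i f := by
  rw [h.d_X_mul e.one_le e.lt, e.coeff_left, e.left, one_zsmul]

theorem d_pair_mul (h : OddDividedDiff a s d) (e : Exchanged a i u v) (f : OPol a) :
    d i (OX u * (OX v * f)) = OX v * (OX u * d i f) := by
  rw [h.d_X_left_mul e, h.d_X_left_mul e.symm, mul_sub, sub_sub_cancel]

theorem d_blocks (h : OddDividedDiff a s d) (e : Exchanged a i u v) (q : ℕ) (C : List (Fin a)) :
    d i (word (blocks q u v ++ C)) = word (blocks q v u) * d i (word C) := by
  induction q with
  | zero => simp [blocks, word_nil]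
  | succ q ih =>
    rw [blocks_succ, List.cons_append, List.cons_append, word_cons, word_cons, h.d_pair_mul e, ih,
      blocks_succ, word_cons, word_cons, mul_assoc, mul_assoc]

theorem d_word_of_notMem (h : OddDividedDiff a s d) (e : Exchanged a i u v) {C : List (Fin a)}
    (hu : u ∉ C) (hv : v ∉ C) : d i (word C) = 0 := by
  induction C with
  | nil => exact h.d_one i e.one_le e.lt
  | cons k C ih =>
    rw [List.mem_cons, not_or] at hu hv
    rw [word_cons, h.d_X_mul e.one_le e.lt, e.coeff_other k (Ne.symm hu.1) (Ne.symm hv.1),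
      ih hu.2 hv.2, zero_zsmul, mul_zero, sub_zero]

theorem d_replicate_mem (h : OddDividedDiff a s d) (e : Exchanged a i u v) {C : List (Fin a)}
    (hu : u ∉ C) (hv : v ∉ C) (m : ℕ) :
    d i (word (List.replicate m u ++ C)) ∈ wordSpan fun l =>
      (∀ k, k ≠ u → k ≠ v → l.count k = C.count k) ∧ l.count u < m ∧ l.count v < m := by
  induction m with
  | zero =>
    rw [List.replicate_zero, List.nil_append, h.d_word_of_notMem e hu hv]
    exact zero_mem _
  | succ m ih =>
    rw [List.replicate_succ, List.cons_append, word_cons, h.d_X_left_mul e]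
    refine sub_mem (word_mem_wordSpan ⟨fun k h1 _ => ?_, ?_, ?_⟩)
      (mul_mem_of_mem_wordSpan v (fun l hl => ⟨fun k h1 h2 => ?_, ?_, ?_⟩) ih)
    · rw [List.count_append, List.count_replicate, if_neg (by simpa using h1.symm), zero_add]
    · rw [List.count_append, List.count_replicate_self, List.count_eq_zero.2 hu]
      omega
    · rw [List.count_append, List.count_replicate, if_neg (by simpa using e.ne),
        List.count_eq_zero.2 hv]
      omega
    · rw [List.count_cons_of_ne h2.symm, hl.1 k h1 h2]
    · rw [List.count_cons_of_ne e.ne.symm]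
      omega
    · rw [List.count_cons_self]
      omega

theorem exists_perm_blocks (e : Exchanged a i u v) {l : List (Fin a)}
    (hle : l.count v ≤ l.count u) :
    ∃ C : List (Fin a), u ∉ C ∧ v ∉ C ∧ (∀ k, k ≠ u → k ≠ v → C.count k = l.count k) ∧
      l.Perm (blocks (l.count v) u v ++
        (List.replicate (l.count u - l.count v) u ++ C)) := by
  refine ⟨l.filter fun k => k ≠ u ∧ k ≠ v, by simp, by simp, fun k h1 h2 => ?_, ?_⟩
  · rw [List.count_filter (by simp [h1, h2])]
  · rw [List.perm_iff_count]
    intro k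
    rw [List.count_append, List.count_append, count_blocks _ e.ne, List.count_replicate]
    by_cases h1 : k = u
    · subst h1
      rw [List.count_eq_zero.2 (by simp : k ∉ l.filter fun k' => k' ≠ k ∧ k' ≠ v)]
      simp
      omega
    by_cases h2 : k = v
    · subst h2
      rw [List.count_eq_zero.2 (by simp : k ∉ l.filter fun k' => k' ≠ u ∧ k' ≠ k)]
      simp [e.ne]
    · rw [List.count_filter (by simp [h1, h2])]
      simp [h1, h2, Ne.symm h1]

theorem d_word_mem (h : OddDividedDiff a s d) (e : Exchanged a i u v) {l : List (Fin a)}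
    (hle : l.count v ≤ l.count u) :
    d i (word l) ∈ wordSpan fun m => (∀ k, k ≠ u → k ≠ v → m.count k = l.count k) ∧
      m.count u < l.count u ∧ m.count v < l.count u := by
  obtain ⟨C, hu, hv, hC, hperm⟩ := exists_perm_blocks e hle
  have hmem : d i (word (blocks (l.count v) u v ++
      (List.replicate (l.count u - l.count v) u ++ C))) ∈ wordSpan fun m =>
        (∀ k, k ≠ u → k ≠ v → m.count k = l.count k) ∧
          m.count u < l.count u ∧ m.count v < l.count u := by
    rw [h.d_blocks e]
    refine map_mem_of_mem_wordSpan (AddMonoidHom.mulLeft _) (fun m hm => ?_)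
      (h.d_replicate_mem e hu hv _)
    rw [AddMonoidHom.coe_mulLeft, ← word_append]
    refine word_mem_wordSpan ⟨fun k h1 h2 => ?_, ?_, ?_⟩
    · rw [List.count_append, count_blocks _ e.ne.symm, hm.1 k h1 h2, hC k h1 h2,
        if_neg (by simp [h1, h2]), zero_add]
    · rw [List.count_append, count_blocks _ e.ne.symm, if_pos (Or.inr rfl)]
      omega
    · rw [List.count_append, count_blocks _ e.ne.symm, if_pos (Or.inl rfl)]
      omega
  rcases word_eq_or_neg_of_perm hperm with h1 | h1
  · rwa [h1]
  · rw [h1, map_neg]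
    exact neg_mem hmem

/-- The span of the words dividing the staircase monomial up to sign. -/
def staircase (a : ℕ) : AddSubgroup (OPol a) :=
  wordSpan fun l => ∀ k : Fin a, l.count k ≤ a - 1 - k

theorem d_mem_staircase (h : OddDividedDiff a s d) {i : ℕ} (h1 : 1 ≤ i) (h2 : i + 1 ≤ a)
    {f : OPol a} (hf : f ∈ staircase a) : d i f ∈ staircase a := by
  refine map_mem_of_mem_wordSpan (d i) (fun l hl => ?_) hf
  have e := exchanged h1 h2
  have hlo := hl ⟨i - 1, by omega⟩
  have hhi := hl ⟨i, by omega⟩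
  simp only at hlo hhi
  rcases le_total (l.count ⟨i, by omega⟩) (l.count ⟨i - 1, by omega⟩) with hle | hle
  · refine wordSpan_mono ?_ (h.d_word_mem e hle)
    rintro m ⟨m1, m2, m3⟩ k
    by_cases k1 : k = ⟨i - 1, by omega⟩
    · subst k1; simp only; omega
    by_cases k2 : k = ⟨i, by omega⟩
    · subst k2; simp only; omega
    rw [m1 k k1 k2]
    exact hl k
  · refine wordSpan_mono ?_ (h.d_word_mem e.symm hle)
    rintro m ⟨m1, m2, m3⟩ k
    by_cases k1 : k = ⟨i - 1, by omega⟩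
    · subst k1; simp only; omega
    by_cases k2 : k = ⟨i, by omega⟩
    · subst k2; simp only; omega
    rw [m1 k k2 k1]
    exact hl k

theorem rev_word (l : List (Fin a)) : rev (word l) = word l.reverse := by
  induction l with
  | nil => exact rev_one
  | cons k l ih =>
    rw [word_cons, rev_mul, ih, rev_OX, List.reverse_cons, word_append, word_cons, word_nil,
      mul_one]

theorem rev_mem_staircase {f : OPol a} (hf : f ∈ staircase a) : rev f ∈ staircase a := by
  refine map_mem_of_mem_wordSpan (AddMonoidHom.mk' rev rev_add) (fun l hl => ?_) hf
  rw [AddMonoidHom.mk'_apply, rev_word]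
  exact word_mem_wordSpan fun k => by rw [List.count_reverse]; exact hl k

/-- The list of letters of the staircase monomial. -/
def staircaseWord (a : ℕ) : List (Fin a) :=
  (List.finRange a).flatMap fun i : Fin a => List.replicate (a - 1 - (i : ℕ)) i

theorem xdelta_eq_word : xdelta a = word (staircaseWord a) := by
  simp [xdelta, word, staircaseWord, List.prod_flatten, List.flatMap_def,
    Function.comp_def]

theorem count_staircaseWord (k : Fin a) : (staircaseWord a).count k = a - 1 - k := by
  rw [staircaseWord, List.count_flatMap, ← Fin.sum_univ_def]
  simp [List.count_replicate]

theorem length_staircaseWord : (staircaseWord a).length = ∑ i : Fin a, (a - 1 - (i : ℕ)) := by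
  rw [staircaseWord, List.length_flatMap, ← Fin.sum_univ_def]
  simp

theorem xdelta_mem_staircase : xdelta a ∈ staircase a := by
  rw [xdelta_eq_word]
  exact word_mem_wordSpan fun k => (count_staircaseWord k).le

theorem exists_d_word_eq (h : OddDividedDiff a s d) (e : Exchanged a i u v) {l : List (Fin a)}
    (hc : l.count u = l.count v + 1) :
    ∃ m : List (Fin a), l.length = m.length + 1 ∧
      (d i (word l) = word m ∨ d i (word l) = -word m) ∧
      ∀ k, m.count k = if k = u then l.count k - 1 else l.count k := by
  obtain ⟨C, hu, hv, hC, hperm⟩ := exists_perm_blocks e (l := l) (by omega)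
  rw [hc, Nat.add_sub_cancel_left] at hperm
  have hd : d i (word (blocks (l.count v) u v ++ (List.replicate 1 u ++ C))) =
      word (blocks (l.count v) v u ++ C) := by
    rw [h.d_blocks e, List.replicate_one, List.singleton_append, word_cons, h.d_X_left_mul e,
      h.d_word_of_notMem e hu hv, mul_zero, sub_zero, word_append]
  refine ⟨blocks (l.count v) v u ++ C, ?_, ?_, fun k => ?_⟩
  · rw [hperm.length_eq]
    simp only [List.length_append, length_blocks, List.length_replicate]
    omega
  · rcases word_eq_or_neg_of_perm hperm with h1 | h1
    · exact Or.inl (by rw [h1, hd])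
    · exact Or.inr (by rw [h1, map_neg, hd])
  · rw [List.count_append, count_blocks _ e.ne.symm]
    by_cases h1 : k = u
    · subst h1
      rw [if_pos (Or.inr rfl), if_pos rfl, List.count_eq_zero.2 hu]
      omega
    rw [if_neg h1]
    by_cases h2 : k = v
    · subst h2
      rw [if_pos (Or.inl rfl), List.count_eq_zero.2 hv, add_zero]
    · rw [if_neg (by simp [h1, h2]), zero_add, hC k h1 h2]

/-- Monomials whose exponents weakly decrease to zero in steps of at most one are sent to `±1` by
some composite of odd divided differences. -/
theorem exists_dword_word_eq (h : OddDividedDiff a s d) (l : List (Fin a))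
    (hstep : ∀ k (hk : k + 1 < a), l.count ⟨k, by omega⟩ = l.count ⟨k + 1, hk⟩ ∨
      l.count ⟨k, by omega⟩ = l.count ⟨k + 1, hk⟩ + 1)
    (hlast : ∀ k (hk : k + 1 = a), l.count ⟨k, by omega⟩ = 0) :
    ∃ m, ValidWord a m ∧ m.length = l.length ∧
      (dword d m (word l) = 1 ∨ dword d m (word l) = -1) := by
  induction hn : l.length generalizing l with
  | zero =>
    rw [List.length_eq_zero_iff] at hn
    subst hn
    exact ⟨[], by simp [ValidWord], rfl, Or.inl rfl⟩
  | succ n ih =>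
    have hex : ∃ j, ∃ hj : j + 1 < a, l.count ⟨j, by omega⟩ = l.count ⟨j + 1, hj⟩ + 1 := by
      by_contra! hcon
      have hzero : ∀ t k (hk : k + t + 1 = a), l.count ⟨k, by omega⟩ = 0 := by
        intro t
        induction t with
        | zero => exact fun k hk => hlast k hk
        | succ t iht =>
          intro k hk
          rw [(hstep k (by omega)).resolve_right (hcon k (by omega)), iht (k + 1) (by omega)]
      cases l with
      | nil => simp at hn
      | cons k l =>
        have := hzero (a - 1 - k) k (by omega)
        simp at this
    classical
    obtain ⟨j, ⟨hj, hcj⟩, hmin⟩ :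
        ∃ j, (∃ hj : j + 1 < a, l.count ⟨j, by omega⟩ = l.count ⟨j + 1, hj⟩ + 1) ∧
          ∀ k < j, ¬∃ hk : k + 1 < a, l.count ⟨k, by omega⟩ = l.count ⟨k + 1, hk⟩ + 1 :=
      ⟨Nat.find hex, Nat.find_spec hex, fun k hk => Nat.find_min hex hk⟩
    have e := exchanged (a := a) (i := j + 1) (by omega) (by omega)
    obtain ⟨m, hlen, hdm, hcount⟩ := h.exists_d_word_eq e (l := l) (by simpa using hcj)
    simp only [Nat.add_sub_cancel] at hcount
    obtain ⟨w, hw, hwlen, hdw⟩ := ih m (by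
      intro k hk
      rw [hcount, hcount]
      simp only [Fin.mk.injEq]
      rcases lt_trichotomy k j with hkj | hkj | hkj
      · have h1 : l.count ⟨k, by omega⟩ = l.count ⟨k + 1, hk⟩ :=
          (hstep k hk).resolve_right fun h2 => hmin k hkj ⟨hk, h2⟩
        rw [if_neg hkj.ne]
        split_ifs with h2
        · subst h2
          omega
        · exact Or.inl h1
      · subst hkj
        rw [if_pos rfl, if_neg (by omega)]
        omega
      · rw [if_neg hkj.ne', if_neg (by omega)]
        exact hstep k hk) (by
      intro k hk
      rw [hcount, hlast k hk]
      split_ifs <;> rfl) (by omega)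
    refine ⟨w ++ [j + 1], validWord_append.2 ⟨hw, ?_⟩, ?_, ?_⟩
    · simpa [ValidWord] using hj
    · simp [hwlen]
    · rw [dword_append]
      have : dword d [j + 1] (word l) = d (j + 1) (word l) := rfl
      rw [this]
      rcases hdm with h1 | h1 <;> rcases hdw with h2 | h2 <;> rw [h1]
      · exact Or.inl h2
      · exact Or.inr h2
      · exact Or.inr (by rw [map_neg, h2])
      · refine Or.inl ?_
        rw [map_neg, h2]
        exact neg_neg _

theorem exists_dword_xdelta (h : OddDividedDiff a s d) :
    ∃ m, ValidWord a m ∧ m.length = ∑ i : Fin a, (a - 1 - (i : ℕ)) ∧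
      (dword d m (xdelta a) = 1 ∨ dword d m (xdelta a) = -1) := by
  rw [← length_staircaseWord, xdelta_eq_word]
  refine h.exists_dword_word_eq _ (fun k hk => ?_) (fun k hk => ?_)
  · rw [count_staircaseWord, count_staircaseWord]
    simp only
    omega
  · rw [count_staircaseWord]
    simp only
    omega

/-- The span of the words in the first `k` variables. -/
def firstVars (a k : ℕ) : AddSubgroup (OPol a) := wordSpan fun l => ∀ j ∈ l, (j : ℕ) < k

/-- The automorphism negating all variables except `x_u`. -/
noncomputable def negExcept (u : Fin a) : OPol a →+* OPol a :=
  oddLift (fun k => if k = u then OX k else -OX k) fun i j hij => by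
    have := OX_mul_OX hij
    have h1 : ∀ f g : OPol a, f * -g = -(f * g) := oddPol_mul_neg
    have h2 : ∀ f g : OPol a, -f * g = -(f * g) := oddPol_neg_mul
    split_ifs <;> simp only [h1, h2, this]

/-- The endomorphism sending `x_v` to zero and fixing the other variables. -/
noncomputable def killVar (v : Fin a) : OPol a →+* OPol a :=
  oddLift (fun k => if k = v then 0 else OX k) fun i j hij => by
    have h0 : -(0 : OPol a) = 0 := neg_zero
    split_ifs
    · rw [mul_zero]; exact h0.symm
    · rw [mul_zero, zero_mul]; exact h0.symm
    · rw [mul_zero, zero_mul]; exact h0.symm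
    · exact OX_mul_OX hij

theorem negExcept_mul (u : Fin a) (f : OPol a) : negExcept u f * OX u = OX u * f := by
  induction f using oddPol_induction with
  | one => rw [map_one, one_mul, mul_one]
  | neg f hf => rw [map_neg, oddPol_neg_mul, hf, oddPol_mul_neg]
  | add f g hf hg => rw [map_add, add_mul, hf, hg, mul_add]
  | mul k f hf =>
    rw [map_mul, mul_assoc, hf, negExcept, oddLift_OX]
    split_ifs with hk
    · rw [hk]
    · rw [oddPol_neg_mul, ← mul_assoc, OX_mul_OX hk, oddPol_neg_mul, mul_assoc]
      exact neg_neg _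

theorem killVar_word {v : Fin a} {l : List (Fin a)} (hv : v ∉ l) :
    killVar v (word l) = word l := by
  induction l with
  | nil => exact map_one _
  | cons k l ih =>
    rw [List.mem_cons, not_or] at hv
    rw [word_cons, map_mul, ih hv.2, killVar, oddLift_OX, if_neg (Ne.symm hv.1)]

/-- A polynomial in `x_1, …, x_i` killed by `∂_i` does not involve `x_i`. -/
theorem mem_firstVars_of_d_eq_zero (h : OddDividedDiff a s d) {i : ℕ} (h1 : 1 ≤ i)
    (h2 : i + 1 ≤ a) {f : OPol a} (hf : f ∈ firstVars a i) (hdf : d i f = 0) :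
    f ∈ firstVars a (i - 1) := by
  have e := exchanged h1 h2
  set u : Fin a := ⟨i - 1, by omega⟩ with hu
  set v : Fin a := ⟨i, by omega⟩ with hv
  let T : OPol a →+ OPol a := (negExcept u).toAddMonoidHom.comp
    ((AddMonoidHom.mulRight (OX u)).comp (killVar v).toAddMonoidHom)
  have hT : ∀ g, T g = negExcept u (killVar v g * OX u) := fun g => rfl
  have key : f - T (d i f) ∈ firstVars a (i - 1) := by
    refine map_mem_of_mem_wordSpan (AddMonoidHom.id (OPol a) - T.comp (d i)) (fun l hl => ?_) hf
    change word l - T (d i (word l)) ∈ _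
    induction l with
    | nil =>
      rw [word_nil, h.d_one i h1 h2, map_zero, sub_zero, ← word_nil]
      exact word_mem_wordSpan (by simp)
    | cons k l ih =>
      have hk := hl k (by simp)
      have hl' : ∀ j ∈ l, (j : ℕ) < i := fun j hj => hl j (by simp [hj])
      have hvl : v ∉ l := fun hvl => by
        have := hl' v hvl
        simp only [hv] at this
        omega
      by_cases hku : k = u
      · have : T (d i (word (k :: l))) = word (k :: l) := by
          rw [hku, word_cons, h.d_X_left_mul e, hT, map_sub, map_mul (killVar v) (OX v),
            killVar_word hvl]
          have hkv : killVar v (OX v) = 0 := by rw [killVar, oddLift_OX, if_pos rfl]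
          rw [hkv, zero_mul, sub_zero, map_mul]
          have hku' : negExcept u (OX u) = OX u := by rw [negExcept, oddLift_OX, if_pos rfl]
          rw [hku', negExcept_mul]
        rw [this, sub_self]
        exact zero_mem _
      · have hkv : k ≠ v := fun hkv => by
          rw [hkv] at hk
          simp only [hv] at hk
          omega
        have hsp : sperm a i k = k := by
          rw [hu, Fin.ext_iff] at hku
          rw [hv, ne_eq, Fin.ext_iff] at hkv
          ext
          rw [sperm_val h1 h2, if_neg hku, if_neg hkv]
        have : T (d i (word (k :: l))) = OX k * T (d i (word l)) := by
          rw [word_cons, h.d_X_mul h1 h2, e.coeff_other k hku hkv, zero_zsmul, zero_sub, hsp,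
            map_neg, hT, hT, map_mul (killVar v), killVar, oddLift_OX, if_neg hkv, ← killVar,
            mul_assoc, map_mul (negExcept u) (OX k)]
          have hkn : negExcept u (OX k) = -OX k := by rw [negExcept, oddLift_OX, if_neg hku]
          rw [hkn, oddPol_neg_mul]
          exact neg_neg _
        rw [this, word_cons, ← mul_sub]
        refine mul_mem_of_mem_wordSpan k (fun m hm => ?_) (ih hl')
        rw [List.forall_mem_cons]
        refine ⟨?_, hm⟩
        rw [hu, Fin.ext_iff] at hku
        simp only at hku
        omega
  rwa [hdf, map_zero, sub_zero] at key

/-- A polynomial in the staircase span killed by all odd divided differences is constant. -/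
theorem exists_int_of_mem_staircase (h : OddDividedDiff a s d) {f : OPol a}
    (hf : f ∈ staircase a) (hdf : ∀ i, 1 ≤ i → i + 1 ≤ a → d i f = 0) :
    ∃ n : ℤ, f = n • (1 : OPol a) := by
  have hmem : ∀ t, f ∈ firstVars a (a - 1 - t) := by
    intro t
    induction t with
    | zero =>
      refine wordSpan_mono (fun l hl j hj => ?_) hf
      have h1 := hl j
      have h2 := List.count_pos_iff.2 hj
      omega
    | succ t ih =>
      by_cases ht : a - 1 - t = 0
      · rwa [← Nat.sub_sub, ht, Nat.zero_sub, ← ht]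
      · have := h.mem_firstVars_of_d_eq_zero (by omega) (by omega) ih
          (hdf _ (by omega) (by omega))
        rwa [← Nat.sub_sub]
  have h0 := hmem a
  rw [Nat.sub_eq_zero_of_le (by omega)] at h0
  have hle : firstVars a 0 ≤ AddSubgroup.zmultiples (1 : OPol a) := by
    rw [firstVars, wordSpan, AddSubgroup.closure_le]
    rintro _ ⟨l, hl, rfl⟩
    cases l with
    | nil => exact AddSubgroup.mem_zmultiples _
    | cons k l => exact absurd (hl k (by simp)) (by simp)
  obtain ⟨n, hn⟩ := AddSubgroup.mem_zmultiples_iff.1 (hle h0)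
  exact ⟨n, hn.symm⟩

end OddDividedDiff

end Words

section Basis

variable {a : ℕ} {s : ℕ → OPol a →+* OPol a} {d : ℕ → OPol a →+ OPol a}
  {red : Perm (Fin a) → List ℕ}

/-- `Finset.smul_sum` for the integer action found on `OPol a`. -/
theorem oddPol_zsmul_sum {ι : Type} (n : ℤ) (t : Finset ι) (f : ι → OPol a) :
    n • ∑ i ∈ t, f i = ∑ i ∈ t, n • f i := Finset.smul_sum

/-- `Finset.sum_smul` for the integer action found on `OPol a`. -/
theorem oddPol_sum_zsmul {ι : Type} (t : Finset ι) (n : ι → ℤ) (f : OPol a) :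
    (∑ i ∈ t, n i) • f = ∑ i ∈ t, n i • f := Finset.sum_smul

/-- `sub_smul` for the integer action found on `OPol a`. -/
theorem oddPol_sub_zsmul (m n : ℤ) (f : OPol a) : (m - n) • f = m • f - n • f := sub_smul m n f

/-- The additive group of odd symmetric polynomials. -/
def oddSymmetric (d : ℕ → OPol a →+ OPol a) : AddSubgroup (OPol a) where
  carrier := {f | ∀ i, 1 ≤ i → i + 1 ≤ a → d i f = 0}
  zero_mem' := fun i _ _ => map_zero (d i)
  add_mem' := fun hf hg i h1 h2 => by rw [map_add, hf i h1 h2, hg i h1 h2, add_zero]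
  neg_mem' := fun hf i h1 h2 => by rw [map_neg, hf i h1 h2, neg_zero]

theorem mem_oddSymmetric {f : OPol a} :
    f ∈ oddSymmetric d ↔ ∀ i, 1 ≤ i → i + 1 ≤ a → d i f = 0 := Iff.rfl

theorem mem_iInf_ker_iff {f : OPol a} :
    f ∈ (⨅ i ∈ Finset.Icc 1 (a - 1), LinearMap.ker (d i).toIntLinearMap) ↔
      f ∈ oddSymmetric d := by
  simp only [Submodule.mem_iInf, Finset.mem_Icc, LinearMap.mem_ker, mem_oddSymmetric]
  exact ⟨fun h i h1 h2 => h i ⟨h1, by omega⟩, fun h i hi => h i hi.1 (by omega)⟩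

theorem isReducedWord_of_length_le {w : Perm (Fin a)} {l : List ℕ} (hl : ValidWord a l)
    (hw : wordPerm a l = w)
    (hmin : ∀ m : List ℕ, ValidWord a m → wordPerm a m = w → l.length ≤ m.length) :
    IsReducedWord w l := by
  obtain ⟨m, hm, hmw, hlen⟩ := exists_reduced w
  refine ⟨hl, hw, le_antisymm ?_ (hw ▸ inv_wordPerm_le hl)⟩
  rw [← hlen]
  exact hmin m hm hmw

namespace OddDividedDiff

theorem dword_mul (h : OddDividedDiff a s d) {l : List ℕ} (hl : ValidWord a l) (f : OPol a)
    {c : OPol a} (hc : c ∈ oddSymmetric d) : dword d l (f * c) = dword d l f * c := by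
  induction l with
  | nil => rfl
  | cons i l ih =>
    obtain ⟨hi, hl⟩ := validWord_cons.1 hl
    rw [dword_cons, ih hl, h.leibniz i hi.1 hi.2, hc i hi.1 hi.2, mul_zero, add_zero, dword_cons]

/-- A composite of odd divided differences along a word of maximal length sends the staircase
monomial to `±1` if the word is reduced. -/
theorem dword_xdelta (h : OddDividedDiff a s d) {l : List ℕ}
    (hl : IsReducedWord (Fin.revPerm : Perm (Fin a)) l) :
    ∃ n : ℤ, n * n = 1 ∧ dword d l (xdelta a) = n • 1 := by
  obtain ⟨m, hm, hlen, hval⟩ := h.exists_dword_xdelta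
  have hsign : ∃ n : ℤ, n * n = 1 ∧ dword d m (xdelta a) = n • 1 := by
    rcases hval with hval | hval
    · exact ⟨1, rfl, by rw [hval, one_zsmul]⟩
    · exact ⟨-1, rfl, by rw [hval, neg_zsmul, one_zsmul]⟩
  obtain ⟨n, hn, hmn⟩ := hsign
  by_cases hred : m.length = inv (wordPerm a m)
  · have hm' : IsReducedWord (Fin.revPerm : Perm (Fin a)) m :=
      ⟨hm, eq_rev_of_inv_eq (hred ▸ hlen), by rw [← eq_rev_of_inv_eq (hred ▸ hlen), hred]⟩
    rcases h.oddNilCoxeter.dword_eqUpToSign hl hm' with h1 | h1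
    · exact ⟨n, hn, by rw [h1, hmn]⟩
    · exact ⟨-n, by rw [neg_mul_neg, hn], by rw [h1, AddMonoidHom.neg_apply, hmn, neg_zsmul]⟩
  · rw [h.oddNilCoxeter.dword_eq_zero hm hred] at hmn
    have htriv : (1 : OPol a) = 0 := by
      rw [← one_zsmul (1 : OPol a), ← hn, mul_zsmul, ← hmn, oddPol_zsmul_zero]
    refine ⟨1, rfl, ?_⟩
    rw [← mul_one (dword d l (xdelta a)), htriv, mul_zero, oddPol_zsmul_zero]

theorem dword_schubert (red : Perm (Fin a) → List ℕ) (u w : Perm (Fin a)) :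
    dword d (red u) (schubert a d red w) =
      dword d (red u ++ red (w⁻¹ * Fin.revPerm)) (xdelta a) :=
  (dword_append _ _ _).symm

theorem dword_schubert_self (h : OddDividedDiff a s d) (hred : ∀ w, IsReducedWord w (red w))
    (w : Perm (Fin a)) :
    ∃ n : ℤ, n * n = 1 ∧ dword d (red w) (schubert a d red w) = n • 1 := by
  rw [dword_schubert]
  have hw := hred w
  have hw' := hred (w⁻¹ * Fin.revPerm)
  have hinv := inv_inv_mul_rev w
  have hrev : inv (Fin.revPerm : Perm (Fin a)) = ∑ i : Fin a, (a - 1 - (i : ℕ)) := by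
    simpa [inv_one] using inv_inv_mul_rev (1 : Perm (Fin a))
  refine h.dword_xdelta ⟨validWord_append.2 ⟨hw.1, hw'.1⟩, ?_, ?_⟩
  · rw [wordPerm_append, hw.2.1, hw'.2.1, mul_inv_cancel_left]
  · rw [List.length_append, hw.2.2, hw'.2.2, hrev, ← hinv, add_comm]

theorem dword_schubert_of_ne (h : OddDividedDiff a s d) (hred : ∀ w, IsReducedWord w (red w))
    {u w : Perm (Fin a)} (hle : inv w ≤ inv u) (hne : u ≠ w) :
    dword d (red u) (schubert a d red w) = 0 := by
  rw [dword_schubert]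
  have hu := hred u
  have hw := hred (w⁻¹ * Fin.revPerm)
  have hinv := inv_inv_mul_rev w
  refine h.oddNilCoxeter.dword_eq_zero (validWord_append.2 ⟨hu.1, hw.1⟩) (fun hlen => hne ?_) _
  have hle' := inv_le (wordPerm a (red u ++ red (w⁻¹ * Fin.revPerm)))
  rw [List.length_append, hu.2.2, hw.2.2] at hlen
  have hperm := eq_rev_of_inv_eq (w := wordPerm a (red u ++ red (w⁻¹ * Fin.revPerm))) (by omega)
  rwa [wordPerm_append, hu.2.1, hw.2.1, ← mul_assoc, mul_eq_right, mul_inv_eq_one] at hperm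

/-- Right linear independence of the odd Schubert polynomials over odd symmetric polynomials. -/
theorem eq_zero_of_sum_schubert_mul (h : OddDividedDiff a s d)
    (hred : ∀ w, IsReducedWord w (red w)) {c : Perm (Fin a) → OPol a}
    (hc : ∀ w, c w ∈ oddSymmetric d) (hsum : ∑ w, schubert a d red w * c w = 0)
    (w : Perm (Fin a)) : c w = 0 := by
  induction hn : (∑ i : Fin a, (a - 1 - (i : ℕ))) - inv w using Nat.strong_induction_on
    generalizing w with
  | _ n ih =>
    subst hn
    have h1 := congrArg (dword d (red w)) hsum
    rw [map_sum, map_zero, Finset.sum_eq_single w] at h1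
    · rw [h.dword_mul (hred w).1 _ (hc w)] at h1
      obtain ⟨n, hn, hw⟩ := h.dword_schubert_self hred w
      rw [hw, smul_mul_assoc, one_mul] at h1
      rw [← one_zsmul (c w), ← hn, mul_zsmul, h1, oddPol_zsmul_zero]
    · intro v _ hvw
      rw [h.dword_mul (hred w).1 _ (hc v)]
      rcases le_or_gt (inv v) (inv w) with hle | hlt
      · rw [h.dword_schubert_of_ne hred hle hvw.symm, zero_mul]
      · rw [ih _ _ v rfl, mul_zero]
        have := inv_le v
        omega
    · exact fun hw => absurd (Finset.mem_univ w) hw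

/-- Existence of expansions in odd Schubert polynomials inside a subgroup stable under odd
divided differences. -/
theorem exists_sum_schubert_mul (h : OddDividedDiff a s d)
    (hred : ∀ w, IsReducedWord w (red w)) {N : AddSubgroup (OPol a)}
    (hN : ∀ i, 1 ≤ i → i + 1 ≤ a → ∀ f ∈ N, d i f ∈ N)
    (hmul : ∀ w, ∀ c ∈ N, c ∈ oddSymmetric d → schubert a d red w * c ∈ N)
    {f : OPol a} (hf : f ∈ N) :
    ∃ c : Perm (Fin a) → OPol a, (∀ w, c w ∈ N ∧ c w ∈ oddSymmetric d) ∧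
      f = ∑ w, schubert a d red w * c w := by
  classical
  have hNword : ∀ l, ValidWord a l → ∀ g ∈ N, dword d l g ∈ N := by
    intro l hl g hg
    induction l with
    | nil => exact hg
    | cons i l ih =>
      obtain ⟨hi, hl⟩ := validWord_cons.1 hl
      exact hN i hi.1 hi.2 _ (ih hl)
  have key : ∀ n, ∀ f ∈ N, (∀ v, n ≤ inv v → dword d (red v) f = 0) →
      ∃ c : Perm (Fin a) → OPol a, (∀ w, c w ∈ N ∧ c w ∈ oddSymmetric d) ∧
        f = ∑ w, schubert a d red w * c w := by
    intro n
    induction n with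
    | zero =>
      intro f _ hzero
      refine ⟨fun _ => 0, fun _ => ⟨zero_mem _, zero_mem _⟩, ?_⟩
      have h1 := hzero 1 (Nat.zero_le _)
      have h2 : red 1 = [] := List.length_eq_zero_iff.1 ((hred 1).2.2.trans inv_one)
      rw [h2] at h1
      rw [show f = 0 from h1]
      simp only [mul_zero, Finset.sum_const_zero]
    | succ n ih =>
      intro f hf hzero
      choose e he hself using h.dword_schubert_self hred
      let b : Perm (Fin a) → OPol a := fun w => if inv w = n then e w • dword d (red w) f else 0
      have hb : ∀ w, b w ∈ N ∧ b w ∈ oddSymmetric d := by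
        intro w
        by_cases hw : inv w = n
        · simp only [b, if_pos hw]
          refine ⟨zsmul_mem (hNword _ (hred w).1 f hf) _, zsmul_mem (fun i h1 h2 => ?_) _⟩
          rw [← dword_cons]
          rcases inv_sperm_mul_cases h1 h2 w with h3 | h3
          · have hi : IsReducedWord (sperm a i * w) (i :: red w) :=
              IsReducedWord.cons ⟨h1, h2⟩ (by rw [sperm_mul_cancel_left, h3])
                (by rw [sperm_mul_cancel_left]; exact hred w)
            have h4 := hzero (sperm a i * w) (by omega)
            rcases h.oddNilCoxeter.dword_eqUpToSign hi (hred (sperm a i * w)) with h5 | h5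
            · rw [h5, h4]
            · rw [h5, AddMonoidHom.neg_apply, h4, neg_zero]
          · refine h.oddNilCoxeter.dword_eq_zero (validWord_cons.2 ⟨⟨h1, h2⟩, (hred w).1⟩) ?_ f
            rw [List.length_cons, wordPerm_cons, (hred w).2.1, (hred w).2.2]
            omega
        · simp only [b, if_neg hw]
          exact ⟨zero_mem _, zero_mem _⟩
      have hg : f - ∑ w, schubert a d red w * b w ∈ N :=
        sub_mem hf (sum_mem fun w _ => hmul w _ (hb w).1 (hb w).2)
      obtain ⟨c, hc, hsum⟩ := ih _ hg (by
        intro v hv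
        have hterm : ∀ w, w ≠ v → dword d (red v) (schubert a d red w * b w) = 0 := by
          intro w hwv
          by_cases hw : inv w = n
          · rw [h.dword_mul (hred v).1 _ (hb w).2,
              h.dword_schubert_of_ne hred (by omega) hwv.symm, zero_mul]
          · simp only [b, if_neg hw, mul_zero, map_zero]
        rw [map_sub, map_sum, Finset.sum_eq_single v (fun w _ hw => hterm w hw)
          (fun hv => absurd (Finset.mem_univ v) hv), h.dword_mul (hred v).1 _ (hb v).2, hself,
          smul_mul_assoc, one_mul]
        by_cases hvn : inv v = n
        · simp only [b, if_pos hvn]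
          rw [← mul_zsmul, he, one_zsmul, sub_self]
        · simp only [b, if_neg hvn]
          rw [hzero v (by omega), oddPol_zsmul_zero, sub_self])
      refine ⟨fun w => c w + b w, fun w =>
        ⟨add_mem (hc w).1 (hb w).1, add_mem (hc w).2 (hb w).2⟩, ?_⟩
      simp only [mul_add, Finset.sum_add_distrib]
      rw [← hsum, sub_add_cancel]
  refine key ((∑ i : Fin a, (a - 1 - (i : ℕ))) + 1) f hf fun v hv => ?_
  have := inv_le v
  omega

theorem exists_right_expansion (h : OddDividedDiff a s d) (hred : ∀ w, IsReducedWord w (red w))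
    (f : OPol a) :
    ∃ c : Perm (Fin a) → OPol a, (∀ w, c w ∈ oddSymmetric d) ∧
      f = ∑ w, schubert a d red w * c w := by
  obtain ⟨c, hc, hf⟩ := h.exists_sum_schubert_mul hred (N := ⊤) (fun _ _ _ _ _ => trivial)
    (fun _ _ _ _ => trivial) (f := f) trivial
  exact ⟨c, fun w => (hc w).2, hf⟩

theorem dword_mem_staircase (h : OddDividedDiff a s d) {l : List ℕ} (hl : ValidWord a l)
    {f : OPol a} (hf : f ∈ staircase a) : dword d l f ∈ staircase a := by
  induction l with
  | nil => exact hf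
  | cons i l ih =>
    obtain ⟨hi, hl⟩ := validWord_cons.1 hl
    exact h.d_mem_staircase hi.1 hi.2 (ih hl)

theorem schubert_mem_staircase (h : OddDividedDiff a s d) (hred : ∀ w, IsReducedWord w (red w))
    (w : Perm (Fin a)) : schubert a d red w ∈ staircase a :=
  h.dword_mem_staircase (hred _).1 xdelta_mem_staircase

/-- The staircase span is spanned over the integers by the odd Schubert polynomials. -/
theorem exists_int_expansion (h : OddDividedDiff a s d) (hred : ∀ w, IsReducedWord w (red w))
    {f : OPol a} (hf : f ∈ staircase a) :
    ∃ n : Perm (Fin a) → ℤ, f = ∑ w, n w • schubert a d red w := by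
  obtain ⟨c, hc, hsum⟩ := h.exists_sum_schubert_mul hred (N := staircase a)
    (fun i h1 h2 f hf => h.d_mem_staircase h1 h2 hf) (fun w c hc hc' => by
      obtain ⟨n, rfl⟩ := h.exists_int_of_mem_staircase hc hc'
      rw [mul_smul_comm, mul_one]
      exact zsmul_mem (h.schubert_mem_staircase hred w) n) hf
  choose n hn using fun w => h.exists_int_of_mem_staircase (hc w).1 (hc w).2
  refine ⟨n, ?_⟩
  rw [hsum]
  exact Finset.sum_congr rfl fun w _ => by rw [hn w, mul_smul_comm, mul_one]

theorem rev_mem_oddSymmetric (h : OddDividedDiff a s d) {f : OPol a}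
    (hf : f ∈ oddSymmetric d) : rev f ∈ oddSymmetric d :=
  fun i h1 h2 => h.d_rev_eq_zero h1 h2 (hf i h1 h2)

/-- The reversal acts on odd Schubert polynomials by an integer matrix. -/
theorem exists_rev_matrix (h : OddDividedDiff a s d) (hred : ∀ w, IsReducedWord w (red w)) :
    ∃ n : Perm (Fin a) → Perm (Fin a) → ℤ,
      ∀ w, rev (schubert a d red w) = ∑ v, n v w • schubert a d red v := by
  choose n hn using fun w =>
    h.exists_int_expansion hred (rev_mem_staircase (h.schubert_mem_staircase hred w))
  exact ⟨fun v w => n w v, hn⟩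

theorem exists_left_expansion (h : OddDividedDiff a s d) (hred : ∀ w, IsReducedWord w (red w))
    (f : OPol a) :
    ∃ c : Perm (Fin a) → OPol a, (∀ w, c w ∈ oddSymmetric d) ∧
      f = ∑ w, c w * schubert a d red w := by
  obtain ⟨n, hn⟩ := h.exists_rev_matrix hred
  obtain ⟨c, hc, hf⟩ := h.exists_right_expansion hred (rev f)
  refine ⟨fun v => ∑ w, n v w • rev (c w), fun v =>
    sum_mem fun w _ => zsmul_mem (h.rev_mem_oddSymmetric (hc w)) _, ?_⟩
  rw [← rev_rev f, hf, rev_sum]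
  simp only [rev_mul, hn, Finset.mul_sum, Finset.sum_mul]
  rw [Finset.sum_comm]
  refine Finset.sum_congr rfl fun v _ => Finset.sum_congr rfl fun w _ => ?_
  rw [mul_smul_comm, smul_mul_assoc]

/-- Left linear independence of the odd Schubert polynomials over odd symmetric polynomials. -/
theorem eq_zero_of_sum_mul_schubert (h : OddDividedDiff a s d)
    (hred : ∀ w, IsReducedWord w (red w)) {c : Perm (Fin a) → OPol a}
    (hc : ∀ w, c w ∈ oddSymmetric d) (hsum : ∑ w, c w * schubert a d red w = 0)
    (w : Perm (Fin a)) : c w = 0 := by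
  classical
  obtain ⟨n, hn⟩ := h.exists_rev_matrix hred
  have hone : (1 : OPol a) ∈ oddSymmetric d := h.d_one
  have hsq : ∀ u w, (∑ v, n u v * n v w) • (1 : OPol a) = (if u = w then 1 else 0 : ℤ) • 1 := by
    intro u w
    rw [← sub_eq_zero, ← oddPol_sub_zsmul]
    refine h.eq_zero_of_sum_schubert_mul hred
      (c := fun u => ((∑ v, n u v * n v w) - (if u = w then 1 else 0)) • (1 : OPol a))
      (fun u => zsmul_mem hone _) ?_ u
    have hrev : rev (rev (schubert a d red w)) =
        ∑ u, (∑ v, n u v * n v w) • schubert a d red u := by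
      rw [hn w, rev_sum]
      simp only [rev_zsmul, hn, oddPol_zsmul_sum, oddPol_sum_zsmul]
      rw [Finset.sum_comm]
      refine Finset.sum_congr rfl fun v _ => Finset.sum_congr rfl fun w _ => ?_
      rw [mul_comm, mul_zsmul]
    simp only [oddPol_sub_zsmul, mul_sub, mul_smul_comm, mul_one, Finset.sum_sub_distrib]
    rw [← hrev, rev_rev]
    simp only [ite_smul, one_zsmul, zero_zsmul, Finset.sum_ite_eq', Finset.mem_univ, if_true,
      sub_self]
  have hlin : ∀ v, ∑ w, n v w • rev (c w) = 0 := by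
    refine h.eq_zero_of_sum_schubert_mul hred
      (fun v => sum_mem fun w _ => zsmul_mem (h.rev_mem_oddSymmetric (hc w)) _) ?_
    have hrev := congrArg rev hsum
    rw [rev_sum, rev_zero] at hrev
    rw [← hrev]
    simp only [rev_mul, hn, Finset.mul_sum, Finset.sum_mul]
    rw [Finset.sum_comm]
    refine Finset.sum_congr rfl fun v _ => Finset.sum_congr rfl fun w _ => ?_
    rw [mul_smul_comm, smul_mul_assoc]
  have hcw : rev (c w) = 0 := by
    calc rev (c w) = ∑ u, ((if w = u then 1 else 0 : ℤ) • (1 : OPol a)) * rev (c u) := by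
          simp only [ite_smul, one_zsmul, zero_zsmul, ite_mul, one_mul, zero_mul,
            Finset.sum_ite_eq, Finset.mem_univ, if_true]
      _ = ∑ v, n w v • ∑ u, n v u • rev (c u) := by
          simp only [← hsq, smul_mul_assoc, one_mul]
          simp only [oddPol_zsmul_sum, oddPol_sum_zsmul]
          rw [Finset.sum_comm]
          refine Finset.sum_congr rfl fun v _ => Finset.sum_congr rfl fun u _ => ?_
          rw [mul_zsmul]
      _ = 0 := by simp only [hlin, oddPol_zsmul_zero, Finset.sum_const_zero]
  rw [← rev_rev (c w), hcw, rev_zero]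

end OddDividedDiff

end Basis

section Homogeneity

variable {a : ℕ} {s : ℕ → OPol a →+* OPol a} {d : ℕ → OPol a →+ OPol a}
  {red : Perm (Fin a) → List ℕ}

theorem word_mem_degComp (l : List (Fin a)) : word l ∈ degComp a l.length :=
  Submodule.subset_span ⟨l, rfl, rfl⟩

theorem OX_mul_mem_degComp (k : Fin a) {n : ℕ} {f : OPol a} (hf : f ∈ degComp a n) :
    OX k * f ∈ degComp a (n + 1) := by
  induction hf using Submodule.span_induction with
  | mem f hf =>
    obtain ⟨l, rfl, rfl⟩ := hf
    exact word_cons k l ▸ word_mem_degComp (k :: l)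
  | zero => rw [mul_zero]; exact zero_mem _
  | add f g _ _ hf hg => rw [mul_add]; exact add_mem hf hg
  | smul n f _ hf => rw [mul_smul_comm]; exact Submodule.smul_mem _ n hf

namespace OddDividedDiff

theorem d_word_mem_degComp (h : OddDividedDiff a s d) {i : ℕ} (h1 : 1 ≤ i) (h2 : i + 1 ≤ a)
    (n : ℕ) (l : List (Fin a)) (hl : l.length = n + 1) : d i (word l) ∈ degComp a n := by
  induction n generalizing l with
  | zero =>
    obtain ⟨k, rfl⟩ := List.length_eq_one_iff.1 hl
    rw [word_cons, h.d_X_mul h1 h2, word_nil, h.d_one i h1 h2, mul_zero, sub_zero]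
    exact zsmul_mem (word_mem_degComp []) _
  | succ n ih =>
    obtain ⟨k, l, rfl⟩ := List.exists_cons_of_length_eq_add_one hl
    rw [List.length_cons, Nat.add_right_cancel_iff] at hl
    rw [word_cons, h.d_X_mul h1 h2]
    exact sub_mem (zsmul_mem (hl ▸ word_mem_degComp l) _) (OX_mul_mem_degComp _ (ih l hl))

theorem d_mem_degComp (h : OddDividedDiff a s d) {i : ℕ} (h1 : 1 ≤ i) (h2 : i + 1 ≤ a)
    {n : ℕ} {f : OPol a} (hf : f ∈ degComp a (n + 1)) : d i f ∈ degComp a n := by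
  induction hf using Submodule.span_induction with
  | mem f hf =>
    obtain ⟨l, hl, rfl⟩ := hf
    exact h.d_word_mem_degComp h1 h2 n l hl
  | zero => rw [map_zero]; exact zero_mem _
  | add f g _ _ hf hg => rw [map_add]; exact add_mem hf hg
  | smul n f _ hf => rw [map_zsmul]; exact zsmul_mem hf n

theorem dword_mem_degComp (h : OddDividedDiff a s d) {l : List ℕ} (hl : ValidWord a l)
    {n : ℕ} {f : OPol a} (hf : f ∈ degComp a (n + l.length)) : dword d l f ∈ degComp a n := by
  induction l generalizing n with
  | nil => exact hf
  | cons i l ih =>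
    obtain ⟨hi, hl⟩ := validWord_cons.1 hl
    refine h.d_mem_degComp hi.1 hi.2 (ih hl ?_)
    rwa [List.length_cons, ← Nat.add_assoc, Nat.add_right_comm] at hf

theorem schubert_mem_degComp (h : OddDividedDiff a s d) (hred : ∀ w, IsReducedWord w (red w))
    (w : Perm (Fin a)) : schubert a d red w ∈ degComp a (inv w) := by
  refine h.dword_mem_degComp (hred _).1 ?_
  rw [(hred _).2.2, add_comm, inv_inv_mul_rev, xdelta_eq_word, ← length_staircaseWord]
  exact word_mem_degComp _

end OddDividedDiff

end Homogeneity

end OddSchubert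

/-- OPol_a is a free left and right OΛ_a-module with basis the odd Schubert
polynomials; each 𝔰_w is homogeneous of degree 2ℓ(w), and
Σ_w q^{2ℓ(w)} = q^{a(a−1)/2}[a]! as polynomials. -/
theorem oddPol_free_over_oddSymmetric (a : ℕ)
    (s : ℕ → OPol a →+* OPol a)
    (hs : ∀ i j : ℕ, 1 ≤ i → i + 1 ≤ a → 1 ≤ j → j ≤ a →
      s i (xv a j) =
        if j = i then -xv a (i + 1) else if j = i + 1 then -xv a i else -xv a j)
    (d : ℕ → OPol a →+ OPol a)
    (hd1 : ∀ i : ℕ, 1 ≤ i → i + 1 ≤ a → d i 1 = 0)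
    (hdx : ∀ i j : ℕ, 1 ≤ i → i + 1 ≤ a → 1 ≤ j → j ≤ a →
      d i (xv a j) = if j = i ∨ j = i + 1 then 1 else 0)
    (hdL : ∀ i : ℕ, 1 ≤ i → i + 1 ≤ a → ∀ f g : OPol a,
      d i (f * g) = d i f * g + s i f * d i g)
    (red : Equiv.Perm (Fin a) → List ℕ)
    (hred1 : ∀ w, ∀ i ∈ red w, 1 ≤ i ∧ i + 1 ≤ a)
    (hred2 : ∀ w, wordPerm a (red w) = w)
    (hred3 : ∀ w, ∀ l : List ℕ, (∀ i ∈ l, 1 ≤ i ∧ i + 1 ≤ a) → wordPerm a l = w →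
      (red w).length ≤ l.length) :
    (∀ f : OPol a,
      ∃! c : Equiv.Perm (Fin a) →
          ↥(⨅ i ∈ Finset.Icc 1 (a - 1), LinearMap.ker (d i).toIntLinearMap),
        f = ∑ w : Equiv.Perm (Fin a), (c w : OPol a) * schubert a d red w) ∧
    (∀ f : OPol a,
      ∃! c : Equiv.Perm (Fin a) →
          ↥(⨅ i ∈ Finset.Icc 1 (a - 1), LinearMap.ker (d i).toIntLinearMap),
        f = ∑ w : Equiv.Perm (Fin a), schubert a d red w * (c w : OPol a)) ∧
    (∀ w : Equiv.Perm (Fin a), schubert a d red w ∈ degComp a ((red w).length)) ∧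
    (∑ w : Equiv.Perm (Fin a), (Polynomial.X : Polynomial ℤ) ^ (2 * (red w).length) =
      ∏ i ∈ Finset.range a, ∑ j ∈ Finset.range (i + 1),
        (Polynomial.X : Polynomial ℤ) ^ (2 * j)) := by
  have h := OddSchubert.OddDividedDiff.mk_of_xv hs hd1 hdx hdL
  have hred : ∀ w, OddSchubert.IsReducedWord w (red w) := fun w =>
    OddSchubert.isReducedWord_of_length_le (hred1 w) (hred2 w) (hred3 w)
  refine ⟨fun f => ?_, fun f => ?_, fun w => ?_, ?_⟩
  · obtain ⟨c, hc, hf⟩ := h.exists_left_expansion hred f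
    refine ⟨fun w => ⟨c w, OddSchubert.mem_iInf_ker_iff.2 (hc w)⟩, hf, fun b hb => ?_⟩
    funext w
    refine Subtype.ext (sub_eq_zero.1 (h.eq_zero_of_sum_mul_schubert hred
      (c := fun w => (b w : OPol a) - c w)
      (fun w => sub_mem (OddSchubert.mem_iInf_ker_iff.1 (b w).2) (hc w)) ?_ w))
    simp only [sub_mul, Finset.sum_sub_distrib]
    rw [← hb, ← hf, sub_self]
  · obtain ⟨c, hc, hf⟩ := h.exists_right_expansion hred f
    refine ⟨fun w => ⟨c w, OddSchubert.mem_iInf_ker_iff.2 (hc w)⟩, hf, fun b hb => ?_⟩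
    funext w
    refine Subtype.ext (sub_eq_zero.1 (h.eq_zero_of_sum_schubert_mul hred
      (c := fun w => (b w : OPol a) - c w)
      (fun w => sub_mem (OddSchubert.mem_iInf_ker_iff.1 (b w).2) (hc w)) ?_ w))
    simp only [mul_sub, Finset.sum_sub_distrib]
    rw [← hb, ← hf, sub_self]
  · rw [(hred w).2.2]
    exact h.schubert_mem_degComp hred w
  · simp only [(hred _).2.2]
    exact OddSchubert.sum_X_pow_inv a
end
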